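/- Let K = ℚ(√-11), let u = √-11 ∈ K, and let σ be the nontrivial automorphism of K over ℚ. In K(t)[x] (t the generator of the rational function field), set f_C(t,x) = (21u·x + 13u - 2x^3 - 54x^2 - 321x - 83)^3·(69u·x + 1573u - 2x^3 - 102x^2 - 1713x - 10043) + 2^9·3^12·(253u + 67)·t·x, and let f_{C2}(t,x) = f_C(t,x)·(σf_C)(t,x), where σf_C is obtained by applying σ to all coefficients. Then f_{C2} has all coefficients in ℚ(t), and the Galois group of f_{C2} over ℚ(t) has cardinality 190080 (the order of the group M₁₂.2 = Aut(M₁₂)). -/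

import Mathlib

section PermutationGroups

open scoped Pointwise

variable {G α : Type*} [Group G] [MulAction G α]

/-- The number of points of a finite set fixed by a group element. -/
def fixCount [Fintype α] [DecidableEq α] (g : G) : ℕ :=
  (Finset.univ.filter fun x : α => g • x = x).card

lemma period_image_card [DecidableEq α] (g : G) (x : α) :
    ((Finset.range (Function.minimalPeriod (g • ·) x)).image fun i => g ^ i • x).card =
      Function.minimalPeriod (g • ·) x := by
  rw [Finset.card_image_of_injOn, Finset.card_range]
  intro i hi j hj h
  have hi' : i < Function.minimalPeriod (g • ·) x := by simpa using hi
  have hj' : j < Function.minimalPeriod (g • ·) x := by simpa using hj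
  refine Function.iterate_injOn_Iio_minimalPeriod (f := (g • · : α → α)) (x := x) hi' hj' ?_
  simpa only [smul_iterate] using h

lemma pow_smul_mem_of_stable {g : G} {O : Finset α} (hO : ∀ x ∈ O, g • x ∈ O) {x : α} (hx : x ∈ O)
    (i : ℕ) : g ^ i • x ∈ O := by
  induction i with
  | zero => simpa using hx
  | succ k ih => rw [pow_succ', mul_smul]; exact hO _ ih

lemma minimalPeriod_le_card [DecidableEq α] {g : G} {O : Finset α} (hO : ∀ x ∈ O, g • x ∈ O) {x : α}
    (hx : x ∈ O) : Function.minimalPeriod (g • ·) x ≤ O.card := by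
  rw [← period_image_card g x]
  refine Finset.card_le_card fun y hy => ?_
  obtain ⟨i, -, rfl⟩ := Finset.mem_image.1 hy
  exact pow_smul_mem_of_stable hO hx i

lemma dvd_card_of_minimalPeriod [DecidableEq α] {g : G} {n : ℕ} {O : Finset α}
    (hO : ∀ x ∈ O, g • x ∈ O)
    (hn : ∀ x ∈ O, Function.minimalPeriod (g • ·) x = n) : n ∣ O.card := by
  rcases Nat.eq_zero_or_pos n with rfl | hpos
  · rcases O.eq_empty_or_nonempty with rfl | ⟨x, hx⟩
    · simp
    · have hfin : ((Finset.range (O.card + 1)).image fun i => g ^ i • x).card ≤ O.card := by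
        refine Finset.card_le_card fun y hy => ?_
        obtain ⟨i, -, rfl⟩ := Finset.mem_image.1 hy
        exact pow_smul_mem_of_stable hO hx i
      obtain ⟨i, hi, j, hj, hij, h⟩ := Finset.exists_ne_map_eq_of_card_lt_of_maps_to
        (s := Finset.range (O.card + 1)) (t := O) (by simp)
        (f := fun i => g ^ i • x) (fun i _ => pow_smul_mem_of_stable hO hx i)
      exfalso
      wlog hlt : i < j generalizing i j
      · exact this j hj i hi hij.symm h.symm (by omega)
      have hper : Function.IsPeriodicPt (g • · : α → α) (j - i) x := by
        have h2 : g ^ i • x = g ^ j • x := h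
        have h3 : g ^ j = g ^ i * g ^ (j - i) := by rw [← pow_add]; congr 1; omega
        rw [h3, mul_smul] at h2
        have h4 := (smul_left_cancel _ h2).symm
        rw [Function.IsPeriodicPt, Function.IsFixedPt, smul_iterate]
        exact h4
      have := hper.minimalPeriod_pos (by omega)
      have h5 := hn x hx
      omega
  · set orb : α → Finset α := fun x => (Finset.range n).image fun i => g ^ i • x with horb
    have hgn : ∀ x ∈ O, g ^ n • x = x := fun x hx => by
      have := Function.isPeriodicPt_minimalPeriod (g • · : α → α) x
      rw [hn x hx, Function.IsPeriodicPt, Function.IsFixedPt, smul_iterate] at this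
      exact this
    have key : ∀ x ∈ O, ∀ y ∈ O, orb y = orb x ↔ y ∈ orb x := by
      intro x hx y hy
      constructor
      · intro h
        rw [← h]
        exact Finset.mem_image.2 ⟨0, by simpa using hpos, by simp⟩
      · intro h
        obtain ⟨i, hi, rfl⟩ := Finset.mem_image.1 h
        have hc : ∀ z ∈ O, (orb z).card = n := fun z hz => by
          have h := period_image_card g z
          rw [hn z hz] at h
          exact h
        refine Finset.eq_of_subset_of_card_le ?_ (by rw [hc _ hx, hc _ hy])
        intro z hz
        obtain ⟨j, hj, rfl⟩ := Finset.mem_image.1 hz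
        refine Finset.mem_image.2 ⟨(j + i) % n, by simpa using Nat.mod_lt _ hpos, ?_⟩
        rw [← mul_smul, ← pow_add]
        conv_rhs => rw [← Nat.mod_add_div (j + i) n, pow_add, mul_smul]
        congr 1
        generalize (j + i) / n = m
        induction m with
        | zero => simp
        | succ m ih => rw [Nat.mul_succ, pow_add, mul_smul, hgn x hx, ← ih]
    rw [Finset.card_eq_sum_card_image orb O]
    refine Finset.dvd_sum fun b hb => ?_
    obtain ⟨x, hx, rfl⟩ := Finset.mem_image.1 hb
    have : {a ∈ O | orb a = orb x} = orb x := by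
      ext y
      rw [Finset.mem_filter]
      constructor
      · rintro ⟨hy, h⟩
        exact (key x hx y hy).1 h
      · intro h
        obtain ⟨i, hi, rfl⟩ := Finset.mem_image.1 h
        have hy := pow_smul_mem_of_stable hO hx i
        exact ⟨hy, (key x hx _ hy).2 h⟩
    rw [this]
    have h := period_image_card g x
    rw [hn x hx] at h
    simp only [horb]
    rw [h]

lemma minimalPeriod_smul_eq_prime {g : G} {p : ℕ} (hp : p.Prime) {x : α} (h : g ^ p • x = x)
    (h1 : g • x ≠ x) : Function.minimalPeriod (g • ·) x = p := by
  have := Fact.mk hp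
  refine Function.minimalPeriod_eq_prime ?_ h1
  rw [Function.IsPeriodicPt, Function.IsFixedPt, smul_iterate]
  exact h

lemma minimalPeriod_smul_eq_prime_pow {g : G} {p k : ℕ} (hp : p.Prime) {x : α}
    (h : g ^ p ^ (k + 1) • x = x) (h1 : g ^ p ^ k • x ≠ x) :
    Function.minimalPeriod (g • ·) x = p ^ (k + 1) := by
  have := Fact.mk hp
  refine Function.minimalPeriod_eq_prime_pow ?_ ?_ <;>
    rw [Function.IsPeriodicPt, Function.IsFixedPt, smul_iterate]
  · exact h1
  · exact h

/-- An action that is transitive on `n`-tuples is transitive on `(n+1)`-tuples as soon as the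
pointwise stabilizer of one `n`-tuple is transitive on the remaining points. -/
lemma isMultiplyPretransitive_succ {n : ℕ} (h : MulAction.IsMultiplyPretransitive G α n)
    (x₀ : Fin n ↪ α) (z₀ : α)
    (hz : ∀ w, w ∉ Set.range x₀ → ∃ g : G, (∀ i, g • x₀ i = x₀ i) ∧ g • z₀ = w) :
    MulAction.IsMultiplyPretransitive G α (n + 1) := by
  rw [MulAction.isMultiplyPretransitive_iff] at h ⊢
  have main : ∀ x : Fin (n + 1) ↪ α, ∃ g : G,
      (∀ i : Fin n, g • x i.castSucc = x₀ i) ∧ g • x (Fin.last n) = z₀ := by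
    intro x
    obtain ⟨g, hg⟩ := h (Fin.castSuccEmb.trans x) x₀
    have hg' : ∀ i : Fin n, g • x i.castSucc = x₀ i := fun i => by rw [← hg]; rfl
    obtain ⟨k, hk, hk'⟩ := hz (g • x (Fin.last n)) (by
      rintro ⟨i, hi⟩
      rw [← hg', smul_left_cancel_iff] at hi
      exact (Fin.castSucc_lt_last i).ne (x.injective hi))
    refine ⟨k⁻¹ * g, fun i => ?_, ?_⟩
    · rw [mul_smul, hg', inv_smul_eq_iff, hk]
    · rw [mul_smul, inv_smul_eq_iff, hk']
  intro x y
  obtain ⟨g, hg, hg'⟩ := main x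
  obtain ⟨k, hk, hk'⟩ := main y
  refine ⟨k⁻¹ * g, ?_⟩
  ext i
  change (k⁻¹ * g) • x i = y i
  refine Fin.lastCases ?_ (fun i => ?_) i
  · rw [mul_smul, hg', inv_smul_eq_iff, hk']
  · rw [mul_smul, hg, inv_smul_eq_iff, hk]

variable [Fintype α] [DecidableEq α]

lemma fix_pow_iff {g : G} {m : ℕ} (h : fixCount (α := α) (g ^ m) = fixCount (α := α) g) (x : α) :
    g ^ m • x = x ↔ g • x = x := by
  have hsub : (Finset.univ.filter fun x : α => g • x = x) ⊆
      (Finset.univ.filter fun x : α => g ^ m • x = x) := by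
    intro y hy
    rw [Finset.mem_filter] at hy ⊢
    refine ⟨hy.1, ?_⟩
    have hy2 : g • y = y := hy.2
    clear h
    induction m with
    | zero => simp
    | succ m ih => rw [pow_succ, mul_smul, hy2, ih]
  have := Finset.eq_of_subset_of_card_le hsub h.le
  have h2 := Finset.ext_iff.1 this x
  simpa using h2.symm

lemma fixCount_conj (g k : G) : fixCount (α := α) (k * g * k⁻¹) = fixCount (α := α) g := by
  unfold fixCount
  refine (Finset.card_bij (fun x _ => k • x) ?_ ?_ ?_).symm
  · intro x hx
    simp only [Finset.mem_filter, Finset.mem_univ, true_and] at hx ⊢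
    rw [← mul_smul, mul_assoc, inv_mul_cancel, mul_one, mul_smul, hx]
  · intro x _ y _ h
    exact smul_left_cancel _ h
  · intro y hy
    simp only [Finset.mem_filter, Finset.mem_univ, true_and] at hy
    refine ⟨k⁻¹ • y, ?_, by simp⟩
    simp only [Finset.mem_filter, Finset.mem_univ, true_and]
    conv_rhs => rw [← hy]
    rw [← mul_smul, ← mul_smul]
    congr 1
    group

/-- The orbit of a point under the pointwise stabilizer of a tuple. -/
lemma exists_orbit_finset {n : ℕ} (x₀ : Fin n ↪ α) (z₀ : α) (hz₀ : z₀ ∉ Set.range x₀) :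
    ∃ O : Finset α, z₀ ∈ O ∧ (∀ w ∈ O, w ∉ Set.range x₀) ∧
      (∀ g : G, (∀ i, g • x₀ i = x₀ i) → ∀ w ∈ O, g • w ∈ O) ∧
      (∀ w ∈ O, ∃ g : G, (∀ i, g • x₀ i = x₀ i) ∧ g • z₀ = w) ∧
      O.card + n ≤ Fintype.card α ∧
      (O.card + n = Fintype.card α → ∀ w, w ∉ Set.range x₀ → w ∈ O) := by
  classical
  set O : Finset α :=
    Finset.univ.filter fun w => ∃ g : G, (∀ i, g • x₀ i = x₀ i) ∧ g • z₀ = w with hO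
  have hdis : ∀ w ∈ O, w ∉ Set.range x₀ := by
    rintro w hw ⟨i, rfl⟩
    obtain ⟨g, hg, hgw⟩ := (Finset.mem_filter.1 hw).2
    rw [← hg i] at hgw
    exact hz₀ ⟨i, (smul_left_cancel _ hgw).symm⟩
  have hd : Disjoint O (Finset.univ.map x₀) := by
    rw [Finset.disjoint_left]
    intro w hw hw'
    obtain ⟨i, -, hi⟩ := Finset.mem_map.1 hw'
    exact hdis w hw ⟨i, hi⟩
  have hcard : (O ∪ Finset.univ.map x₀).card = O.card + n := by
    rw [Finset.card_union_of_disjoint hd]; simp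
  refine ⟨O, ?_, hdis, ?_, fun w hw => (Finset.mem_filter.1 hw).2, ?_, ?_⟩
  · exact Finset.mem_filter.2 ⟨Finset.mem_univ _, 1, by simp, by simp⟩
  · intro g hg w hw
    obtain ⟨k, hk, hkw⟩ := (Finset.mem_filter.1 hw).2
    refine Finset.mem_filter.2 ⟨Finset.mem_univ _, g * k, fun i => ?_, ?_⟩
    · rw [mul_smul, hk, hg]
    · rw [mul_smul, hkw]
  · rw [← hcard]; exact Finset.card_le_univ _
  · intro h w hw
    have : O ∪ Finset.univ.map x₀ = Finset.univ := by
      rw [← Finset.card_eq_iff_eq_univ, hcard, h]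
    have h2 := this ▸ Finset.mem_univ w
    rcases Finset.mem_union.1 h2 with h3 | h3
    · exact h3
    · obtain ⟨i, -, hi⟩ := Finset.mem_map.1 h3
      exact absurd ⟨i, hi⟩ hw

lemma isMultiplyPretransitive_one (hα : Fintype.card α = 12) {a b : G}
    (ha : fixCount (α := α) a = 1) (ha' : ∀ x : α, a ^ 11 • x = x)
    (hb : fixCount (α := α) b = 0) : MulAction.IsMultiplyPretransitive G α 1 := by
  obtain ⟨p, hp⟩ := Finset.card_eq_one.1 ha
  have hfix : ∀ x, a • x = x ↔ x = p := fun x => by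
    have := Finset.ext_iff.1 hp x
    simpa using this
  have h0 : MulAction.IsMultiplyPretransitive G α 0 := by
    rw [MulAction.isMultiplyPretransitive_iff]
    intro x y
    exact ⟨1, by ext i; exact i.elim0⟩
  have hbp : b • p ≠ p := by
    intro h
    rw [fixCount, Finset.card_eq_zero] at hb
    have := Finset.ext_iff.1 hb p
    simp [h] at this
  let x₀ : Fin 0 ↪ α := ⟨Fin.elim0, fun i => i.elim0⟩
  obtain ⟨O, hzO, -, hst, hO, hle, hfull⟩ := exists_orbit_finset (G := G) x₀ p (by simp)
  refine isMultiplyPretransitive_succ h0 x₀ p fun w hw => hO w (hfull ?_ w hw)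
  have h1 : b • p ∈ O := hst b (fun i => i.elim0) p hzO
  have h2 : Function.minimalPeriod (a • ·) (b • p) = 11 :=
    minimalPeriod_smul_eq_prime (by norm_num) (ha' _) (by rw [ne_eq, hfix]; exact hbp)
  have h3 : 11 ≤ (O.erase p).card := by
    rw [← h2]
    refine minimalPeriod_le_card ?_ (Finset.mem_erase.2 ⟨hbp, h1⟩)
    intro x hx
    obtain ⟨hx1, hx2⟩ := Finset.mem_erase.1 hx
    refine Finset.mem_erase.2 ⟨fun h => hx1 ?_, hst a (fun i => i.elim0) x hx2⟩
    have : a • p = p := (hfix p).2 rfl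
    rw [← this] at h
    exact smul_left_cancel _ h
  rw [Finset.card_erase_of_mem hzO] at h3
  omega

lemma isMultiplyPretransitive_two (hα : Fintype.card α = 12) {a b : G}
    (ha : fixCount (α := α) a = 1) (ha' : ∀ x : α, a ^ 11 • x = x)
    (hb : fixCount (α := α) b = 0) : MulAction.IsMultiplyPretransitive G α 2 := by
  have h1 := isMultiplyPretransitive_one hα ha ha' hb
  obtain ⟨p, hp⟩ := Finset.card_eq_one.1 ha
  have hfix : ∀ x, a • x = x ↔ x = p := fun x => by
    have := Finset.ext_iff.1 hp x
    simpa using this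
  let x₀ : Fin 1 ↪ α := ⟨fun _ => p, fun i j _ => Subsingleton.elim i j⟩
  have hx₀ : ∀ i, x₀ i = p := fun i => rfl
  obtain ⟨z, hz⟩ : ∃ z : α, z ≠ p := by
    have : Nontrivial α := Fintype.one_lt_card_iff_nontrivial.1 (by omega)
    exact exists_ne p
  obtain ⟨O, hzO, -, hst, hO, hle, hfull⟩ := exists_orbit_finset (G := G) x₀ z (by
    rintro ⟨i, hi⟩; exact hz hi.symm)
  refine isMultiplyPretransitive_succ h1 x₀ z fun w hw => hO w (hfull ?_ w hw)
  have h2 : Function.minimalPeriod (a • ·) z = 11 :=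
    minimalPeriod_smul_eq_prime (by norm_num) (ha' _) (by rw [ne_eq, hfix]; exact hz)
  have h3 : 11 ≤ O.card := by
    rw [← h2]
    exact minimalPeriod_le_card (hst a fun i => (hfix p).2 rfl) hzO
  omega

/-- Triple transitivity from elements of cycle types `10·2` and `8·2·1·1`. -/
lemma isMultiplyPretransitive_three (hα : Fintype.card α = 12)
    (h2 : MulAction.IsMultiplyPretransitive G α 2) {b c : G}
    (hb2 : fixCount (α := α) (b ^ 2) = 2) (hb' : ∀ x : α, b ^ 10 • x = x)
    (hc : fixCount (α := α) c = 2) (hc4 : fixCount (α := α) (c ^ 4) = 4)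
    (hc' : ∀ x : α, c ^ 8 • x = x) : MulAction.IsMultiplyPretransitive G α 3 := by
  obtain ⟨p, q, hpq, hfc⟩ := Finset.card_eq_two.1 hc
  obtain ⟨p', q', hpq', hfb⟩ := Finset.card_eq_two.1 hb2
  have hfixc : ∀ x, c • x = x ↔ x = p ∨ x = q := fun x => by
    simpa using Finset.ext_iff.1 hfc x
  have hfixb : ∀ x, b ^ 2 • x = x ↔ x = p' ∨ x = q' := fun x => by
    simpa using Finset.ext_iff.1 hfb x
  let x₀ : Fin 2 ↪ α := ⟨![p, q], by
    intro i j h; fin_cases i <;> fin_cases j <;> simp_all⟩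
  let x₁ : Fin 2 ↪ α := ⟨![p', q'], by
    intro i j h; fin_cases i <;> fin_cases j <;> simp_all⟩
  obtain ⟨k, hk⟩ := MulAction.isMultiplyPretransitive_iff.1 h2 x₁ x₀
  have hkp : k • p' = p := DFunLike.congr_fun hk 0
  have hkq : k • q' = q := DFunLike.congr_fun hk 1
  set d := k * b ^ 2 * k⁻¹ with hd
  have hfixd : ∀ x, d • x = x ↔ x = p ∨ x = q := fun x => by
    rw [hd, mul_smul, mul_smul, ← eq_inv_smul_iff, hfixb, ← hkp, ← hkq, inv_smul_eq_iff,
      inv_smul_eq_iff]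
  have hd5 : ∀ x : α, d ^ 5 • x = x := fun x => by
    rw [hd, conj_pow, ← pow_mul, mul_smul, mul_smul, hb', smul_inv_smul]
  have hrange : ∀ w, w ∉ Set.range x₀ ↔ ¬(w = p ∨ w = q) := by
    intro w
    rw [not_iff_not]
    constructor
    · rintro ⟨i, rfl⟩
      fin_cases i
      · exact Or.inl rfl
      · exact Or.inr rfl
    · rintro (rfl | rfl)
      · exact ⟨0, rfl⟩
      · exact ⟨1, rfl⟩
  obtain ⟨z, hz⟩ : ∃ z : α, c ^ 4 • z ≠ z := by
    by_contra! h
    have : fixCount (α := α) (c ^ 4) = 12 := by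
      rw [fixCount, Finset.filter_true_of_mem fun x _ => h x, Finset.card_univ, hα]
    omega
  have hz1 : z ∉ Set.range x₀ := by
    rw [hrange, ← hfixc]
    intro h
    apply hz
    rw [pow_succ, mul_smul, h, pow_succ, mul_smul, h, pow_succ, mul_smul, h, pow_one, h]
  have st : ∀ g : G, g • p = p → g • q = q → ∀ i, g • x₀ i = x₀ i := by
    intro g hgp hgq i
    fin_cases i
    · exact hgp
    · exact hgq
  obtain ⟨O, hzO, hOr, hst, hO, hle, hfull⟩ := exists_orbit_finset (G := G) x₀ z hz1
  refine isMultiplyPretransitive_succ h2 x₀ z fun w hw => hO w (hfull ?_ w hw)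
  have h8 : 8 ≤ O.card := by
    have := minimalPeriod_smul_eq_prime_pow (g := c) (p := 2) (k := 2) (by norm_num) (hc' z) hz
    have h := minimalPeriod_le_card (hst c (st c ((hfixc p).2 (.inl rfl)) ((hfixc q).2 (.inr rfl)))) hzO
    omega
  have h5 : 5 ∣ O.card := by
    refine dvd_card_of_minimalPeriod
      (hst d (st d ((hfixd p).2 (.inl rfl)) ((hfixd q).2 (.inr rfl)))) fun x hx => ?_
    exact minimalPeriod_smul_eq_prime (by norm_num) (hd5 x)
      (by rw [ne_eq, hfixd, ← hrange]; exact hOr x hx)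
  omega

/-- Quadruple transitivity from elements of cycle types `8·2·1·1` and `6·3·2·1`. -/
lemma isMultiplyPretransitive_four (hα : Fintype.card α = 12)
    (h3 : MulAction.IsMultiplyPretransitive G α 3) {c d : G}
    (hc2 : fixCount (α := α) (c ^ 2) = 4) (hc4 : fixCount (α := α) (c ^ 4) = 4)
    (hc' : ∀ x : α, c ^ 8 • x = x)
    (hd : fixCount (α := α) (d ^ 2) = 3) (hd' : ∀ x : α, d ^ 6 • x = x) :
    MulAction.IsMultiplyPretransitive G α 4 := by
  obtain ⟨F, hF⟩ : ∃ F : Finset α, F = Finset.univ.filter fun x : α => c ^ 2 • x = x := ⟨_, rfl⟩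
  have hFc : F.card = 4 := by rw [hF]; exact hc2
  have hfixc : ∀ x, c ^ 2 • x = x ↔ x ∈ F := fun x => by simp [hF]
  obtain ⟨z, hzF⟩ : F.Nonempty := by rw [← Finset.card_pos]; omega
  obtain ⟨p, q, r, hpq, hpr, hqr, hE⟩ := Finset.card_eq_three.1
    (show (F.erase z).card = 3 by rw [Finset.card_erase_of_mem hzF, hFc])
  obtain ⟨p', q', r', hpq', hpr', hqr', hfd⟩ := Finset.card_eq_three.1 hd
  have hfixd : ∀ x, d ^ 2 • x = x ↔ x = p' ∨ x = q' ∨ x = r' := fun x => by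
    simpa using Finset.ext_iff.1 hfd x
  have hFE : ∀ x, x ∈ F ↔ x = z ∨ (x = p ∨ x = q ∨ x = r) := fun x => by
    rw [← Finset.insert_erase hzF, hE]; simp
  have hzE : z ≠ p ∧ z ≠ q ∧ z ≠ r := by
    have := Finset.notMem_erase z F
    rw [hE] at this
    simpa using this
  let x₀ : Fin 3 ↪ α := ⟨![p, q, r], by
    intro i j h; fin_cases i <;> fin_cases j <;> first | rfl | (exfalso; simp at h; tauto)⟩
  let x₁ : Fin 3 ↪ α := ⟨![p', q', r'], by
    intro i j h; fin_cases i <;> fin_cases j <;> first | rfl | (exfalso; simp at h; tauto)⟩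
  obtain ⟨k, hk⟩ := MulAction.isMultiplyPretransitive_iff.1 h3 x₁ x₀
  have hkp : k • p' = p := DFunLike.congr_fun hk 0
  have hkq : k • q' = q := DFunLike.congr_fun hk 1
  have hkr : k • r' = r := DFunLike.congr_fun hk 2
  set e := k * d ^ 2 * k⁻¹ with he
  have hfixe : ∀ x, e • x = x ↔ x = p ∨ x = q ∨ x = r := fun x => by
    rw [he, mul_smul, mul_smul, ← eq_inv_smul_iff, hfixd, ← hkp, ← hkq, ← hkr, inv_smul_eq_iff,
      inv_smul_eq_iff, inv_smul_eq_iff]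
  have he3 : ∀ x : α, e ^ 3 • x = x := fun x => by
    rw [he, conj_pow, ← pow_mul, mul_smul, mul_smul, hd', smul_inv_smul]
  have hrange : ∀ w, w ∉ Set.range x₀ ↔ ¬(w = p ∨ w = q ∨ w = r) := by
    intro w
    rw [not_iff_not]
    constructor
    · rintro ⟨i, rfl⟩
      fin_cases i
      · exact Or.inl rfl
      · exact Or.inr (Or.inl rfl)
      · exact Or.inr (Or.inr rfl)
    · rintro (rfl | rfl | rfl)
      · exact ⟨0, rfl⟩
      · exact ⟨1, rfl⟩
      · exact ⟨2, rfl⟩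
  have st : ∀ g : G, g • p = p → g • q = q → g • r = r → ∀ i, g • x₀ i = x₀ i := by
    intro g hgp hgq hgr i
    fin_cases i
    · exact hgp
    · exact hgq
    · exact hgr
  obtain ⟨O, hzO, hOr, hst, hO, hle, hfull⟩ := exists_orbit_finset (G := G) x₀ z (by
    rw [hrange]; tauto)
  refine isMultiplyPretransitive_succ h3 x₀ z fun w hw => hO w (hfull ?_ w hw)
  have h3' : 3 ∣ O.card := by
    refine dvd_card_of_minimalPeriod (hst e (st e ((hfixe p).2 (by tauto)) ((hfixe q).2 (by tauto))
      ((hfixe r).2 (by tauto)))) fun x hx => ?_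
    exact minimalPeriod_smul_eq_prime (by norm_num) (he3 x)
      (by rw [ne_eq, hfixe, ← hrange]; exact hOr x hx)
  have hcst := hst (c ^ 2) (st (c ^ 2) ((hfixc p).2 ((hFE p).2 (by tauto)))
    ((hfixc q).2 ((hFE q).2 (by tauto))) ((hfixc r).2 ((hFE r).2 (by tauto))))
  have h4 : 4 ∣ (O.erase z).card := by
    refine dvd_card_of_minimalPeriod (g := c ^ 2) (fun x hx => ?_) fun x hx => ?_
    · obtain ⟨hx1, hx2⟩ := Finset.mem_erase.1 hx
      refine Finset.mem_erase.2 ⟨fun h => hx1 ?_, hcst x hx2⟩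
      have : c ^ 2 • z = z := (hfixc z).2 hzF
      rw [← this] at h
      exact smul_left_cancel _ h
    · obtain ⟨hx1, hx2⟩ := Finset.mem_erase.1 hx
      have hxF : x ∉ F := by
        rw [hFE]
        rintro (h | h)
        · exact hx1 h
        · exact (hrange x).1 (hOr x hx2) h
      refine minimalPeriod_smul_eq_prime_pow (g := c ^ 2) (p := 2) (k := 1) (by norm_num) ?_ ?_
      · rw [← pow_mul]; exact hc' x
      · rw [ne_eq, fix_pow_iff (g := c ^ 2) (m := 2 ^ 1) (by rw [← pow_mul, hc2]; exact hc4), hfixc]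
        exact hxF
  rw [Finset.card_erase_of_mem hzO] at h4
  have hpos : 0 < O.card := Finset.card_pos.2 ⟨z, hzO⟩
  omega

end PermutationGroups

section HexadSystems

open scoped Pointwise

variable {G α : Type*} [Group G] [MulAction G α] [Fintype α] [DecidableEq α]

lemma exists_smul_eq_of_card_eq {n : ℕ} (h : MulAction.IsMultiplyPretransitive G α n)
    {s t : Finset α} (hs : s.card = n) (ht : t.card = n) : ∃ g : G, g • s = t := by
  let e : ∀ u : Finset α, u.card = n → (Fin n ↪ α) := fun u hu =>
    ((Fintype.equivFinOfCardEq (α := u) (by simpa using hu)).symm.toEmbedding).trans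
      (Function.Embedding.subtype _)
  have he : ∀ u hu, Finset.univ.image (e u hu) = u := by
    intro u hu
    ext x
    simp only [Finset.mem_image, Finset.mem_univ, true_and]
    constructor
    · rintro ⟨i, rfl⟩
      exact Subtype.coe_prop _
    · intro hx
      exact ⟨Fintype.equivFinOfCardEq (α := u) (by simpa using hu) ⟨x, hx⟩, by simp [e]⟩
  obtain ⟨g, hg⟩ := MulAction.isMultiplyPretransitive_iff.1 h (e s hs) (e t ht)
  refine ⟨g, ?_⟩
  rw [← he t ht, ← hg]
  conv_lhs => rw [← he s hs]
  rw [← Finset.image_smul, Finset.image_image]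
  rfl

/-- Double counting for a family of six-element sets invariant under a group transitive on
`i`-element sets. -/
lemma choose_mul_sum_choose_inter (hα : Fintype.card α = 12) {i : ℕ}
    (h : MulAction.IsMultiplyPretransitive G α i) (hi : i ≤ 6)
    {O : Finset (Finset α)} (h6 : ∀ H ∈ O, H.card = 6) (hst : ∀ (g : G), ∀ H ∈ O, g • H ∈ O)
    {X : Finset α} (hX : X.card = 6) :
    Nat.choose 12 i * ∑ H ∈ O, Nat.choose (H ∩ X).card i = Nat.choose 6 i ^ 2 * O.card := by
  obtain ⟨T₀, hT₀⟩ : ∃ T : Finset α, T.card = i := by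
    obtain ⟨T, -, hT⟩ := Finset.exists_subset_card_eq (s := X) (n := i) (by omega)
    exact ⟨T, hT⟩
  set l := (O.filter fun H => T₀ ⊆ H).card with hl
  have hconst : ∀ T : Finset α, T.card = i → (O.filter fun H => T ⊆ H).card = l := by
    intro T hT
    obtain ⟨g, rfl⟩ := exists_smul_eq_of_card_eq h hT₀ hT
    refine (Finset.card_bij (fun H _ => g • H) ?_ ?_ ?_).symm
    · intro H hH
      rw [Finset.mem_filter] at hH ⊢
      exact ⟨hst g H hH.1, Finset.smul_finset_subset_smul_finset hH.2⟩
    · intro a _ b _ hab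
      exact smul_left_cancel _ hab
    · intro H hH
      rw [Finset.mem_filter] at hH
      refine ⟨g⁻¹ • H, ?_, by simp⟩
      rw [Finset.mem_filter]
      refine ⟨hst _ H hH.1, ?_⟩
      rw [Finset.subset_smul_finset_iff, inv_inv]
      exact hH.2
  have hdc : ∀ U : Finset α, ∑ H ∈ O, Nat.choose (H ∩ U).card i = Nat.choose U.card i * l := by
    intro U
    have h1 := Finset.sum_card_bipartiteAbove_eq_sum_card_bipartiteBelow
      (s := O) (t := U.powersetCard i) (fun H T => T ⊆ H)
    have h2 : ∀ H ∈ O, (Finset.bipartiteAbove (fun H T => T ⊆ H) (U.powersetCard i) H).card =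
        Nat.choose (H ∩ U).card i := by
      intro H _
      rw [← Finset.card_powersetCard]
      congr 1
      ext T
      simp only [Finset.bipartiteAbove, Finset.mem_filter, Finset.mem_powersetCard,
        Finset.subset_inter_iff]
      tauto
    rw [Finset.sum_congr rfl h2] at h1
    rw [h1, Finset.sum_congr rfl (g := fun _ => l)]
    · simp
    · intro T hT
      exact hconst T (Finset.mem_powersetCard.1 hT).2
  have h3 := hdc Finset.univ
  rw [Finset.sum_congr rfl (g := fun _ => Nat.choose 6 i)] at h3
  · rw [Finset.card_univ, hα, Finset.sum_const, smul_eq_mul] at h3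
    rw [hdc X, hX, mul_left_comm, ← h3]
    ring
  · intro H hH
    rw [Finset.inter_univ, h6 H hH]

/-- A group-invariant Steiner system `S(5, 6, 12)`, closed under complements. -/
structure IsHexadSystem (G : Type*) {α : Type*} [Group G] [MulAction G α] [Fintype α]
    [DecidableEq α] (O : Finset (Finset α)) : Prop where
  card_eq : ∀ H ∈ O, H.card = 6
  compl_mem : ∀ H ∈ O, Hᶜ ∈ O
  smul_mem : ∀ (g : G), ∀ H ∈ O, g • H ∈ O
  exists_smul_eq : ∀ H ∈ O, ∀ H' ∈ O, ∃ g : G, g • H = H'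
  card_inter_le : ∀ H ∈ O, ∀ H' ∈ O, H ≠ H' → (H ∩ H').card ≤ 4
  exists_mem : ∀ T : Finset α, T.card = 5 → ∃ H ∈ O, T ⊆ H
  card_family : O.card = 132

lemma isHexadSystem_of_card_le (hα : Fintype.card α = 12)
    (h : MulAction.IsMultiplyPretransitive G α 4)
    {O : Finset (Finset α)} (h6 : ∀ H ∈ O, H.card = 6) (hc : ∀ H ∈ O, Hᶜ ∈ O)
    (hst : ∀ (g : G), ∀ H ∈ O, g • H ∈ O)
    (htr : ∀ H ∈ O, ∀ H' ∈ O, ∃ g : G, g • H = H')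
    (hne : O.Nonempty) (hle : O.card ≤ 132) : IsHexadSystem G O := by
  obtain ⟨q, hqdef⟩ : ∃ q : ℕ → ℤ, ∀ m : ℕ, q m = ((m : ℤ) - 2) * (m - 3) ^ 2 * (m - 4) :=
    ⟨_, fun _ => rfl⟩
  have hq : ∀ m : ℕ, m ≤ 6 → (72 * (m.choose 0 : ℤ) - 60 * m.choose 1 + 48 * m.choose 2
      - 36 * m.choose 3 + 24 * m.choose 4) = q m := by
    intro m hm
    rw [hqdef]
    interval_cases m <;> simp [Nat.choose]
  have hqn : ∀ m : ℕ, 0 ≤ q m := by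
    intro m
    rw [hqdef]
    have : (0 : ℤ) ≤ (m - 2) * (m - 4) ∨ m = 3 := by
      rcases lt_trichotomy m 3 with h | h | h
      · left; nlinarith [(by exact_mod_cast h : (m : ℤ) < 3)]
      · right; exact h
      · left
        have h' : (4 : ℤ) ≤ m := by exact_mod_cast h
        nlinarith
    rcases this with h | rfl
    · nlinarith [mul_nonneg h (sq_nonneg ((m : ℤ) - 3))]
    · norm_num
  have key : ∀ X ∈ O, 11 * ∑ H ∈ O, q (H ∩ X).card = 12 * O.card := by
    intro X hX
    have c : ∀ i, i ≤ 4 → _ := fun i hi => choose_mul_sum_choose_inter hα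
      (MulAction.isMultiplyPretransitive_of_le (G := G) (α := α) (n := 4) hi
        (by rw [Nat.card_eq_fintype_card, hα]; norm_num)) (by omega) h6 hst (h6 X hX)
    have c0 := c 0 (by norm_num)
    have c1 := c 1 (by norm_num)
    have c2 := c 2 (by norm_num)
    have c3 := c 3 (by norm_num)
    have c4 := c 4 (by norm_num)
    rw [Finset.sum_congr rfl fun H hH => (hq _ ((Finset.card_le_card
      (Finset.inter_subset_left)).trans (h6 H hH).le)).symm]
    simp only [Finset.sum_add_distrib, Finset.sum_sub_distrib, ← Finset.mul_sum, ← Nat.cast_sum]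
    generalize ∑ H ∈ O, (H ∩ X).card.choose 0 = s0 at *
    generalize ∑ H ∈ O, (H ∩ X).card.choose 1 = s1 at *
    generalize ∑ H ∈ O, (H ∩ X).card.choose 2 = s2 at *
    generalize ∑ H ∈ O, (H ∩ X).card.choose 3 = s3 at *
    generalize ∑ H ∈ O, (H ∩ X).card.choose 4 = s4 at *
    norm_num [Nat.choose] at c0 c1 c2 c3 c4
    omega
  have hXc : ∀ X ∈ O, Xᶜ ≠ X := by
    intro X hX hh
    obtain ⟨x, hx⟩ := Finset.card_pos.1 (by rw [h6 X hX]; norm_num)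
    have h2 := hx
    rw [← hh, Finset.mem_compl] at h2
    exact h2 hx
  have bound : ∀ X ∈ O, O.card = 132 ∧ ∀ H ∈ O, H ≠ X → H ≠ Xᶜ →
      q (H ∩ X).card = 0 := by
    intro X hX
    have h1 := key X hX
    have h2 : Xᶜ ∈ O.erase X := Finset.mem_erase.2 ⟨hXc X hX, hc X hX⟩
    rw [← Finset.add_sum_erase _ _ hX, ← Finset.add_sum_erase _ _ h2] at h1
    rw [Finset.inter_self, h6 X hX, Finset.inter_comm, Finset.inter_compl] at h1
    rw [show q 6 = 72 by rw [hqdef]; norm_num,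
      show q (∅ : Finset α).card = 72 by rw [hqdef]; norm_num] at h1
    have h3 : (0 : ℤ) ≤ ∑ H ∈ (O.erase X).erase Xᶜ,
        q (H ∩ X).card :=
      Finset.sum_nonneg fun H _ => hqn _
    have h4 : ∑ H ∈ (O.erase X).erase Xᶜ,
        q (H ∩ X).card = 0 := by omega
    refine ⟨by omega, fun H hH h5 h6 => ?_⟩
    exact (Finset.sum_eq_zero_iff_of_nonneg fun H _ => hqn _).1 h4 H
      (Finset.mem_erase.2 ⟨h6, Finset.mem_erase.2 ⟨h5, hH⟩⟩)
  have hinter : ∀ H ∈ O, ∀ H' ∈ O, H ≠ H' → (H ∩ H').card ≤ 4 := by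
    intro H hH H' hH' hne'
    by_cases h7 : H = H'ᶜ
    · rw [h7, Finset.inter_comm, Finset.inter_compl]; simp
    · have h8 := (bound H' hH').2 H hH hne' h7
      rw [hqdef] at h8
      rcases mul_eq_zero.1 h8 with h9 | h9
      · rcases mul_eq_zero.1 h9 with h10 | h10
        · omega
        · have := pow_eq_zero_iff (two_ne_zero) |>.1 h10
          omega
      · omega
  obtain ⟨X, hX⟩ := hne
  have h132 := (bound X hX).1
  refine ⟨h6, hc, hst, htr, hinter, ?_, h132⟩
  have hone : ∀ T ∈ (Finset.univ : Finset α).powersetCard 5,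
      (O.filter fun H => T ⊆ H).card ≤ 1 := by
    intro T hT
    rw [Finset.card_le_one]
    intro a ha b hb
    rw [Finset.mem_filter] at ha hb
    by_contra hab
    have h1 := hinter a ha.1 b hb.1 hab
    have h2 := Finset.card_le_card (Finset.subset_inter ha.2 hb.2)
    rw [(Finset.mem_powersetCard.1 hT).2] at h2
    omega
  have h1 := Finset.sum_card_bipartiteAbove_eq_sum_card_bipartiteBelow
      (s := O) (t := (Finset.univ : Finset α).powersetCard 5) (fun H T => T ⊆ H)
  have h2 : ∀ H ∈ O, (Finset.bipartiteAbove (fun H T => T ⊆ H)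
      ((Finset.univ : Finset α).powersetCard 5) H).card = 6 := by
    intro H hH
    have : Finset.bipartiteAbove (fun H T => T ⊆ H) ((Finset.univ : Finset α).powersetCard 5) H =
        H.powersetCard 5 := by
      ext T
      simp only [Finset.bipartiteAbove, Finset.mem_filter, Finset.mem_powersetCard,
        Finset.subset_univ, true_and]
      tauto
    rw [this, Finset.card_powersetCard, h6 H hH]
    rfl
  rw [Finset.sum_congr rfl h2, Finset.sum_const, h132] at h1
  intro T hT
  have hTm : T ∈ (Finset.univ : Finset α).powersetCard 5 :=
    Finset.mem_powersetCard.2 ⟨Finset.subset_univ _, hT⟩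
  have h3 : ∑ T ∈ (Finset.univ : Finset α).powersetCard 5, (O.filter fun H => T ⊆ H).card =
      ∑ T ∈ (Finset.univ : Finset α).powersetCard 5, 1 := by
    rw [Finset.sum_const, Finset.card_powersetCard, Finset.card_univ, hα]
    exact h1.symm
  have h4 := (Finset.sum_eq_sum_iff_of_le hone).1 h3 T hTm
  obtain ⟨H, hH⟩ := Finset.card_pos.1 (by rw [h4]; norm_num)
  rw [Finset.mem_filter] at hH
  exact ⟨H, hH.1, hH.2⟩

namespace IsHexadSystem

variable {O : Finset (Finset α)}

lemma eq_of_subset (hO : IsHexadSystem G O) {H H' T : Finset α} (hH : H ∈ O) (hH' : H' ∈ O)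
    (hT : 5 ≤ T.card) (h : T ⊆ H) (h' : T ⊆ H') : H = H' := by
  by_contra hne
  have h1 := hO.card_inter_le H hH H' hH' hne
  have h2 := Finset.card_le_card (Finset.subset_inter h h')
  omega

lemma exists_partner (hO : IsHexadSystem G O) {X T : Finset α} (hX : X ∈ O) (hT : T ⊆ X)
    (hT4 : T.card = 4) {y : α} (hy : y ∉ X) :
    ∃ z, z ∉ X ∧ z ≠ y ∧ insert y (insert z T) ∈ O := by
  have hyT : y ∉ T := fun h => hy (hT h)
  have h5 : (insert y T).card = 5 := by rw [Finset.card_insert_of_notMem hyT, hT4]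
  obtain ⟨H, hH, hTH⟩ := hO.exists_mem _ h5
  obtain ⟨z, hz⟩ := Finset.card_eq_one.1 (show (H \ insert y T).card = 1 by
    rw [Finset.card_sdiff_of_subset hTH, hO.card_eq H hH, h5])
  have hzm : z ∈ H ∧ z ∉ insert y T := by
    rw [← Finset.mem_sdiff, hz]; exact Finset.mem_singleton_self z
  have hzT : z ∉ T := fun h => hzm.2 (Finset.mem_insert_of_mem h)
  have hzX : z ∉ X := by
    intro hzX
    have : H = X := hO.eq_of_subset hH hX (T := insert z T)
      (by rw [Finset.card_insert_of_notMem hzT, hT4])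
      (Finset.insert_subset hzm.1 fun t ht => hTH (Finset.mem_insert_of_mem ht))
      (Finset.insert_subset hzX hT)
    exact hy (this ▸ hTH (Finset.mem_insert_self _ _))
  have hzy : z ≠ y := fun h => hzm.2 (h ▸ Finset.mem_insert_self _ _)
  refine ⟨z, hzX, hzy, ?_⟩
  have : insert y (insert z T) = H := by
    rw [Finset.insert_comm]
    refine Finset.eq_of_subset_of_card_le (Finset.insert_subset hzm.1 hTH) ?_
    rw [Finset.card_insert_of_notMem hzm.2, h5, hO.card_eq H hH]
  rwa [this]

lemma partner_unique (hO : IsHexadSystem G O) {T : Finset α} (hT4 : T.card = 4)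
    {y z z' : α} (hy : y ∉ T) (hz : z ∉ insert y T) (h : insert y (insert z T) ∈ O)
    (h' : insert y (insert z' T) ∈ O) : z = z' := by
  have h1 := hO.eq_of_subset h h' (T := insert y T)
    (by rw [Finset.card_insert_of_notMem hy, hT4])
    (Finset.insert_subset_insert _ (Finset.subset_insert _ _))
    (Finset.insert_subset_insert _ (Finset.subset_insert _ _))
  have h2 : z ∈ insert y (insert z' T) := by rw [← h1]; simp
  simp only [Finset.mem_insert] at h2 hz
  tauto

lemma eq_of_partner (hO : IsHexadSystem G O) {X T T' : Finset α} (hT : T ⊆ X)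
    (hT' : T' ⊆ X) (h3 : 3 ≤ (T ∩ T').card) {y z : α} (hy : y ∉ X) (hz : z ∉ X) (hyz : y ≠ z)
    (h : insert y (insert z T) ∈ O) (h' : insert y (insert z T') ∈ O) : T = T' := by
  have hz0 : z ∉ T ∩ T' := fun hh => hz (hT (Finset.mem_inter.1 hh).1)
  have hy0 : y ∉ insert z (T ∩ T') := by
    rw [Finset.mem_insert]
    rintro (hh | hh)
    · exact hyz hh
    · exact hy (hT (Finset.mem_inter.1 hh).1)
  have h1 := hO.eq_of_subset h h' (T := insert y (insert z (T ∩ T')))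
    (by rw [Finset.card_insert_of_notMem hy0, Finset.card_insert_of_notMem hz0]; omega)
    (Finset.insert_subset_insert _ (Finset.insert_subset_insert _ Finset.inter_subset_left))
    (Finset.insert_subset_insert _ (Finset.insert_subset_insert _ Finset.inter_subset_right))
  ext t
  have h2 := Finset.ext_iff.1 h1 t
  simp only [Finset.mem_insert] at h2
  constructor
  · intro ht
    have : t ≠ y := fun e => hy (e ▸ hT ht)
    have : t ≠ z := fun e => hz (e ▸ hT ht)
    tauto
  · intro ht
    have : t ≠ y := fun e => hy (e ▸ hT' ht)
    have : t ≠ z := fun e => hz (e ▸ hT' ht)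
    tauto

lemma exists_tetrad (hO : IsHexadSystem G O) (hα : Fintype.card α = 12) {X : Finset α} (hX : X ∈ O)
    {a₀ : α} (ha₀ : a₀ ∈ X) {y z : α} (hy : y ∉ X) (hz : z ∉ X) (hyz : y ≠ z) :
    ∃ a ∈ X.erase a₀, insert y (insert z ((X.erase a₀).erase a)) ∈ O := by
  have h6 := hO.card_eq X hX
  have h5 : (X.erase a₀).card = 5 := by rw [Finset.card_erase_of_mem ha₀, h6]
  have hsub : ∀ a, (X.erase a₀).erase a ⊆ X := fun a =>
    (Finset.erase_subset _ _).trans (Finset.erase_subset _ _)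
  have h4 : ∀ a ∈ X.erase a₀, ((X.erase a₀).erase a).card = 4 := fun a ha => by
    rw [Finset.card_erase_of_mem ha, h5]
  have hex : ∀ a : α, a ∈ X.erase a₀ → ∃ z, z ∉ X ∧ z ≠ y ∧
      insert y (insert z ((X.erase a₀).erase a)) ∈ O :=
    fun a ha => hO.exists_partner hX (hsub a) (h4 a ha) hy
  choose! f hf1 hf2 hf3 using hex
  have hinj : Set.InjOn f (X.erase a₀) := by
    intro a ha b hb hab
    by_contra hne
    have ha' : a ∈ X.erase a₀ := ha
    have hb' : b ∈ X.erase a₀ := hb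
    have hT := hO.eq_of_partner (hsub a) (hsub b) (y := y) (z := f a) (by
      have : (X.erase a₀).erase a ∩ (X.erase a₀).erase b = ((X.erase a₀).erase a).erase b := by
        ext t; simp only [Finset.mem_inter, Finset.mem_erase]; tauto
      rw [this, Finset.card_erase_of_mem (Finset.mem_erase.2 ⟨Ne.symm hne, hb'⟩), h4 a ha'])
      hy (hf1 a ha') (hf2 a ha').symm (hf3 a ha') (by rw [hab]; exact hf3 b hb')
    have : b ∈ (X.erase a₀).erase b := by
      rw [← hT]; exact Finset.mem_erase.2 ⟨Ne.symm hne, hb'⟩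
    exact Finset.notMem_erase _ _ this
  have himg : (X.erase a₀).image f = Xᶜ.erase y := by
    refine Finset.eq_of_subset_of_card_le ?_ ?_
    · intro w hw
      obtain ⟨a, ha, rfl⟩ := Finset.mem_image.1 hw
      exact Finset.mem_erase.2 ⟨hf2 a ha, Finset.mem_compl.2 (hf1 a ha)⟩
    · rw [Finset.card_image_of_injOn hinj, h5, Finset.card_erase_of_mem (Finset.mem_compl.2 hy),
        Finset.card_compl, hα, h6]
  have : z ∈ (X.erase a₀).image f := by
    rw [himg]; exact Finset.mem_erase.2 ⟨hyz.symm, Finset.mem_compl.2 hz⟩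
  obtain ⟨a, ha, rfl⟩ := Finset.mem_image.1 this
  exact ⟨a, ha, hf3 a ha⟩

/-- An element fixing a hexad pointwise acts trivially. -/
lemma smul_eq_of_fixes (hO : IsHexadSystem G O) (hα : Fintype.card α = 12) {X : Finset α}
    (hX : X ∈ O) {g : G} (hg : ∀ x ∈ X, g • x = x) (x : α) : g • x = x := by
  have h6 := hO.card_eq X hX
  obtain ⟨a₀, ha₀⟩ := Finset.card_pos.1 (by rw [h6]; norm_num : 0 < X.card)
  have hgX : ∀ y, y ∉ X → g • y ∉ X := by
    intro y hy h
    have h1 := hg _ h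
    exact hy (smul_left_cancel g h1 ▸ h)
  obtain ⟨T, hTdef⟩ : ∃ T : α → Finset α, ∀ a, T a = (X.erase a₀).erase a := ⟨_, fun _ => rfl⟩
  have hTX : ∀ a, T a ⊆ X := fun a => by
    rw [hTdef]
    exact (Finset.erase_subset _ _).trans (Finset.erase_subset _ _)
  have hT4 : ∀ a ∈ X.erase a₀, (T a).card = 4 := fun a ha => by
    rw [hTdef, Finset.card_erase_of_mem ha, Finset.card_erase_of_mem ha₀, h6]
  have hgT : ∀ a, g • T a = T a := by
    intro a
    rw [← Finset.image_smul, Finset.image_congr (g := id) fun t ht => hg t (hTX a ht),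
      Finset.image_id]
  have htet : ∀ y z, y ∉ X → z ∉ X → y ≠ z → ∃ a ∈ X.erase a₀, insert y (insert z (T a)) ∈ O := by
    intro y z hy hz hyz
    simp only [hTdef]
    exact hO.exists_tetrad hα hX ha₀ hy hz hyz
  have hgO : ∀ a y z, insert y (insert z (T a)) ∈ O →
      insert (g • y) (insert (g • z) (T a)) ∈ O := by
    intro a y z h
    have h1 := hO.smul_mem g _ h
    rwa [Finset.smul_finset_insert, Finset.smul_finset_insert, hgT] at h1
  have huniq : ∀ a ∈ X.erase a₀, ∀ y z z', y ∉ X → z ∉ X → y ≠ z →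
      insert y (insert z (T a)) ∈ O → insert y (insert z' (T a)) ∈ O → z = z' := by
    intro a ha y z z' hy hz hyz h h'
    refine hO.partner_unique (hT4 a ha) (fun hh => hy (hTX a hh)) ?_ h h'
    rw [Finset.mem_insert]
    rintro (hh | hh)
    · exact hyz hh.symm
    · exact hz (hTX a hh)
  by_contra hne
  have hxX : x ∉ X := fun h => hne (hg x h)
  have hmove : ∀ w, w ∉ X → g • w ≠ w := by
    intro w hw hfix
    have hxw : w ≠ x := by rintro rfl; exact hne hfix
    obtain ⟨a, ha, h⟩ := htet w x hw hxX hxw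
    have h1 := hgO a w x h
    rw [hfix] at h1
    exact hne (huniq a ha w x _ hw hxX hxw h h1).symm
  have hinv : ∀ w, w ∉ X → g • g • w = w := by
    intro w hw
    obtain ⟨a, ha, h⟩ := htet w (g • w) hw (hgX w hw) (hmove w hw).symm
    have h1 := hgO a _ _ h
    rw [Finset.insert_comm] at h
    exact (huniq a ha _ _ _ (hgX w hw) hw (hmove w hw) h h1).symm
  have hcompl : (Xᶜ).card = 6 := by rw [Finset.card_compl, hα, h6]
  obtain ⟨z, hz⟩ : (Xᶜ \ {x, g • x}).Nonempty := by
    rw [← Finset.card_pos]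
    have := Finset.le_card_sdiff {x, g • x} Xᶜ
    have := Finset.card_le_two (a := x) (b := g • x)
    omega
  simp only [Finset.mem_sdiff, Finset.mem_compl, Finset.mem_insert, Finset.mem_singleton,
    not_or] at hz
  obtain ⟨hzX, hzx, hzgx⟩ := hz
  obtain ⟨w, hw⟩ : (Xᶜ \ {x, g • x, z, g • z}).Nonempty := by
    rw [← Finset.card_pos]
    have := Finset.le_card_sdiff {x, g • x, z, g • z} Xᶜ
    have := Finset.card_le_four (a := x) (b := g • x) (c := z) (d := g • z)
    omega
  simp only [Finset.mem_sdiff, Finset.mem_compl, Finset.mem_insert, Finset.mem_singleton,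
    not_or] at hw
  obtain ⟨hwX, hwx, hwgx, hwz, hwgz⟩ := hw
  have hgx := hgX x hxX
  have hgz := hgX z hzX
  have hgw := hgX w hwX
  have hxgz : x ≠ g • z := by
    intro h
    apply hzgx
    rw [h, hinv z hzX]
  have hgwne : g • w ≠ x ∧ g • w ≠ g • x ∧ g • w ≠ z ∧ g • w ≠ g • z := by
    refine ⟨fun h => hwgx ?_, fun h => hwx (smul_left_cancel g h), fun h => hwgz ?_,
      fun h => hwz (smul_left_cancel g h)⟩
    · rw [← h, hinv w hwX]
    · rw [← h, hinv w hwX]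
  have hcover : ∀ v, v ∉ X → v = x ∨ v = g • x ∨ v = z ∨ v = g • z ∨ v = w ∨ v = g • w := by
    have hsub : ({x, g • x, z, g • z, w, g • w} : Finset α) ⊆ Xᶜ := by
      intro v hv
      simp only [Finset.mem_insert, Finset.mem_singleton] at hv
      rw [Finset.mem_compl]
      rcases hv with rfl | rfl | rfl | rfl | rfl | rfl <;> assumption
    have hc : ({x, g • x, z, g • z, w, g • w} : Finset α).card = 6 := by
      rw [Finset.card_insert_of_notMem, Finset.card_insert_of_notMem,
        Finset.card_insert_of_notMem, Finset.card_insert_of_notMem,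
        Finset.card_insert_of_notMem, Finset.card_singleton]
      · simpa using (hmove w hwX).symm
      · simp only [Finset.mem_insert, Finset.mem_singleton, not_or]
        exact ⟨Ne.symm hwgz, hgwne.2.2.2.symm⟩
      · simp only [Finset.mem_insert, Finset.mem_singleton, not_or]
        exact ⟨(hmove z hzX).symm, Ne.symm hwz, hgwne.2.2.1.symm⟩
      · simp only [Finset.mem_insert, Finset.mem_singleton, not_or]
        exact ⟨Ne.symm hzgx, fun h => hzx (smul_left_cancel g h).symm, Ne.symm hwgx,
          hgwne.2.1.symm⟩
      · simp only [Finset.mem_insert, Finset.mem_singleton, not_or]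
        exact ⟨(hmove x hxX).symm, Ne.symm hzx, hxgz, Ne.symm hwx, hgwne.1.symm⟩
    have heq := Finset.eq_of_subset_of_card_le hsub (by rw [hcompl, hc])
    intro v hv
    rw [← Finset.mem_compl, ← heq] at hv
    simpa using hv
  have hpair : ∀ a ∈ X.erase a₀, ∀ v, v = z ∨ v = g • z → insert x (insert v (T a)) ∈ O →
      insert w (insert (g • w) (T a)) ∈ O := by
    intro a ha v hv h
    have hv' : v ∉ X ∧ x ≠ v ∧ w ≠ v ∧ g • x ≠ v ∧ g • v ∉ X ∧ g • x ≠ g • v ∧ w ≠ g • v ∧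
        (v = z ∧ g • v = g • z ∨ v = g • z ∧ g • v = z) := by
      rcases hv with rfl | rfl
      · exact ⟨hzX, Ne.symm hzx, hwz, Ne.symm hzgx, hgz,
          fun h => hzx (smul_left_cancel g h).symm, hwgz, Or.inl ⟨rfl, rfl⟩⟩
      · rw [hinv z hzX]
        exact ⟨hgz, hxgz, hwgz, fun h => hzx (smul_left_cancel g h).symm, hzX,
          Ne.symm hzgx, hwz, Or.inr ⟨rfl, rfl⟩⟩
    obtain ⟨hvX, hxv, hwv, hgxv, hgv, hgxgv, hwgv, hcase⟩ := hv'
    have h2 := hgO a _ _ h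
    obtain ⟨p, hpX, hpw, hp⟩ := hO.exists_partner hX (hTX a) (hT4 a ha) hwX
    have hp' : insert p (insert w (T a)) ∈ O := by rwa [Finset.insert_comm]
    have e1 : p ≠ x := by
      rintro rfl
      exact hwv (huniq a ha _ _ _ hxX hvX hxv h hp').symm
    have e2 : p ≠ g • x := by
      rintro rfl
      exact hwgv (huniq a ha _ _ _ hgx hgv hgxgv h2 hp').symm
    have e3 : p ≠ v := by
      rintro rfl
      rw [Finset.insert_comm] at h
      exact hwx (huniq a ha _ _ _ hvX hxX (Ne.symm hxv) h hp').symm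
    have e4 : p ≠ g • v := by
      rintro rfl
      rw [Finset.insert_comm] at h2
      exact hwgx (huniq a ha _ _ _ hgv hgx (Ne.symm hgxgv) h2 hp').symm
    have : p = g • w := by
      rcases hcover p hpX with e | e | e | e | e | e
      · exact absurd e e1
      · exact absurd e e2
      · rcases hcase with ⟨r1, r2⟩ | ⟨r1, r2⟩
        · exact absurd (e.trans r1.symm) e3
        · exact absurd (e.trans r2.symm) e4
      · rcases hcase with ⟨r1, r2⟩ | ⟨r1, r2⟩
        · exact absurd (e.trans r2.symm) e4
        · exact absurd (e.trans r1.symm) e3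
      · exact absurd e hpw
      · exact e
    rwa [← this]
  obtain ⟨a, ha, h⟩ := htet x z hxX hzX (Ne.symm hzx)
  obtain ⟨b, hb, h'⟩ := htet x (g • z) hxX hgz hxgz
  have q1 := hpair a ha z (Or.inl rfl) h
  have q2 := hpair b hb (g • z) (Or.inr rfl) h'
  have hTT : T a = T b := by
    refine hO.eq_of_partner (hTX a) (hTX b) ?_ hwX hgw (hmove w hwX).symm q1 q2
    have : ((X.erase a₀).erase a).erase b ⊆ T a ∩ T b := by
      rw [hTdef, hTdef]
      intro t
      simp only [Finset.mem_inter, Finset.mem_erase]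
      tauto
    have h7 := Finset.card_le_card this
    have h8 := Finset.pred_card_le_card_erase (s := (X.erase a₀).erase a) (a := b)
    have h9 := hT4 a ha
    rw [hTdef] at h9
    omega
  rw [← hTT] at h'
  exact hmove z hzX (huniq a ha x z _ hxX hzX (Ne.symm hzx) h h').symm

end IsHexadSystem

end HexadSystems

section GroupOrder

open scoped Pointwise

variable {G α : Type*} [Group G] [MulAction G α] [Fintype α] [DecidableEq α]

/-- An element of cycle type `6·3·2·1` stabilizes a hexad, on which its cube is a transposition. -/
lemma exists_hexad_swap {O : Finset (Finset α)} (hO : IsHexadSystem G O) {d : G}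
    (hd1 : fixCount (α := α) d = 1) (hd2 : fixCount (α := α) (d ^ 2) = 3)
    (hd3 : fixCount (α := α) (d ^ 3) = 4) :
    ∃ X ∈ O, d • X = X ∧ ∃ p ∈ X, ∃ q ∈ X, p ≠ q ∧ d ^ 3 • p = q ∧ d ^ 3 • q = p ∧
      ∀ x ∈ X, x ≠ p → x ≠ q → d ^ 3 • x = x := by
  obtain ⟨f, hf⟩ := Finset.card_eq_one.1 hd1
  have hfix : ∀ x, d • x = x ↔ x = f := fun x => by
    simpa using Finset.ext_iff.1 hf x
  have hdf : d • f = f := (hfix f).2 rfl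
  obtain ⟨A, hA⟩ : ∃ A : Finset α, A = Finset.univ.filter fun x : α => d ^ 2 • x = x := ⟨_, rfl⟩
  obtain ⟨B, hB⟩ : ∃ B : Finset α, B = Finset.univ.filter fun x : α => d ^ 3 • x = x := ⟨_, rfl⟩
  have hAm : ∀ x, x ∈ A ↔ d ^ 2 • x = x := fun x => by simp [hA]
  have hBm : ∀ x, x ∈ B ↔ d ^ 3 • x = x := fun x => by simp [hB]
  have hAc : A.card = 3 := by rw [hA]; exact hd2
  have hBc : B.card = 4 := by rw [hB]; exact hd3
  have hAB : A ∩ B = {f} := by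
    ext x
    rw [Finset.mem_inter, hAm, hBm, Finset.mem_singleton, ← hfix]
    constructor
    · rintro ⟨h2, h3⟩
      rw [pow_succ', mul_smul, h2] at h3
      exact h3
    · intro h
      simp [pow_succ, mul_smul, h]
  have hfA : f ∈ A := by
    have : f ∈ A ∩ B := by rw [hAB]; simp
    exact (Finset.mem_inter.1 this).1
  have hcomm : ∀ n : ℕ, ∀ x : α, d ^ n • d • x = d • d ^ n • x := fun n x => by
    rw [← mul_smul, ← mul_smul, ← pow_succ, pow_succ']
  have hAB6 : (A ∪ B).card = 6 := by
    have := Finset.card_union_add_card_inter A B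
    rw [hAB, Finset.card_singleton] at this
    omega
  have hstAB : ∀ x, x ∈ A ∪ B → d • x ∈ A ∪ B := by
    intro x hx
    rw [Finset.mem_union, hAm, hBm] at hx ⊢
    rcases hx with h | h
    · left; rw [hcomm, h]
    · right; rw [hcomm, h]
  have hfAB : f ∈ A ∪ B := Finset.mem_union_left _ hfA
  have h5 : ((A ∪ B).erase f).card = 5 := by rw [Finset.card_erase_of_mem hfAB, hAB6]
  have hd5 : d • (A ∪ B).erase f = (A ∪ B).erase f := by
    refine Finset.eq_of_subset_of_card_le ?_ (by rw [Finset.card_smul_finset])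
    intro y hy
    obtain ⟨x, hx, rfl⟩ := Finset.mem_smul_finset.1 hy
    obtain ⟨h1, h2⟩ := Finset.mem_erase.1 hx
    refine Finset.mem_erase.2 ⟨fun h => h1 ?_, hstAB x h2⟩
    rw [← hdf] at h
    exact smul_left_cancel _ h
  obtain ⟨H, hH, hsub⟩ := hO.exists_mem _ h5
  have hdH : d • H = H := by
    refine hO.eq_of_subset (hO.smul_mem d H hH) hH h5.ge ?_ hsub
    rw [← hd5]
    exact Finset.smul_finset_subset_smul_finset hsub
  obtain ⟨w, hw⟩ := Finset.card_eq_one.1 (show (H \ (A ∪ B).erase f).card = 1 by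
    rw [Finset.card_sdiff_of_subset hsub, hO.card_eq H hH, h5])
  have hdw : d • w = w := by
    have h1 : d • (H \ (A ∪ B).erase f) = H \ (A ∪ B).erase f := by
      rw [Finset.smul_finset_sdiff, hdH, hd5]
    rw [hw, Finset.smul_finset_singleton] at h1
    exact Finset.singleton_injective h1
  have hwf : w = f := (hfix w).1 hdw
  have hfH : f ∈ H := by
    have : w ∈ H \ (A ∪ B).erase f := by rw [hw]; simp
    rw [← hwf]
    exact (Finset.mem_sdiff.1 this).1
  have hHAB : H = A ∪ B := by
    refine (Finset.eq_of_subset_of_card_le ?_ (by rw [hO.card_eq H hH, hAB6])).symm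
    rw [← Finset.insert_erase hfAB]
    exact Finset.insert_subset hfH hsub
  obtain ⟨p, q, hpq, hE⟩ := Finset.card_eq_two.1 (show (A.erase f).card = 2 by
    rw [Finset.card_erase_of_mem hfA, hAc])
  have hpA : p ∈ A ∧ p ≠ f := by
    have : p ∈ A.erase f := by rw [hE]; simp
    exact ⟨(Finset.mem_erase.1 this).2, (Finset.mem_erase.1 this).1⟩
  have hqA : q ∈ A ∧ q ≠ f := by
    have : q ∈ A.erase f := by rw [hE]; simp
    exact ⟨(Finset.mem_erase.1 this).2, (Finset.mem_erase.1 this).1⟩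
  have hAst : ∀ x ∈ A, x ≠ f → d ^ 3 • x = d • x ∧ d • x ≠ x ∧ (d • x = p ∨ d • x = q) := by
    intro x hx hxf
    have hx2 := (hAm x).1 hx
    have h1 : d • x ≠ x := by rwa [ne_eq, hfix]
    refine ⟨by rw [pow_succ', mul_smul, hx2], h1, ?_⟩
    have h2 : d • x ∈ A.erase f := by
      refine Finset.mem_erase.2 ⟨fun h => hxf ?_, (hAm _).2 (by rw [hcomm, hx2])⟩
      rw [← hdf] at h
      exact smul_left_cancel _ h
    rw [hE] at h2
    simpa using h2
  refine ⟨H, hH, hdH, p, ?_, q, ?_, hpq, ?_, ?_, ?_⟩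
  · rw [hHAB]; exact Finset.mem_union_left _ hpA.1
  · rw [hHAB]; exact Finset.mem_union_left _ hqA.1
  · obtain ⟨h1, h2, h3⟩ := hAst p hpA.1 hpA.2
    rw [h1]
    tauto
  · obtain ⟨h1, h2, h3⟩ := hAst q hqA.1 hqA.2
    rw [h1]
    tauto
  · intro x hx hxp hxq
    rw [hHAB, Finset.mem_union, hBm] at hx
    rcases hx with h | h
    · by_cases hxf : x = f
      · rw [hxf]
        simp [pow_succ, mul_smul, hdf]
      · have : x ∈ A.erase f := Finset.mem_erase.2 ⟨hxf, h⟩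
        rw [hE] at this
        simp [hxp, hxq] at this
    · exact h

/-- The action of a set stabilizer on the set. -/
noncomputable def stabilizerPermHom (X : Finset α) :
    MulAction.stabilizer G X →* Equiv.Perm {x // x ∈ X} :=
  MonoidHom.mk' (fun g => (MulAction.toPermHom G α g.1).subtypePerm (p := fun x => x ∈ X) fun x => by
    have h : g.1 • X = X := g.2
    change g.1 • x ∈ X ↔ x ∈ X
    have h2 := Finset.smul_mem_smul_finset_iff (s := X) (b := x) g.1
    rwa [h] at h2) fun g h => by
      ext x
      exact mul_smul g.1 h.1 (x : α)

lemma stabilizerPermHom_apply (X : Finset α) (g : MulAction.stabilizer G X) (x : {x // x ∈ X}) :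
    (stabilizerPermHom X g x : α) = g.1 • (x : α) := rfl

lemma index_stabilizer_hexad {O : Finset (Finset α)} (hO : IsHexadSystem G O) {X : Finset α}
    (hX : X ∈ O) : (MulAction.stabilizer G X).index = 132 := by
  rw [MulAction.index_stabilizer, ← hO.card_family, ← Set.ncard_coe_finset]
  congr 1
  ext H
  rw [Finset.mem_coe]
  constructor
  · rintro ⟨g, rfl⟩
    exact hO.smul_mem g X hX
  · intro hH
    exact hO.exists_smul_eq X hX H hH

theorem card_range_toPermHom (hα : Fintype.card α = 12)
    (h4 : MulAction.IsMultiplyPretransitive G α 4)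
    {O : Finset (Finset α)} (hO : IsHexadSystem G O) {c d : G}
    (hc2 : fixCount (α := α) (c ^ 2) = 4) (hc4 : fixCount (α := α) (c ^ 4) = 4)
    (hc' : ∀ x : α, c ^ 8 • x = x)
    (hd1 : fixCount (α := α) d = 1) (hd2 : fixCount (α := α) (d ^ 2) = 3)
    (hd3 : fixCount (α := α) (d ^ 3) = 4) :
    Nat.card (MulAction.toPermHom G α).range = 95040 := by
  obtain ⟨X, hX, hdX, p, hp, q, hq, hpq, hdp, hdq, hdx⟩ := exists_hexad_swap hO hd1 hd2 hd3
  set K := (MulAction.toPermHom G α).ker with hK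
  have hKm : ∀ g : G, g ∈ K ↔ ∀ x : α, g • x = x := fun g => by
    rw [hK, MonoidHom.mem_ker, Equiv.ext_iff]
    rfl
  rw [← Subgroup.index_ker, ← hK]
  have hKP : K ≤ MulAction.stabilizer G X := by
    intro g hg
    rw [MulAction.mem_stabilizer_iff, ← Finset.image_smul,
      Finset.image_congr (g := id) fun t _ => (hKm g).1 hg t, Finset.image_id]
  have hP := index_stabilizer_hexad hO hX
  have e1 := Subgroup.relIndex_mul_index hKP
  have hker : (stabilizerPermHom (G := G) X).ker = K.subgroupOf (MulAction.stabilizer G X) := by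
    ext g
    rw [MonoidHom.mem_ker, Subgroup.mem_subgroupOf, hKm, Equiv.ext_iff]
    constructor
    · intro h
      exact hO.smul_eq_of_fixes hα hX fun x hx => congrArg Subtype.val (h ⟨x, hx⟩)
    · intro h x
      exact Subtype.ext (h x)
  have e2 : K.relIndex (MulAction.stabilizer G X) =
      Nat.card (stabilizerPermHom (G := G) X).range := by
    rw [Subgroup.relIndex, ← hker, Subgroup.index_ker]
  have hX6 : Fintype.card {x // x ∈ X} = 6 := by simpa using hO.card_eq X hX
  have hperm : Nat.card (Equiv.Perm {x // x ∈ X}) = 720 := by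
    rw [Nat.card_eq_fintype_card, Fintype.card_perm, hX6]; rfl
  have hdvd : Nat.card (stabilizerPermHom (G := G) X).range ∣ 720 := by
    rw [← hperm]; exact Subgroup.card_subgroup_dvd_card _
  have h720 : 47520 ∣ K.index := by
    let F : Finset α := Finset.univ.filter fun x : α => c ^ 2 • x = x
    have hF : Fintype.card F = 4 := by rw [Fintype.card_coe]; exact hc2
    let x₀ : Fin 4 ↪ α := (Fintype.equivFinOfCardEq hF).symm.toEmbedding.trans
      (Function.Embedding.subtype _)
    have hx₀ : ∀ i, c ^ 2 • x₀ i = x₀ i := fun i =>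
      (Finset.mem_filter.1 ((Fintype.equivFinOfCardEq hF).symm i).2).2
    have hKQ : K ≤ MulAction.stabilizer G x₀ := by
      intro g hg
      rw [MulAction.mem_stabilizer_iff]
      ext i
      exact (hKm g).1 hg _
    have hQ : (MulAction.stabilizer G x₀).index = 11880 := by
      have : MulAction.orbit G x₀ = Set.univ := by
        ext y
        simp only [Set.mem_univ, iff_true]
        exact MulAction.isMultiplyPretransitive_iff.1 h4 x₀ y
      rw [MulAction.index_stabilizer, this, Set.ncard_univ, Nat.card_eq_fintype_card,
        Fintype.card_embedding_eq, hα, Fintype.card_fin]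
      rfl
    rw [← Subgroup.relIndex_mul_index hKQ, hQ]
    have e3 : K.relIndex (MulAction.stabilizer G x₀) = Nat.card
        ((MulAction.toPermHom G α).comp (MulAction.stabilizer G x₀).subtype).range := by
      rw [Subgroup.relIndex, ← Subgroup.index_ker]
      rfl
    have hord : orderOf (MulAction.toPermHom G α (c ^ 2)) = 2 ^ (1 + 1) := by
      refine orderOf_eq_prime_pow (p := 2) ?_ ?_
      · intro h
        rw [← map_pow, ← pow_mul, Equiv.ext_iff] at h
        have : fixCount (α := α) (c ^ 4) = 12 := by
          rw [fixCount, Finset.filter_true_of_mem fun x _ => by exact h x, Finset.card_univ, hα]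
        omega
      · rw [← map_pow, ← pow_mul]
        exact Equiv.ext hc'
    have h44 : 4 ∣ K.relIndex (MulAction.stabilizer G x₀) := by
      rw [e3]
      have := Subgroup.orderOf_dvd_natCard
        ((MulAction.toPermHom G α).comp (MulAction.stabilizer G x₀).subtype).range
        (x := MulAction.toPermHom G α (c ^ 2)) ⟨⟨c ^ 2, by
          rw [MulAction.mem_stabilizer_iff]
          ext i
          exact hx₀ i⟩, rfl⟩
      rwa [hord] at this
    obtain ⟨m, hm⟩ := h44
    exact ⟨m, by rw [hm]; ring⟩
  have hsign : ∃ s : MulAction.stabilizer G X,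
      Equiv.Perm.sign (stabilizerPermHom (G := G) X s) = -1 := by
    refine ⟨⟨d ^ 3, (MulAction.stabilizer G X).pow_mem hdX 3⟩, ?_⟩
    have : stabilizerPermHom (G := G) X ⟨d ^ 3, (MulAction.stabilizer G X).pow_mem hdX 3⟩ =
        Equiv.swap ⟨p, hp⟩ ⟨q, hq⟩ := by
      ext x
      rw [stabilizerPermHom_apply]
      by_cases hxp : x = ⟨p, hp⟩
      · rw [hxp, Equiv.swap_apply_left]; exact hdp
      · by_cases hxq : x = ⟨q, hq⟩
        · rw [hxq, Equiv.swap_apply_right]; exact hdq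
        · rw [Equiv.swap_apply_of_ne_of_ne hxp hxq]
          exact hdx x x.2 (fun h => hxp (Subtype.ext h)) fun h => hxq (Subtype.ext h)
    rw [this, Equiv.Perm.sign_swap]
    exact fun h => hpq (congrArg Subtype.val h)
  have h360 : Nat.card (stabilizerPermHom (G := G) X).range ≠ 360 := by
    intro h
    have hidx : (stabilizerPermHom (G := G) X).range.index = 2 := by
      have := Subgroup.card_mul_index (stabilizerPermHom (G := G) X).range
      rw [h, hperm] at this
      omega
    have halt := Equiv.Perm.eq_alternatingGroup_of_index_eq_two hidx
    obtain ⟨s, hs⟩ := hsign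
    have h1 : stabilizerPermHom (G := G) X s ∈ alternatingGroup {x // x ∈ X} := by
      rw [← halt]; exact ⟨s, rfl⟩
    rw [Equiv.Perm.mem_alternatingGroup, hs] at h1
    exact absurd h1 (by decide)
  rw [e2, hP] at e1
  rw [← e1] at h720 ⊢
  generalize Nat.card (stabilizerPermHom (G := G) X).range = r at *
  have hr : 360 ∣ r := by omega
  have hr' := Nat.le_of_dvd (by norm_num) hdvd
  have hr0 : r ≠ 0 := by rintro rfl; norm_num at hdvd
  omega

end GroupOrder

section TwelvePointActions

open scoped Pointwise

variable {G α β : Type*} [Group G] [MulAction G α] [MulAction G β] [Fintype α] [DecidableEq α]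
  [Fintype β] [DecidableEq β]

/-- An element of cycle type `10·2` stabilizes no six-element set. -/
lemma smul_ne_of_card_six {b : G} (hb0 : fixCount (α := α) b = 0)
    (hb2 : fixCount (α := α) (b ^ 2) = 2) (hb' : ∀ x : α, b ^ 10 • x = x) {H : Finset α}
    (hH : H.card = 6) : b • H ≠ H := by
  intro h
  have hst : ∀ x ∈ H, b • x ∈ H := fun x hx => by
    have := Finset.smul_mem_smul_finset (a := b) hx
    rwa [h] at this
  obtain ⟨p, q, hpq, hE⟩ := Finset.card_eq_two.1 hb2
  have hfix : ∀ x, b ^ 2 • x = x ↔ x = p ∨ x = q := fun x => by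
    simpa using Finset.ext_iff.1 hE x
  have hb : ∀ x : α, b • x ≠ x := by
    intro x hx
    rw [fixCount, Finset.card_eq_zero] at hb0
    have := Finset.ext_iff.1 hb0 x
    simp [hx] at this
  have hbp : b • p = q := by
    have h1 : b ^ 2 • b • p = b • p := by
      rw [← mul_smul, ← pow_succ, pow_succ', mul_smul, (hfix p).2 (Or.inl rfl)]
    rcases (hfix _).1 h1 with h2 | h2
    · exact absurd h2 (hb p)
    · exact h2
  have hbq : b • q = p := by
    rw [← hbp, ← mul_smul, ← pow_two]
    exact (hfix p).2 (Or.inl rfl)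
  have h5 : 5 ∣ (H \ {p, q}).card := by
    refine dvd_card_of_minimalPeriod (g := b ^ 2) ?_ ?_
    · intro x hx
      simp only [Finset.mem_sdiff, Finset.mem_insert, Finset.mem_singleton, ← hfix] at hx ⊢
      refine ⟨?_, fun h => hx.2 (smul_left_cancel _ h)⟩
      rw [pow_two, mul_smul]
      exact hst _ (hst _ hx.1)
    · intro x hx
      simp only [Finset.mem_sdiff, Finset.mem_insert, Finset.mem_singleton, ← hfix] at hx
      exact minimalPeriod_smul_eq_prime (by norm_num) (by rw [← pow_mul]; exact hb' x) hx.2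
  by_cases hp : p ∈ H
  · have hq : q ∈ H := hbp ▸ hst p hp
    rw [Finset.card_sdiff_of_subset (Finset.insert_subset hp (Finset.singleton_subset_iff.2 hq)),
      hH, Finset.card_pair hpq] at h5
    omega
  · have hq : q ∉ H := fun hq => hp (hbq ▸ hst q hq)
    rw [Finset.sdiff_eq_self_of_disjoint, hH] at h5
    · omega
    · rw [Finset.disjoint_right]
      intro x hx
      simp only [Finset.mem_insert, Finset.mem_singleton] at hx
      rcases hx with rfl | rfl <;> assumption

/-- A pair of twelve-point actions with the given Frobenius-type elements, linked by a subgroup of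
small index fixing a pair of points on one side and a bisection on the other, has image the
Mathieu group order, and the first action determines the second. -/
theorem twelve_point_actions (hα : Fintype.card α = 12) (hβ : Fintype.card β = 12) {a b c d : G}
    (ha : fixCount (α := α) a = 1) (ha' : ∀ x : α, a ^ 11 • x = x)
    (haβ : fixCount (α := β) a = 1) (haβ' : ∀ x : β, a ^ 11 • x = x)
    (hb : fixCount (α := α) b = 0) (hb2 : fixCount (α := α) (b ^ 2) = 2)
    (hb' : ∀ x : α, b ^ 10 • x = x)
    (hbβ : fixCount (α := β) b = 0) (hb2β : fixCount (α := β) (b ^ 2) = 2)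
    (hc : fixCount (α := α) c = 2) (hc2 : fixCount (α := α) (c ^ 2) = 4)
    (hc4 : fixCount (α := α) (c ^ 4) = 4) (hc' : ∀ x : α, c ^ 8 • x = x)
    (hd : fixCount (α := α) d = 1) (hd2 : fixCount (α := α) (d ^ 2) = 3)
    (hd3 : fixCount (α := α) (d ^ 3) = 4) (hd' : ∀ x : α, d ^ 6 • x = x)
    (S : Subgroup G) (hS : S.index ≤ 66) (hS0 : S.index ≠ 0)
    (e : Finset β) (he : e.card = 2) (H : Finset α) (hH : H.card = 6)
    (hSe : ∀ g ∈ S, g • e = e) (hSH : ∀ g ∈ S, g • H = H ∨ g • H = Hᶜ) :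
    Nat.card (MulAction.toPermHom G α).range = 95040 ∧
      ∀ g : G, (∀ x : α, g • x = x) → ∀ y : β, g • y = y := by
  have t2 : MulAction.IsMultiplyPretransitive G α 2 := isMultiplyPretransitive_two hα ha ha' hb
  have t3 : MulAction.IsMultiplyPretransitive G α 3 :=
    isMultiplyPretransitive_three hα t2 hb2 hb' hc hc4 hc'
  have t4 : MulAction.IsMultiplyPretransitive G α 4 :=
    isMultiplyPretransitive_four hα t3 hc2 hc4 hc' hd2 hd'
  have s2 : MulAction.IsMultiplyPretransitive G β 2 :=
    isMultiplyPretransitive_two hβ haβ haβ' hbβ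
  -- `S` is the stabilizer of the pair
  have hSle : S ≤ MulAction.stabilizer G e := fun g hg => hSe g hg
  have hstab : (MulAction.stabilizer G e).index = 66 := by
    have : MulAction.orbit G e = ((Finset.univ : Finset β).powersetCard 2 : Finset (Finset β)) := by
      ext u
      rw [Finset.mem_coe, Finset.mem_powersetCard]
      constructor
      · rintro ⟨g, rfl⟩
        exact ⟨Finset.subset_univ _, by rw [← he]; exact Finset.card_smul_finset g e⟩
      · rintro ⟨-, hu⟩
        exact exists_smul_eq_of_card_eq s2 he hu
    rw [MulAction.index_stabilizer, this, Set.ncard_coe_finset, Finset.card_powersetCard,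
      Finset.card_univ, hβ]
    rfl
  have hSeq : S = MulAction.stabilizer G e := by
    have h1 := Subgroup.relIndex_mul_index hSle
    rw [hstab] at h1
    refine le_antisymm hSle (Subgroup.relIndex_eq_one.1 ?_)
    rcases Nat.lt_trichotomy (S.relIndex (MulAction.stabilizer G e)) 1 with h2 | h2 | h2 <;> omega
  have hS66 : S.index = 66 := by rw [hSeq, hstab]
  -- the swapping element
  obtain ⟨k, hkS, hkH⟩ : ∃ k ∈ S, k • H = Hᶜ := by
    obtain ⟨g, hg⟩ := exists_smul_eq_of_card_eq s2 he hb2β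
    have hbe : b • g • e = g • e := by
      rw [hg]
      refine Finset.eq_of_subset_of_card_le ?_ (by rw [Finset.card_smul_finset])
      intro y hy
      obtain ⟨x, hx, rfl⟩ := Finset.mem_smul_finset.1 hy
      rw [Finset.mem_filter] at hx ⊢
      refine ⟨Finset.mem_univ _, ?_⟩
      rw [← mul_smul, ← pow_succ, pow_succ', mul_smul, hx.2]
    have hkS : g⁻¹ * b * g ∈ S := by
      rw [hSeq, MulAction.mem_stabilizer_iff, mul_smul, mul_smul, hbe, inv_smul_smul]
    refine ⟨_, hkS, (hSH _ hkS).resolve_left ?_⟩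
    refine smul_ne_of_card_six ?_ ?_ ?_ hH
    · have := fixCount_conj (α := α) b g⁻¹
      rw [inv_inv] at this
      rw [this, hb]
    · have h1 : (g⁻¹ * b * g) ^ 2 = g⁻¹ * b ^ 2 * g := by
        simpa using conj_pow (i := 2) (a := g⁻¹) (b := b)
      have := fixCount_conj (α := α) (b ^ 2) g⁻¹
      rw [inv_inv] at this
      rw [h1, this, hb2]
    · intro x
      have h1 : (g⁻¹ * b * g) ^ 10 = g⁻¹ * b ^ 10 * g := by
        simpa using conj_pow (i := 10) (a := g⁻¹) (b := b)
      rw [h1, mul_smul, mul_smul, hb', inv_smul_smul]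
  set P := MulAction.stabilizer G H with hPdef
  have hrel : P.relIndex S ≤ 2 ∧ P.relIndex S ≠ 0 := by
    have h1 : P.relIndex S = (MulAction.orbit S H).ncard := by
      rw [← MulAction.index_stabilizer]; rfl
    have hsub : MulAction.orbit S H ⊆ (({H, Hᶜ} : Finset (Finset α)) : Set (Finset α)) := by
      rintro _ ⟨g, rfl⟩
      rcases hSH g g.2 with h | h
      · simp only [Finset.coe_insert, Finset.coe_singleton]
        exact Or.inl h
      · simp only [Finset.coe_insert, Finset.coe_singleton]
        exact Or.inr h
    rw [h1]
    constructor
    · refine (Set.ncard_le_ncard hsub (Finset.finite_toSet _)).trans ?_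
      rw [Set.ncard_coe_finset]
      exact Finset.card_le_two
    · exact ((Set.ncard_pos ((Finset.finite_toSet _).subset hsub)).2
        ⟨H, MulAction.mem_orbit_self H⟩).ne'
  have hPS : (P ⊓ S).index = P.relIndex S * 66 := by
    rw [← hS66, ← Subgroup.inf_relIndex_right, Subgroup.relIndex_mul_index inf_le_right]
  have hPS0 : (P ⊓ S).index ≠ 0 := by
    rw [hPS]; exact Nat.mul_ne_zero hrel.2 (by norm_num)
  have hPle : P.index ≤ 132 := by
    have := Nat.le_of_dvd (Nat.pos_of_ne_zero hPS0) (Subgroup.index_dvd_of_le (inf_le_left : P ⊓ S ≤ P))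
    omega
  obtain ⟨O, hOdef⟩ : ∃ O : Finset (Finset α), ∀ X, X ∈ O ↔ X ∈ MulAction.orbit G H := by
    classical
    exact ⟨Finset.univ.filter fun X => X ∈ MulAction.orbit G H, fun X => by simp⟩
  have hsm : ∀ g : G, ∀ X ∈ O, g • X ∈ O := by
    intro g X hX
    rw [hOdef] at hX ⊢
    obtain ⟨k, rfl⟩ := hX
    exact ⟨g * k, mul_smul _ _ _⟩
  have hHO : H ∈ O := (hOdef H).2 (MulAction.mem_orbit_self H)
  have hcomplsmul : ∀ (g : G) (X : Finset α), g • Xᶜ = (g • X)ᶜ := by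
    intro g X
    ext x
    rw [Finset.mem_compl, ← Finset.inv_smul_mem_iff, ← Finset.inv_smul_mem_iff, Finset.mem_compl]
  have hOsys : IsHexadSystem G O := by
    refine isHexadSystem_of_card_le hα t4 ?_ ?_ hsm ?_ ⟨H, hHO⟩ ?_
    · intro X hX
      obtain ⟨g, rfl⟩ := (hOdef X).1 hX
      rw [← hH]; exact Finset.card_smul_finset g H
    · intro X hX
      obtain ⟨g, rfl⟩ := (hOdef X).1 hX
      change (g • H)ᶜ ∈ O
      rw [← hcomplsmul, ← hkH]
      exact hsm _ _ (hsm _ _ hHO)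
    · intro X hX Y hY
      obtain ⟨g, rfl⟩ := (hOdef X).1 hX
      obtain ⟨k, rfl⟩ := (hOdef Y).1 hY
      exact ⟨k * g⁻¹, by simp [mul_smul]⟩
    · rw [MulAction.index_stabilizer] at hPle
      have : MulAction.orbit G H = (O : Set (Finset α)) := by
        ext X
        rw [Finset.mem_coe, hOdef]
      rwa [this, Set.ncard_coe_finset] at hPle
  refine ⟨card_range_toPermHom hα t4 hOsys hc2 hc4 hc' hd hd2 hd3 , ?_⟩
  have hP132 : P.index = 132 := index_stabilizer_hexad hOsys hHO
  have hPleS : P ≤ S := by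
    have h1 := Subgroup.relIndex_mul_index (inf_le_left : P ⊓ S ≤ P)
    rw [hP132, Subgroup.inf_relIndex_left] at h1
    rw [← Subgroup.relIndex_eq_one]
    have h2 := hrel.1
    rcases Nat.lt_trichotomy (S.relIndex P) 1 with h3 | h3 | h3 <;> omega
  intro g hg
  have hpair : ∀ u : Finset β, u.card = 2 → g • u = u := by
    intro u hu
    obtain ⟨k, rfl⟩ := exists_smul_eq_of_card_eq s2 he hu
    have h1 : k⁻¹ * g * k ∈ P := by
      rw [hPdef, MulAction.mem_stabilizer_iff, ← Finset.image_smul,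
        Finset.image_congr (g := id), Finset.image_id]
      intro x _
      change (k⁻¹ * g * k) • x = x
      rw [mul_smul, mul_smul, hg, inv_smul_smul]
    have h2 := hSe _ (hPleS h1)
    rw [mul_smul, mul_smul, inv_smul_eq_iff] at h2
    exact h2
  intro y
  have hcard : 1 < ((Finset.univ : Finset β).erase y).card := by
    rw [Finset.card_erase_of_mem (Finset.mem_univ y), Finset.card_univ, hβ]; norm_num
  obtain ⟨z, hz, w, hw, hzw⟩ := Finset.one_lt_card.1 hcard
  have hzy := (Finset.mem_erase.1 hz).1
  have hwy := (Finset.mem_erase.1 hw).1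
  have hmem : ∀ v, v ≠ y → g • y = y ∨ g • y = v := by
    intro v hv
    have h1 := hpair {y, v} (Finset.card_pair (Ne.symm hv))
    have h2 : g • y ∈ g • ({y, v} : Finset β) := Finset.smul_mem_smul_finset (by simp)
    rw [h1] at h2
    simpa using h2
  rcases hmem z hzy with h | h
  · exact h
  · rcases hmem w hwy with h' | h'
    · exact h'
    · exact absurd (h.symm.trans h') hzw

end TwelvePointActions

section FrobeniusElements

open scoped Pointwise

universe w

/-- The automorphism group of an algebraic extension acts on an integral closure inside it. -/
@[reducible] def integralClosureAction (R k Ω : Type*) [CommRing R] [Field k] [Field Ω]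
    [Algebra R k] [Algebra k Ω] [Algebra R Ω] [IsScalarTower R k Ω] :
    MulSemiringAction (Ω ≃ₐ[k] Ω) (integralClosure R Ω) where
  smul γ x := ⟨γ x, x.2.map (γ.restrictScalars R)⟩
  one_smul _ := rfl
  mul_smul _ _ _ := rfl
  smul_zero γ := Subtype.ext (map_zero γ)
  smul_add γ _ _ := Subtype.ext (map_add γ _ _)
  smul_one γ := Subtype.ext (map_one γ)
  smul_mul γ _ _ := Subtype.ext (map_mul γ _ _)

theorem exists_frobenius_element {R k : Type*} {Ω : Type w} [CommRing R] [Field k] [Field Ω]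
    [Algebra R k] [Algebra k Ω] [Algebra R Ω] [IsScalarTower R k Ω] [IsGalois k Ω]
    [IsIntegrallyClosedIn R k] (p : ℕ) [Fact p.Prime] (ψ : R →+* ZMod p)
    (hinj : Function.Injective (algebraMap R k)) :
    ∃ (κ : Type w) (_ : Field κ) (_ : CharP κ p) (φ : integralClosure R Ω →+* κ) (γ : Ω ≃ₐ[k] Ω),
      (∀ r n, ψ r = ((n : ℤ) : ZMod p) → φ (algebraMap R _ r) = n) ∧
      ∀ x y : integralClosure R Ω, γ x = y → φ y = φ x ^ p := by
  let := integralClosureAction R k Ω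
  have hsmul : ∀ (γ : Ω ≃ₐ[k] Ω) (x : integralClosure R Ω), ((γ • x : integralClosure R Ω) : Ω) = γ x :=
    fun _ _ => rfl
  let : TopologicalSpace (integralClosure R Ω) := ⊥
  have : DiscreteTopology (integralClosure R Ω) := ⟨rfl⟩
  have : SMulCommClass (Ω ≃ₐ[k] Ω) R (integralClosure R Ω) := ⟨fun γ r x => Subtype.ext (by
    rw [hsmul, SetLike.val_smul, SetLike.val_smul, hsmul, Algebra.smul_def, Algebra.smul_def, map_mul,
      IsScalarTower.algebraMap_apply R k Ω, AlgEquiv.commutes])⟩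
  have : ContinuousSMul (Ω ≃ₐ[k] Ω) (integralClosure R Ω) := by
    refine continuousSMul_iff_stabilizer_isOpen.2 fun x => ?_
    convert stabilizer_isOpen_of_isIntegral (K := k) (x : Ω) using 1
    ext γ
    simp [MulAction.mem_stabilizer_iff, Subtype.ext_iff, hsmul]
  have : Algebra.IsInvariant R (integralClosure R Ω) (Ω ≃ₐ[k] Ω) := ⟨fun x hx => by
    obtain ⟨y, hy⟩ := (InfiniteGalois.mem_range_algebraMap_iff_fixed (k := k) (x : Ω)).2
      fun γ => congrArg Subtype.val (hx γ)
    have hyi : IsIntegral R y := by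
      rw [← isIntegral_algebraMap_iff (B := Ω) (algebraMap k Ω).injective, hy]
      exact x.2
    obtain ⟨r, rfl⟩ := IsIntegrallyClosedIn.isIntegral_iff.1 hyi
    exact ⟨r, Subtype.ext (by rw [← hy, ← IsScalarTower.algebraMap_apply]; rfl)⟩⟩
  have hp := Fact.out (p := p.Prime)
  have hψ : Function.Surjective ψ := ZMod.ringHom_surjective ψ
  have hPm : (RingHom.ker ψ).IsMaximal := RingHom.ker_isMaximal_of_surjective ψ hψ
  have : FaithfulSMul R (integralClosure R Ω) := (faithfulSMul_iff_algebraMap_injective _ _).2 (by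
    intro a b hab
    apply hinj
    apply (algebraMap k Ω).injective
    rw [← IsScalarTower.algebraMap_apply, ← IsScalarTower.algebraMap_apply]
    exact congrArg Subtype.val hab)
  obtain ⟨Q, hQm, hQ⟩ := Ideal.exists_maximal_ideal_liesOver_of_isIntegral (S := integralClosure R Ω)
    (RingHom.ker ψ)
  set P := RingHom.ker ψ
  let : Field (R ⧸ P) := Ideal.Quotient.field P
  let : Field (integralClosure R Ω ⧸ Q) := Ideal.Quotient.field Q
  have hmem : ∀ r, ψ r = 0 ↔ algebraMap R (integralClosure R Ω) r ∈ Q := fun r => by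
    rw [← RingHom.mem_ker]; exact Ideal.mem_of_liesOver Q P r
  have : CharP (integralClosure R Ω ⧸ Q) p := by
    refine (CharP.charP_iff_prime_eq_zero hp).2 ?_
    have := (hmem (p : R)).1 (by simp)
    rw [← Ideal.Quotient.eq_zero_iff_mem] at this
    simpa using this
  have hfix : ∀ r : R ⧸ P, r ^ p = r := by
    intro r
    obtain ⟨r, rfl⟩ := Ideal.Quotient.mk_surjective r
    rw [← map_pow, Ideal.Quotient.eq, RingHom.mem_ker, map_sub, map_pow, ZMod.pow_card, sub_self]
  let f : (integralClosure R Ω ⧸ Q) →ₐ[R ⧸ P] (integralClosure R Ω ⧸ Q) :=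
    { frobenius (integralClosure R Ω ⧸ Q) p with
      commutes' := fun r => by
        change algebraMap _ _ r ^ p = _
        rw [← map_pow, hfix] }
  have hf : Function.Bijective f := Algebra.IsAlgebraic.algHom_bijective f
  obtain ⟨γ, hγ⟩ := Ideal.Quotient.stabilizerHom_surjective_of_profinite (G := Ω ≃ₐ[k] Ω) P Q
    (AlgEquiv.ofBijective f hf)
  refine ⟨integralClosure R Ω ⧸ Q, inferInstance, inferInstance, Ideal.Quotient.mk Q, γ, ?_, ?_⟩
  · intro r n hr
    have := (hmem (r - n)).1 (by simp [hr])
    rw [map_sub, ← Ideal.Quotient.eq] at this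
    rw [this]
    simp
  · intro x y hxy
    have h := congrArg (fun e : (integralClosure R Ω ⧸ Q) ≃ₐ[R ⧸ P] _ => e (Ideal.Quotient.mk Q x)) hγ
    change Ideal.Quotient.mk Q ((γ : Ω ≃ₐ[k] Ω) • x) = (Ideal.Quotient.mk Q x) ^ p at h
    rw [← h]
    congr 1
    exact Subtype.ext hxy.symm

end FrobeniusElements

open Polynomial

section KroneckerSubstitution

/-- `p` is a difference of polynomials with natural coefficients whose coefficient sums add up
to at most `n`. -/
def CoeffSumLE (p : ℤ[X]) (n : ℕ) : Prop :=
  ∃ P Q : ℕ[X], p = P.map (Nat.castRingHom ℤ) - Q.map (Nat.castRingHom ℤ) ∧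
    P.eval 1 + Q.eval 1 ≤ n

namespace CoeffSumLE

variable {p q : ℤ[X]} {m n : ℕ}

theorem mono (h : CoeffSumLE p m) (hmn : m ≤ n) : CoeffSumLE p n :=
  let ⟨P, Q, hp, hn⟩ := h
  ⟨P, Q, hp, hn.trans hmn⟩

theorem add (hp : CoeffSumLE p m) (hq : CoeffSumLE q n) : CoeffSumLE (p + q) (m + n) := by
  obtain ⟨P, Q, rfl, h⟩ := hp
  obtain ⟨P', Q', rfl, h'⟩ := hq
  refine ⟨P + P', Q + Q', by simp only [Polynomial.map_add]; ring, ?_⟩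
  simp only [eval_add]
  omega

theorem neg (hp : CoeffSumLE p m) : CoeffSumLE (-p) m := by
  obtain ⟨P, Q, rfl, h⟩ := hp
  exact ⟨Q, P, by ring, by omega⟩

theorem mul (hp : CoeffSumLE p m) (hq : CoeffSumLE q n) : CoeffSumLE (p * q) (m * n) := by
  obtain ⟨P, Q, rfl, h⟩ := hp
  obtain ⟨P', Q', rfl, h'⟩ := hq
  refine ⟨P * P' + Q * Q', P * Q' + Q * P', by
    simp only [Polynomial.map_add, Polynomial.map_mul]; ring, ?_⟩
  simp only [eval_add, eval_mul]
  calc _ = (P.eval 1 + Q.eval 1) * (P'.eval 1 + Q'.eval 1) := by ring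
    _ ≤ m * n := Nat.mul_le_mul h h'

theorem intCast (a : ℤ) : CoeffSumLE (a : ℤ[X]) a.natAbs := by
  refine ⟨(a.toNat : ℕ[X]), ((-a).toNat : ℕ[X]), ?_, ?_⟩
  · simp only [Polynomial.map_natCast]
    have h : a = (a.toNat : ℤ) - ((-a).toNat : ℤ) := by omega
    conv_lhs => rw [h]
    push_cast
    rfl
  · simp only [eval_natCast, Nat.cast_id]
    omega

theorem zero (n : ℕ) : CoeffSumLE 0 n :=
  ⟨0, 0, by simp, by simp⟩

theorem one : CoeffSumLE 1 1 :=
  ⟨1, 0, by simp, by simp⟩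

theorem X_mul (hp : CoeffSumLE p m) : CoeffSumLE (X * p) m := by
  obtain ⟨P, Q, rfl, h⟩ := hp
  exact ⟨X * P, X * Q, by simp only [Polynomial.map_mul, map_X]; ring, by simpa using h⟩

theorem natAbs_coeff_le (hp : CoeffSumLE p m) (i : ℕ) : (p.coeff i).natAbs ≤ m := by
  obtain ⟨P, Q, rfl, h⟩ := hp
  have key : ∀ P : ℕ[X], P.coeff i ≤ P.eval 1 := fun P => by
    rw [eval_eq_sum, Polynomial.sum]
    by_cases hi : i ∈ P.support
    · simpa using Finset.single_le_sum (f := fun e => P.coeff e * 1 ^ e) (fun _ _ => Nat.zero_le _) hi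
    · simp [notMem_support_iff.1 hi]
  have h1 := key P
  have h2 := key Q
  simp only [coeff_sub, coeff_map, eq_natCast]
  omega

theorem eq_zero (hp : CoeffSumLE p m) {B : ℕ} (hB : m < B) (h0 : p.eval (B : ℤ) = 0) : p = 0 := by
  by_contra hne
  obtain ⟨k, q, hq, hpq⟩ : ∃ k, ∃ q : ℤ[X], q.coeff 0 ≠ 0 ∧ p = X ^ k * q := by
    obtain ⟨q, hq⟩ := X_pow_dvd_iff.2 fun d (hd : d < p.natTrailingDegree) =>
      coeff_eq_zero_of_lt_natTrailingDegree hd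
    refine ⟨_, q, ?_, hq⟩
    have := mt trailingCoeff_eq_zero.1 hne
    rw [trailingCoeff] at this
    have h2 := congrArg (fun r => coeff r p.natTrailingDegree) hq
    simp only [coeff_X_pow_mul', le_refl, if_true, Nat.sub_self] at h2
    rwa [← h2]
  have hB0 : (B : ℤ) ≠ 0 := by omega
  rw [hpq, eval_mul, eval_pow, eval_X] at h0
  have h1 : q.eval (B : ℤ) = 0 := (mul_eq_zero.1 h0).resolve_left (pow_ne_zero _ hB0)
  have h2 : (B : ℤ) ∣ q.coeff 0 := by
    rw [← divX_mul_X_add q] at h1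
    simp only [eval_add, eval_mul, eval_X, eval_C] at h1
    exact ⟨-(q.divX.eval (B : ℤ)), by linear_combination h1⟩
  have h3 := hp.natAbs_coeff_le k
  rw [hpq, coeff_X_pow_mul', if_pos le_rfl, Nat.sub_self] at h3
  exact hq (Int.eq_zero_of_abs_lt_dvd h2 (by rw [Int.abs_eq_natAbs]; omega))

end CoeffSumLE

/-- The polynomial with the given list of coefficients in `ℤ[u]`. -/
noncomputable def listPoly {Ω : Type*} [Field Ω] (u : Ω) (L : List (ℤ × ℤ)) : Polynomial Ω :=
  L.foldr (fun c f => C (c.1 + c.2 * u) + X * f) 0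

/-- The values at a large integer of the components of a polynomial expression
`p₀ + p₁ u + (p₂ + p₃ u) w`, with a bound for the size of the components. -/
structure KroneckerValue where
  (a b c d : ℤ)
  n : ℕ

namespace KroneckerValue

variable (B : ℕ)

/-- `q` describes the element `z` of the ring generated by `s`, `u`, `w`. -/
def Describes {Ω : Type*} [Field Ω] (q : KroneckerValue) (s u w : Ω) (z : Ω) : Prop :=
  ∃ p₀ p₁ p₂ p₃ : ℤ[X],
    (p₀.eval (B : ℤ) = q.a ∧ p₁.eval (B : ℤ) = q.b ∧ p₂.eval (B : ℤ) = q.c ∧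
      p₃.eval (B : ℤ) = q.d) ∧
    (CoeffSumLE p₀ q.n ∧ CoeffSumLE p₁ q.n ∧ CoeffSumLE p₂ q.n ∧ CoeffSumLE p₃ q.n) ∧
    z = aeval s p₀ + aeval s p₁ * u + (aeval s p₂ + aeval s p₃ * u) * w

def add (q r : KroneckerValue) : KroneckerValue :=
  ⟨q.a + r.a, q.b + r.b, q.c + r.c, q.d + r.d, q.n + r.n⟩

def neg (q : KroneckerValue) : KroneckerValue := ⟨-q.a, -q.b, -q.c, -q.d, q.n⟩

/-- The cubic polynomial `g₀ + g₁ u` that is the square of `w`: the part `g₀`. -/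
noncomputable def cubic₀ : ℤ[X] := -6420 + X * (2612 + X * (-338 + X * 16))

/-- The cubic polynomial `g₀ + g₁ u` that is the square of `w`: the part `g₁`. -/
noncomputable def cubic₁ : ℤ[X] := 4440 + X * (-788 + X * 54)

def cubicValue₀ : ℤ := -6420 + B * (2612 + B * (-338 + B * 16))

def cubicValue₁ : ℤ := 4440 + B * (-788 + B * 54)

def mul (q r : KroneckerValue) : KroneckerValue :=
  ⟨q.a * r.a - 11 * (q.b * r.b) + cubicValue₀ B * (q.c * r.c - 11 * (q.d * r.d))
      - 11 * (cubicValue₁ B * (q.c * r.d + q.d * r.c)),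
    q.a * r.b + q.b * r.a + cubicValue₀ B * (q.c * r.d + q.d * r.c)
      + cubicValue₁ B * (q.c * r.c - 11 * (q.d * r.d)),
    q.a * r.c + q.c * r.a - 11 * (q.b * r.d + q.d * r.b),
    q.a * r.d + q.d * r.a + q.b * r.c + q.c * r.b, 262144 * (q.n * r.n)⟩

/-- The value of a list of coefficients. -/
def ofList (L : List (ℤ × ℤ)) : KroneckerValue :=
  L.foldr (fun c q => ⟨c.1 + B * q.a, c.2 + B * q.b, B * q.c, B * q.d,
    c.1.natAbs + c.2.natAbs + q.n⟩) ⟨0, 0, 0, 0, 0⟩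

def isZero (q : KroneckerValue) : Bool :=
  q.a == 0 && q.b == 0 && q.c == 0 && q.d == 0 && Nat.blt q.n B

def isNonzero (q : KroneckerValue) : Bool :=
  (! (q.a == 0 && q.b == 0)) && q.c == 0 && q.d == 0 && Nat.blt q.n B

end KroneckerValue

namespace KroneckerValue.Describes

variable {Ω : Type*} [Field Ω] {B : ℕ} {s u w : Ω} {q r : KroneckerValue} {x y : Ω}

theorem add (hq : q.Describes B s u w x) (hr : r.Describes B s u w y) :
    (q.add r).Describes B s u w (x + y) := by
  obtain ⟨p₀, p₁, p₂, p₃, ⟨a, b, c, d⟩, ⟨ha, hb, hc, hd⟩, rfl⟩ := hq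
  obtain ⟨r₀, r₁, r₂, r₃, ⟨a', b', c', d'⟩, ⟨ha', hb', hc', hd'⟩, rfl⟩ := hr
  refine ⟨p₀ + r₀, p₁ + r₁, p₂ + r₂, p₃ + r₃, ?_, ⟨ha.add ha', hb.add hb', hc.add hc', hd.add hd'⟩, ?_⟩
  · simp [*, KroneckerValue.add]
  · simp only [map_add]; ring

theorem neg (hq : q.Describes B s u w x) : q.neg.Describes B s u w (-x) := by
  obtain ⟨p₀, p₁, p₂, p₃, ⟨a, b, c, d⟩, ⟨ha, hb, hc, hd⟩, rfl⟩ := hq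
  refine ⟨-p₀, -p₁, -p₂, -p₃, ?_, ⟨ha.neg, hb.neg, hc.neg, hd.neg⟩, ?_⟩
  · simp [*, KroneckerValue.neg]
  · simp only [map_neg]; ring

theorem coeffSumLE_cubic₀ : CoeffSumLE cubic₀ 9386 := by
  have h : ∀ a : ℤ, CoeffSumLE (a : ℤ[X]) a.natAbs := CoeffSumLE.intCast
  simpa [cubic₀] using (h (-6420)).add ((h 2612).add ((h (-338)).add (h 16).X_mul).X_mul).X_mul

theorem coeffSumLE_cubic₁ : CoeffSumLE cubic₁ 5282 := by
  have h : ∀ a : ℤ, CoeffSumLE (a : ℤ[X]) a.natAbs := CoeffSumLE.intCast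
  simpa [cubic₁] using (h 4440).add ((h (-788)).add (h 54).X_mul).X_mul

theorem mul (hu : u ^ 2 = -11) (hw : w ^ 2 = aeval s cubic₀ + aeval s cubic₁ * u)
    (hq : q.Describes B s u w x) (hr : r.Describes B s u w y) : (q.mul B r).Describes B s u w (x * y) := by
  obtain ⟨p₀, p₁, p₂, p₃, ⟨a, b, c, d⟩, ⟨ha, hb, hc, hd⟩, rfl⟩ := hq
  obtain ⟨r₀, r₁, r₂, r₃, ⟨a', b', c', d'⟩, ⟨ha', hb', hc', hd'⟩, rfl⟩ := hr
  have h11 : CoeffSumLE 11 11 := CoeffSumLE.intCast 11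
  have hG := coeffSumLE_cubic₀
  have hG' := coeffSumLE_cubic₁
  have hE := (hc.mul hc').add ((h11.mul (hd.mul hd')).neg)
  have hE' := (hc.mul hd').add (hd.mul hc')
  refine ⟨p₀ * r₀ + -(11 * (p₁ * r₁)) + cubic₀ * (p₂ * r₂ + -(11 * (p₃ * r₃)))
      + -(11 * (cubic₁ * (p₂ * r₃ + p₃ * r₂))),
    p₀ * r₁ + p₁ * r₀ + cubic₀ * (p₂ * r₃ + p₃ * r₂) + cubic₁ * (p₂ * r₂ + -(11 * (p₃ * r₃))),
    p₀ * r₂ + p₂ * r₀ + -(11 * (p₁ * r₃ + p₃ * r₁)),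
    p₀ * r₃ + p₃ * r₀ + p₁ * r₂ + p₂ * r₁, ?_, ⟨?_, ?_, ?_, ?_⟩, ?_⟩
  · simp only [KroneckerValue.mul, eval_add, eval_mul, eval_neg, a, b, c, d, a', b', c', d']
    have e11 : eval (B : ℤ) (11 : ℤ[X]) = 11 := by simp
    have e0 : eval (B : ℤ) cubic₀ = cubicValue₀ B := by simp [cubic₀, cubicValue₀]
    have e1 : eval (B : ℤ) cubic₁ = cubicValue₁ B := by simp [cubic₁, cubicValue₁]
    rw [e11, e0, e1]
    exact ⟨by ring, by ring, by ring, trivial⟩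
  · refine ((((ha.mul ha').add (h11.mul (hb.mul hb')).neg).add (hG.mul hE)).add
      (h11.mul (hG'.mul hE')).neg).mono ?_
    simp only [KroneckerValue.mul]
    generalize q.n * r.n = N
    omega
  · refine ((((ha.mul hb').add (hb.mul ha')).add (hG.mul hE')).add (hG'.mul hE)).mono ?_
    simp only [KroneckerValue.mul]
    generalize q.n * r.n = N
    omega
  · refine (((ha.mul hc').add (hc.mul ha')).add (h11.mul ((hb.mul hd').add (hd.mul hb'))).neg).mono ?_
    simp only [KroneckerValue.mul]
    generalize q.n * r.n = N
    omega
  · refine ((((ha.mul hd').add (hd.mul ha')).add (hb.mul hc')).add (hc.mul hb')).mono ?_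
    simp only [KroneckerValue.mul]
    generalize q.n * r.n = N
    omega
  · have e11 : aeval s (11 : ℤ[X]) = (11 : Ω) := map_ofNat _ 11
    simp only [map_add, map_mul, map_neg, e11]
    linear_combination (aeval s p₁ * aeval s r₁ + (aeval s p₁ * aeval s r₃ + aeval s p₃ * aeval s r₁) * w
      + aeval s p₃ * aeval s r₃ * w ^ 2
      + (aeval s p₂ * aeval s r₃ + aeval s p₃ * aeval s r₂) * aeval s cubic₁) * hu
      + (aeval s p₂ * aeval s r₂ + (aeval s p₂ * aeval s r₃ + aeval s p₃ * aeval s r₂) * u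
        - 11 * aeval s p₃ * aeval s r₃) * hw

theorem ofList (L : List (ℤ × ℤ)) :
    (KroneckerValue.ofList B L).Describes B s u w ((listPoly u L).eval s) := by
  induction L with
  | nil =>
    have h0 := CoeffSumLE.zero 0
    exact ⟨0, 0, 0, 0, by simp [KroneckerValue.ofList], ⟨h0, h0, h0, h0⟩, by simp [listPoly]⟩
  | cons x L ih =>
    obtain ⟨p₀, p₁, p₂, p₃, ⟨a, b, c, d⟩, ⟨ha, hb, hc, hd⟩, h⟩ := ih
    refine ⟨(x.1 : ℤ[X]) + X * p₀, (x.2 : ℤ[X]) + X * p₁, X * p₂, X * p₃, ?_,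
      ⟨((CoeffSumLE.intCast _).add ha.X_mul).mono ?_, ((CoeffSumLE.intCast _).add hb.X_mul).mono ?_,
        hc.X_mul.mono ?_, hd.X_mul.mono ?_⟩, ?_⟩
    · simp only [eval_add, eval_mul, eval_X, eval_intCast, a, b, c, d]
      exact ⟨rfl, rfl, rfl, rfl⟩
    any_goals simp only [KroneckerValue.ofList, List.foldr_cons]; omega
    · simp only [listPoly, List.foldr_cons, eval_add, eval_C, eval_mul, eval_X] at h ⊢
      rw [h]
      simp only [map_add, map_mul, aeval_X, map_intCast]
      ring

theorem w_describes : (⟨0, 0, 1, 0, 1⟩ : KroneckerValue).Describes B s u w w := by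
  have h0 := CoeffSumLE.zero 1
  have h1 := CoeffSumLE.one
  exact ⟨0, 0, 1, 0, by simp, ⟨h0, h0, h1, h0⟩, by simp⟩

theorem eq_zero (hq : q.Describes B s u w x) (h : q.isZero B = true) : x = 0 := by
  obtain ⟨p₀, p₁, p₂, p₃, ⟨a, b, c, d⟩, ⟨ha, hb, hc, hd⟩, rfl⟩ := hq
  simp only [isZero, Bool.and_eq_true, beq_iff_eq, Nat.blt_eq] at h
  obtain ⟨⟨⟨⟨h1, h2⟩, h3⟩, h4⟩, h5⟩ := h
  rw [ha.eq_zero h5 (a.trans h1), hb.eq_zero h5 (b.trans h2), hc.eq_zero h5 (c.trans h3),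
    hd.eq_zero h5 (d.trans h4)]
  simp

theorem ne_zero (hu : u ^ 2 = -11) (hs : Transcendental ℤ s) (hq : q.Describes B s u w x)
    (h : q.isNonzero B = true) : x ≠ 0 := by
  obtain ⟨p₀, p₁, p₂, p₃, ⟨a, b, c, d⟩, ⟨ha, hb, hc, hd⟩, rfl⟩ := hq
  simp only [isNonzero, Bool.and_eq_true, beq_iff_eq, Nat.blt_eq] at h
  obtain ⟨⟨⟨h1, h3⟩, h4⟩, h5⟩ := h
  rw [hc.eq_zero h5 (c.trans h3), hd.eq_zero h5 (d.trans h4)]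
  intro h0
  simp only [map_zero, zero_mul, add_zero] at h0
  have h6 : aeval s (p₀ ^ 2 + 11 * p₁ ^ 2) = 0 := by
    have e11 : aeval s (11 : ℤ[X]) = (11 : Ω) := map_ofNat _ 11
    simp only [map_add, map_mul, map_pow, e11]
    linear_combination (aeval s p₀ - aeval s p₁ * u) * h0 + aeval s p₁ ^ 2 * hu
  have h7 := (transcendental_iff.1 hs) _ h6
  have h8 := congrArg (eval (B : ℤ)) h7
  simp only [eval_add, eval_mul, eval_pow, a, b, eval_zero] at h8
  rw [show eval (B : ℤ) (11 : ℤ[X]) = 11 by simp] at h8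
  have ha0 : q.a = 0 := by nlinarith [sq_nonneg q.a, sq_nonneg q.b]
  have hb0 : q.b = 0 := by nlinarith [sq_nonneg q.a, sq_nonneg q.b]
  simp [ha0, hb0] at h1

end KroneckerValue.Describes

/-- Polynomial expressions in elements of `ℤ[s, u]` and `w`. -/
inductive CurveExpr
  | poly (L : List (ℤ × ℤ))
  | w
  | add (x y : CurveExpr)
  | neg (x : CurveExpr)
  | mul (x y : CurveExpr)

namespace CurveExpr

def kronecker (B : ℕ) : CurveExpr → KroneckerValue
  | poly L => .ofList B L
  | w => ⟨0, 0, 1, 0, 1⟩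
  | add x y => (x.kronecker B).add (y.kronecker B)
  | neg x => (x.kronecker B).neg
  | mul x y => (x.kronecker B).mul B (y.kronecker B)

variable {Ω : Type*} [Field Ω]

noncomputable def value (s u v : Ω) : CurveExpr → Ω
  | poly L => (listPoly u L).eval s
  | w => v
  | add x y => x.value s u v + y.value s u v
  | neg x => -x.value s u v
  | mul x y => x.value s u v * y.value s u v

instance : Add CurveExpr := ⟨add⟩
instance : Mul CurveExpr := ⟨mul⟩
instance : Neg CurveExpr := ⟨neg⟩
instance : Sub CurveExpr := ⟨fun x y => add x (neg y)⟩

variable {B : ℕ} {s u v : Ω}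

theorem value_add (x y : CurveExpr) : (x + y).value s u v = x.value s u v + y.value s u v := rfl

theorem value_mul (x y : CurveExpr) : (x * y).value s u v = x.value s u v * y.value s u v := rfl

theorem value_neg (x : CurveExpr) : (-x).value s u v = -x.value s u v := rfl

theorem value_sub (x y : CurveExpr) : (x - y).value s u v = x.value s u v - y.value s u v :=
  (sub_eq_add_neg _ _).symm

theorem describes (hu : u ^ 2 = -11)
    (hv : v ^ 2 = aeval s KroneckerValue.cubic₀ + aeval s KroneckerValue.cubic₁ * u) (x : CurveExpr) :
    (x.kronecker B).Describes B s u v (x.value s u v) := by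
  induction x with
  | poly L => exact .ofList L
  | w => exact .w_describes
  | add x y hx hy => exact hx.add hy
  | neg x hx => exact hx.neg
  | mul x y hx hy => exact hx.mul hu hv hy

end CurveExpr

end KroneckerSubstitution

section CurveIdentities

namespace CurveExpr

instance : OfNat CurveExpr 0 := ⟨poly []⟩
instance : OfNat CurveExpr 1 := ⟨poly [(1, 0)]⟩

def pow (x : CurveExpr) : ℕ → CurveExpr
  | 0 => 1
  | n + 1 => x.pow n * x

def isZero (B : ℕ) (x : CurveExpr) : Bool := (x.kronecker B).isZero B

def isNonzero (B : ℕ) (x : CurveExpr) : Bool := (x.kronecker B).isNonzero B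

/-- Sum of polynomials given by lists of coefficients. -/
def addList : List CurveExpr → List CurveExpr → List CurveExpr
  | [], l => l
  | x :: l, [] => x :: l
  | x :: l, y :: m => (x + y) :: addList l m

/-- Product of polynomials given by lists of coefficients. -/
def mulList : List CurveExpr → List CurveExpr → List CurveExpr
  | [], _ => []
  | x :: l, m => addList (m.map (x * ·)) (0 :: mulList l m)

/-- Product of `a₀ + a₁ y` and `b₀ + b₁ y` when `y ^ 2 = p * y - q`. -/
def mulPair (p q : CurveExpr) (a b : CurveExpr × CurveExpr) : CurveExpr × CurveExpr :=
  (a.1 * b.1 - a.2 * b.2 * q, a.1 * b.2 + a.2 * b.1 + a.2 * b.2 * p)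

/-- The value of a polynomial given by a list of coefficients, when `y ^ 2 = p * y - q`. -/
def evalPair (p q : CurveExpr) : List CurveExpr → CurveExpr × CurveExpr
  | [] => (0, 0)
  | x :: l => (x + (mulPair p q (0, 1) (evalPair p q l)).1, (mulPair p q (0, 1) (evalPair p q l)).2)

section Value

variable {Ω : Type*} [Field Ω] {B : ℕ} {s u v : Ω}

theorem value_zero : (0 : CurveExpr).value s u v = 0 := by
  change (listPoly u []).eval s = (0 : Ω)
  simp [listPoly]

theorem value_one : (1 : CurveExpr).value s u v = 1 := by
  change (listPoly u [(1, 0)]).eval s = 1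
  simp [listPoly]

theorem value_pow (x : CurveExpr) (n : ℕ) : (x.pow n).value s u v = x.value s u v ^ n := by
  induction n with
  | zero => exact (value_one (s := s) (u := u) (v := v)).trans (pow_zero _).symm
  | succ n ih => rw [pow, value_mul, ih, pow_succ]

theorem value_eq_zero (hu : u ^ 2 = -11)
    (hv : v ^ 2 = aeval s KroneckerValue.cubic₀ + aeval s KroneckerValue.cubic₁ * u) {x : CurveExpr}
    (hx : x.isZero B = true) : x.value s u v = 0 :=
  (describes hu hv x).eq_zero hx

theorem value_ne_zero (hu : u ^ 2 = -11)
    (hv : v ^ 2 = aeval s KroneckerValue.cubic₀ + aeval s KroneckerValue.cubic₁ * u)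
    (hs : Transcendental ℤ s) {x : CurveExpr} (hx : x.isNonzero B = true) : x.value s u v ≠ 0 :=
  (describes hu hv x).ne_zero hu hs hx

/-- The value at `y` of the polynomial with the given coefficients. -/
noncomputable def evalList (s u v y : Ω) : List CurveExpr → Ω
  | [] => 0
  | x :: l => x.value s u v + y * evalList s u v y l

variable {y : Ω}

theorem evalList_addList (l m : List CurveExpr) :
    evalList s u v y (addList l m) = evalList s u v y l + evalList s u v y m := by
  induction l generalizing m with
  | nil => simp [addList, evalList]
  | cons x l ih =>
    cases m with
    | nil => simp [addList, evalList]
    | cons z m =>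
      simp only [addList, evalList, ih, value_add]
      ring

theorem evalList_map_mul (x : CurveExpr) (l : List CurveExpr) :
    evalList s u v y (l.map (x * ·)) = x.value s u v * evalList s u v y l := by
  induction l with
  | nil => simp [evalList]
  | cons z l ih =>
    simp only [List.map_cons, evalList, ih, value_mul]
    ring

theorem evalList_mulList (l m : List CurveExpr) :
    evalList s u v y (mulList l m) = evalList s u v y l * evalList s u v y m := by
  induction l with
  | nil => simp [mulList, evalList]
  | cons x l ih =>
    simp only [mulList, evalList, evalList_addList, evalList_map_mul, ih, value_zero]
    ring

theorem evalList_eq_zero (hu : u ^ 2 = -11)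
    (hv : v ^ 2 = aeval s KroneckerValue.cubic₀ + aeval s KroneckerValue.cubic₁ * u)
    {l : List CurveExpr} (hl : l.all (isZero B) = true) : evalList s u v y l = 0 := by
  induction l with
  | nil => rfl
  | cons x l ih =>
    rw [List.all_cons, Bool.and_eq_true] at hl
    rw [evalList, value_eq_zero hu hv hl.1, ih hl.2, mul_zero, add_zero]

theorem mulPair_value {p q : CurveExpr} (hy : y ^ 2 = p.value s u v * y - q.value s u v)
    (a b : CurveExpr × CurveExpr) :
    (mulPair p q a b).1.value s u v + (mulPair p q a b).2.value s u v * y =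
      (a.1.value s u v + a.2.value s u v * y) * (b.1.value s u v + b.2.value s u v * y) := by
  simp only [mulPair, value_add, value_sub, value_mul]
  linear_combination -(a.2.value s u v * b.2.value s u v) * hy

theorem evalPair_value {p q : CurveExpr} (hy : y ^ 2 = p.value s u v * y - q.value s u v)
    (l : List CurveExpr) :
    (evalPair p q l).1.value s u v + (evalPair p q l).2.value s u v * y = evalList s u v y l := by
  induction l with
  | nil => simp [evalPair, evalList, value_zero]
  | cons x l ih =>
    have h := mulPair_value hy (0, 1) (evalPair p q l)
    rw [value_zero, value_one, ih] at h
    simp only [evalPair, evalList, value_add]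
    linear_combination h

end Value

end CurveExpr

namespace CurveData

open CurveExpr

def denominator : List (ℤ × ℤ) := [(-37288, 12130), (7893, -819), (-1964, 518), (388, -70), (-42, 6), (2,
    0)]

def resolvent : List (ℤ × ℤ) := [(1317696816533730541449132829793091041121574182878298526298565137685,
    -14456089753566094568122218780338536939812443595953192580323936871),
    (-2842224645570373297602442899604521839742843254889699789914458055754,
    -847759125342434601033233457386810967453311870394474226489309860906),
    (599835141638853435251150314710872021058297069267663751776930051471,
    1936161019853646688009931319088661446545018060449043620612778913599),
    (3706862311150522857830714977287878874035711052453536724603277295790,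
    -1873021033790436736649615634571863197513549384212971279829344024222),
    (-5633826207872625783995637227817653605062078717749695889123800708146,
    821201912758711690855609256553189774340642888921469427982472935068),
    (4390812265692954557464322581543688911316592118553612482268769106098,
    128291928643216562667805361374916028993244668036716911835087298930),
    (-2139767533474425865950824721368304014815462108421488620564227651544,
    -457818035339751542543722574343341486963878460828503732647614889576),
    (589210843248364453367269744713491255946567044041813649248988770836,
    365711965645289251664796705767865600726230219439131712007325453232),
    (21885121546988932977232055439662349714209910368871020423102558931,
    -183733672402264309733436289023483322784503659616702012644697863903),
    (-121191049879450191090824333304882185268876615773739294755189575974,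
    64579720489117219648204701248196891680870684703537218738712797298),
    (74859469567687216418790568483419217591539506886389754787974493788,
    -14882299742735000416507507287066449254468798501934576125997822826),
    (-29578279832783755545781586647003443437111987518599196526009049540,
    1019181107474793686791044038462293524014937126987775239865489092),
    (8515692248733061917384135101747601715964924233506451830607593699,
    946453619444104015669771487091601195510131115024686232728383409),
    (-1745774576520685582506834692857504587288150138111486500095007406,
    -563178954485141001395465359098895021851649291552939261850056554),
    (188510454251558368166059858004696721348111032718608252465918463,
    193562342650485001174091908974608252354152977642378615914456613),
    (29439815827838524368962482297512072493344937992660989280912108,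
    -48461556138470074977070818115842741406334257704587293149452472),
    (-22603910413946779644278650335252799119221065302558445640930970,
    8978869714381514290905866271727321851517723171342475217608970),
    (7234810039945458209709609385238173045424846886249086943437448,
    -1058173936613479000598254992178792022270313006809087356256556),
    (-1630243199523855903840322948517860973224053302749181302412007,
    -9987521579272753487270776762515014945688059288543662557627),
    (275096226013536923416781895119754719152330472516680546466400,
    44728980311048499334598517065137644242918161824052474621308),
    (-32029869594575938394051573955940378461879391970603239943418,
    -14127248475656178396225178254515868827326101621143460896484),
    (1178095521698399820147111426545514995393053851578490409848,
    2928342490752451079205259546292105988076673342050254213000),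
    (565480940670511711207741100670612493198827874232358969291,
    -452411676835744757476113220571095541691048857192564672751),
    (-186926336158278989079279611504062105191406506989431115922,
    50163390003126821212583003223320691609338257621644065226),
    (36139001944794202597842027883609981738974284531117163993,
    -2695152413933201155955512513483707784816304585897471925),
    (-5128214256091781927459996618802910702774880699637931368,
    -384476506650514821815722435965028528201925046163651728),
    (533250897988521438416151951018031704029802182264677545,
    144153039345531474665424999507694510183461932743263789),
    (-31973881050179848553785671608225301232578436530198966,
    -26242904994520021015660253638156260218318007735775062),
    (-1554706904448744380299640232445967567520019539717957,
    3426789854890510834954754678442408863426502390549771),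
    (792005708050961129057743624704828283684827446535156,
    -331917691182994076739750358536209075477557293143772),
    (-137253594517596424656307903031865736348068747897642,
    20514507039332995658837241986646862953589621812864),
    (16524049652046119662704916347851963468466407216532, 126436110381721180116437961966520853691179085096),
    (-1486780889111781549953847146110080235407483126279, -250191409768431970473352735022181050963326152585),
    (91773192469577883441969425050596565645065508014, 42179174818977928122814553240511342342108279726),
    (-1605611172602920936994181461405401537443355314, -4698805239311830173717331304957822644138614432),
    (-506564845244864528494181812705977891572993004, 392266826762755888366318399065880076476905132),
    (88062187134533852908650053697346166743039688, -23777218570638761307577711434904864797809666),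
    (-9153943068652095519234730053552042186810900, 754737677645607826932380658861362463625560),
    (707615246970057099005630567403950848179246, 40938442183823790595175011860376650289608),
    (-41433755758457664138664070900994226724942, -9259147017023020413140872971637026901414),
    (1645834704417904543602331854879495181170, 919825602534081274864950204175572225390),
    (-14986982418032169400355917172967224574, -65474885524782773150564683144588466166),
    (-4242494830340769351658757497188410337, 3605115127732790936536627295829441597),
    (453233233003736817729800513504899722, -153000194228812353546094355143025310),
    (-29329254767473935649867681193366208, 4672742806096789909887298790292168),
    (1422588013771969674394455562558302, -80097503241026618450937675881490),
    (-55674124760567064978412264548261, -214849816915104972914023696887), (1961348730103004657288586211818,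
    -2264960140860481004589822558), (-78088702458802161877230843561, 6750118834991088043225550889),
    (3986167325792808474846381348, -577422110388867479077096656), (-213486633619443104512146192,
    26523549195539030485910928), (9839811151494679143732174, -748125655993727691121134),
    (-364680389390127273843336, 13667096785654239146208), (10971029028304762607718, -478766986456008890574),
    (-300700335200845852272, 44741508457923635754), (9638318150671266090, -2978333654401435770),
    (-377450651358559449, 130198417298094519), (13637788225058316, -4009685227249152), (-361542914414253,
    95663199517281), (5675254379388, -2321438064660), (-14887744641, 77234249565), (-926430318,
    -2731545234), (-16037703, 73788759), (1656820, -1325104), (-40953, 14025), (462, -66), (-2, 0)]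

def sextic₁Even : List (ℤ × ℤ) := [(-4922016, 1601160), (1041876, -108108), (-259248, 68376), (51216,
    -9240), (-5544, 792), (264, 0)]

def sextic₁Odd : List (ℤ × ℤ) := []

def sextic₂Even : List (ℤ × ℤ) := [(-1852671057876, -6308819200476), (-2105809265736, 1705006412928),
    (183631929822, -685649693754), (-143122832820, 186016340052), (35860614174, -39087693918), (-8079867972,
    6761976156), (1406055222, -947426958), (-210441132, 94373964), (20159568, -5682384), (-1138500, 163260),
    (25014, 318), (72, 0)]

def sextic₂Odd : List (ℤ × ℤ) := [(-7846281432, -2172108960), (1364081796, 1403302320), (68545521,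
    -393615855), (-201942180, 111042846), (58665618, -10443186), (-8394606, 941850), (1008711, -22239),
    (-61479, -1215), (3366, -72), (-99, -9)]

def sextic₃Even : List (ℤ × ℤ) := [(23568656493529867104, 5276453865537634848), (-6210958943210843448,
    -3200945291484623640), (3761742723457831992, 1238945849650972152), (-1205321077003474728,
    -488986117049120616), (333183993946307856, 142036901407318896), (-77983773298144560,
    -36600876198541584), (15363813463022376, 8142085747514664), (-2415086105545872, -1575552893035968),
    (297473908781808, 257556392446320), (-25274798988912, -35532056870640), (633544506936, 3955844980296),
    (179452472760, -335009546136), (-29074363560, 19702693368), (2079430056, -704792664), (-72912312,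
    10567800), (638000, 51392), (12936, 696)]

def sextic₃Odd : List (ℤ × ℤ) := [(41768977223304576, 148412684176848), (-22169062539814284,
    -4819359945522780), (7095706208996580, 2186852611539132), (-1809345130022448, -972799667605008),
    (209550803530392, 272295424583208), (-11637571737528, -65688675940008), (-8968285291284,
    13138931301804), (3147570975384, -1988669529000), (-637560526680, 232687560600), (86764582080,
    -19796608656), (-8447961852, 1213084620), (577042272, -44650008), (-26712936, 1072224), (875232, 4104),
    (-10584, -1512), (-96, -24)]

def sextic₄Even : List (ℤ × ℤ) := [(-19806552309567583728019872, 1486001843991477440624160),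
    (10669942983273861459173760, 655275655656474301312128), (-4994894976408078705773568,
    -67027939607029045571712), (2040495806318500968319872, 13422295669415582922624),
    (-728914930966685726502624, 23066863767971102118816), (251377713543941277967872,
    -11551098194881988564736), (-76447236916690974614016, 2530414739719012587264), (19820895225827129799552,
    -65526879990614129280), (-4335272919201880437408, -142658338122089028000), (806878595620719883008,
    58910644153880925696), (-128038091062479719616, -14988884281006347072), (17329369678565962752,
    2901394867662330624), (-1973785528586542176, -455578615136463264), (182855802850136064,
    58911810302633472), (-12828385352458368, -6175570462192512), (582588372478464, 504901818270720),
    (-7608243867840, -30445958104704), (-929566357632, 1240006734720), (60724287360, -28511709696),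
    (-1039699584, 161827200), (-24414720, 4233216), (742016, 3200), (-896, 640)]

def sextic₄Odd : List (ℤ × ℤ) := [(-28572998023750942297008, 13154828829150527581104),
    (35305181537259714966864, -4096017739608327620208), (-19426376041166625857568, 1971361897170952238784),
    (10479195774411525955728, -199717791710564794896), (-3724481090127606909408, -239034630864579827040),
    (1048930213384213072704, 159595674151599188928), (-221466725937233400096, -61700447570524982496),
    (35589139240826486304, 16565335468477075872), (-4258691762298321744, -3508062075695075472),
    (309459526064118144, 612267569191008864), (10276889132725776, -90566955546013584), (-8242656670808208,
    11306884713363504), (1634072426780112, -1176334317077040), (-215603653383360, 99118655773920),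
    (20672341292592, -6499624238064), (-1454787149904, 316956337200), (73081160064, -10796768640),
    (-2509768800, 235444320), (49496832, -1747008), (-15840, 23904), (-9856, -3328)]

def sextic₅Even : List (ℤ × ℤ) := [(3135072935842972330024325789568, -1769561306331283919009854136448),
    (-4110700262142260934799779371904, 518080628298194713482138221184), (1282284663729044295474329383296,
    -15984133743292707317234212224), (39850845600900095128599965568, 75175779246602804980647552),
    (-256382917299712102646809598976, -50695880047817383581716600064), (123256553908018592508811600896,
    48194864578157700532426191360), (-31136581800253238813692632576, -24689956866435543664436260608),
    (2745398669488402447002878208, 8974460919003119876521405440), (1374898810503370060125106560,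
    -2528281772876492280153500544), (-813228310675348343682420096, 573785761817420673252640128),
    (259018989250520646304312320, -106545604162710131834418432), (-61019205530499636384362112,
    16243684513535159720926848), (11564638641298805970213504, -2011940895871639519625088),
    (-1831494789479853456456960, 194925074659731223805952), (247756160201404444939008,
    -12844377882897987801600), (-28992388055185055635200, 105691329386636995584), (2941560202512081262464,
    128000044749112214400), (-255578763408987009024, -24404481222600188160), (18443992116529229184,
    2954769540585109632), (-1048868662656912768, -264240575417301120), (42953656433377536,
    17553346737924096), (-1021665467053440, -827715333785472), (214606060416, 24678139881600),
    (770955128064, -290847905280), (-16703394048, -8060940288), (-25462272, 399158016), (1947264, -8038272),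
    (-11264, 93952)]

def sextic₅Odd : List (ℤ × ℤ) := [(-13790124068814815017823795520, -5748666265733977628173765440),
    (8399674073685923616363826752, 5767497985817597946479354304), (-5538764122238242319092828416,
    -5705596293849651418951582080), (-1653285404801180590303435776, 3680815509274065188326458624),
    (2724818099791745508241461120, -1491066394884577087069432320), (-1607383127863481876793255744,
    428063526609471128970842688), (628913157003000228801651264, -79777105049744878930228800),
    (-185736146728973063279120064, 5408423440450079370780096), (43766363250936726570758016,
    2515998889376500517231616), (-8394302685200093348569344, -1239137237343624440481792),
    (1320447404534846893227648, 337033681729502246184960), (-170095505696312772693888,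
    -68264638727703124487040), (17822704948408566756288, 11184872721856606245312), (-1479916801406462518656,
    -1546390203838166987136), (88018199606974840704, 185331565517188900608), (-1621077259810101696,
    -19558340166594836160), (-493912157544184896, 1817317067612270400), (92311717264696512,
    -146227491854034624), (-10054290730074624, 9900226209126528), (770549817096576, -547765026069888),
    (-42188125110912, 24267939303168), (1597579137792, -856176013440), (-38430920448, 24268025088),
    (414782208, -562163328), (1062720, 10953792), (129408, -110208), (-2624, -1088)]

def sextic₆Even : List (ℤ × ℤ) := [(-991713246898358542596453046630448640,
    473817123350472865304857612912722432), (401918568665214132389567880393974784,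
    -521412218547140995911135313768700928), (-185903537063726673040202368636566528,
    364845718935905229663365273073573888), (241232089338649271056482236470680576,
    -171514492669886168084508858216305664), (-203564310620661069375720675929255424,
    40765180673066893494074497542210048), (93595600866824757969452350444219392,
    8571335519699319466355267769928704), (-19702739612667421235536774187194368,
    -12589024432595460259469168364724224), (-3751740392968265239741060737469440,
    6057807508220441073633985433508864), (4843002561268508963100981913360896,
    -1775782272631069803587788918568448), (-2175665061994260302518943244051456,
    307782280419566521785188343837696), (651088594015237112597747518436352,
    -5496874475105628127567322836992), (-144098338541628490287413998934016,
    -16381663433557621403156155957248), (23862508613912995037470920688128, 6461572636472047262600540852736),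
    (-2750232297058957707820045516800, -1580487749240061478760399738880), (137518566668253580634365330944,
    289941862230565150806308335104), (25979789615659049035365350400, -42062813359629965073391481856),
    (-8749826352890420989400934912, 4894953799029386474450511360), (1507068803768931636194497536,
    -452981916113026291840429056), (-189520487309601440365773312, 32042566922361632639894016),
    (18889222187524066695465984, -1520986660486950656314368), (-1542016181985865586896896,
    16956224597312333697024), (104886675026362098828288, 5139792846734429002752), (-5984863463621615040000,
    -628933019577299136000), (282384106566938754048, 46657289122172457984), (-10209361621547506176,
    -2584451664108311040), (197677691869667328, 104970750113101824), (6162615375307776, -2213971041567744),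
    (-768139772894208, -76605941320704), (35762605705728, 10065431195136), (-881608983552, -502947062784),
    (5924171264, 14298126848), (261347328, -205019136), (-5693952, 370176), (10240, 16384)]

def sextic₆Odd : List (ℤ × ℤ) := [(5743376703256210900973588417589504, 4241048827879667106630634818394368),
    (-7219860534205176221780517011395584, -2640441551555633620961118359913984),
    (4153724734843702650489052824085248, 721437594251027437507973171205888),
    (-2514519170534967327128018470109184, 161469170356065741217037546436096),
    (1813020226757597913416084420066304, -175968964462485540659094272236032),
    (-1057485573631714599805611556654848, 14961640104010015640377455870720),
    (437045028108723804640505216668416, 45305920986664025844598875224832),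
    (-123218461926696082047735929011200, -34534175081205579829728603849216),
    (20239817884492424040651973224960, 14691390811197827756864685539328), (433191604258782587303097078528,
    -4370418713950999741275660580608), (-1504152002840344699927166813952, 960299378944680894830613593856),
    (563710285287064699796975719680, -153323949275085935434422009600), (-136375164434291478501108112128,
    15272975097821108395295887104), (24789976205757114245287756032, 33665061695250356634269952),
    (-3530051298262055421368388864, -383131253261130156989814528), (395449627938298147265534208,
    93668208462303456523799808), (-33946600272313699457194752, -14710324654120707667107072),
    (2047140269868715427729664, 1750484067563212397736192), (-58959126285528403604736,
    -166174046947048421295360), (-3196810875248624595456, 12930362982307778347008), (503690936515535298816,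
    -849439073971210662144), (-26122251096551934720, 49556682440385170688), (-99308294486362368,
    -2766703477577948928), (120436870322393856, 156033847497109248), (-9896500574712576, -8644701153496320),
    (417292959105792, 428578699878144), (-5487391692288, -17021199430656), (-452280837888, 466624758528),
    (31180723200, -5610954240), (-865776384, -128030976), (9073152, 6156288), (25344, -71424)]

def quintic₁Even : List (ℤ × ℤ) := [(1932700882968, -737048877336), (-60133989168, -21503058336),
    (-178286843988, -45110709540), (59589640440, 20042887752), (-9423267876, -7058362428), (140004216,
    1412054712), (206598348, -189779292), (-45550296, 14083416), (4051872, -245088), (-129096, -34632),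
    (-2772, 1692), (144, 0)]

def quintic₁Odd : List (ℤ × ℤ) := [(-15692562864, -4344217920), (2728163592, 2806604640), (137091042,
    -787231710), (-403884360, 222085692), (117331236, -20886372), (-16789212, 1883700), (2017422, -44478),
    (-122958, -2430), (6732, -144), (-198, -18)]

def quintic₂Even : List (ℤ × ℤ) := [(1928156942624520960, 5188113556085462400), (1634202279567312840,
    -776909965487479704), (1195620786706388328, 225851944038678504), (-616274517761031096,
    -79007029853993496), (245772823138170768, 32119713727648272), (-66559622763867552, -11714615162256672),
    (14440599299401704, 3462739541685864), (-2348519096976624, -832735743158880), (275169186642240,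
    157212860229216), (-17218153160208, -23089065961104), (-806043361464, 2476564891416), (313865739000,
    -175465175832), (-32681716056, 6099090696), (1572149304, 95163768), (-16420536, -16689672), (-1359072,
    413424), (31944, 696)]

def quintic₂Odd : List (ℤ × ℤ) := [(118645333778441088, -1723584238620912), (-64357020157809132,
    -10957145610674844), (20448834122243196, 5575204911725172), (-5199558779161512, -2569485259995336),
    (579583155032568, 726980760224712), (-27726538175424, -171649728068544), (-24168829865004,
    33631092386100), (8077393110600, -4987912168008), (-1584920220840, 578028435336), (210907654848,
    -49325061456), (-20267209908, 3139908948), (1392276384, -131701896), (-66962376, 4270320), (2391120,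
    -43416), (-36720, -3888), (-96, -24)]

def quintic₃Even : List (ℤ × ℤ) := [(-30371720619312856633021056, -5839268208228160371312768),
    (5343073010038820609771328, 3558329868748144936403520), (-3656976523425531070598592,
    -628051367716767927552960), (1519437782637386603323200, 72126575729185547881152),
    (-662285465320173902707104, 63086961289642656609312), (266915059327175183489664,
    -33751656570082022612352), (-92278239989017862983104, 10121501927908837195200),
    (26451433597189440913920, -1831086026825599014912), (-6283522161043792362720, 142967645238194776224),
    (1245412704913406631360, 36144879014643792192), (-205367021339845654080, -17913294448191850176),
    (27896334588572518656, 4423179837201387264), (-3017645532052287840, -781974087166126944),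
    (239836777083864576, 105300965998700928), (-10841338001571264, -10696879132770240), (-187976963756736,
    777438435160512), (71476640478144, -35533616611392), (-5145559499520, 574219953792), (150056660160,
    35031051072), (1177887744, -2186237952), (-172963296, 34806240), (2528064, 91584), (1536, 384)]

def quintic₃Odd : List (ℤ × ℤ) := [(-151686302965716488020128, 58532097007190586345696),
    (173019814730430538004640, -19564069606404086102688), (-85566725493580800583488,
    5369607708259414236480), (38634908986530320571360, 153362591062907610528), (-12389750656245999740880,
    -943411653030719944944), (3417249274177274830800, 485286841973860667856), (-756078591187347148512,
    -181090161757689121728), (134221182442146298224, 49604852165320100880), (-18916317648750208896,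
    -11051818052214968640), (1905580644416646912, 2037587518187512128), (-78235138836844704,
    -314938870211930976), (-17105335311065760, 40294520813123424), (4728896711825616, -4222796685637680),
    (-678527709377760, 355400899369920), (66926234607408, -23384943786672), (-4811983113168, 1168684696368),
    (252355007520, -42191197056), (-9511731504, 981101808), (227169360, -4234032), (-1530144, -231552),
    (-22176, -4896)]

def quintic₄Even : List (ℤ × ℤ) := [(30150679687816961080488105900288, -4220998057587774149034938228736),
    (-19419420276823024161795297862656, -1010902845643931110354295275008), (7320360862060412296475884872960,
    539895695041661227165135355904), (-1768687024862199036449850944256, -233927883655813864683121628160),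
    (24315725582931350406763951488, -58978903335267726390369967488), (99036179897379122767794746112,
    98731052403401213517973547520), (-25186615023918354272256481920, -55190794353538585349666653056),
    (-3511306458149791017870020736, 20830920659293112636202152064), (4863275555691806756307712512,
    -6100030080213500037449297664), (-2149421790899918390733275904, 1462602412602293075327858688),
    (658652878894238561225033856, -294156277774424962073324928), (-160297174177256668117053312,
    49969284751658698601544576), (32522157961300389197578752, -7089302991392039008929024),
    (-5611755454210412065050624, 807561852658431954444288), (827749360412286260838912,
    -65348766326633277305088), (-103787345733518246697216, 1675694338932258588672),
    (10870413278249502857088, 557512130569738246272), (-919442920025787759360, -122695770243271915008),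
    (58979039397128484480, 14957579396699381376), (-2482998444583709184, -1243970642437712640),
    (32104750873536000, 70105458996156672), (3467902181800320, -2309189287439232), (-231109649971200,
    11443503681792), (4195714267008, 2547457070976), (121948561152, -102546051840), (-5811734016,
    1348634880), (39029760, -5483520), (380160, 172800)]

def quintic₄Odd : List (ℤ × ℤ) := [(-56179288968819984889722745344, -61918847546117485040418436992),
    (-40722298106827864616804543040, 53145230058738580713429395520), (31361627903801758127139176640,
    -32106073323676144146373685952), (-28978282038550440036655516608, 16357020943700126932369857216),
    (16898646408574353708007478016, -5872703812621594629263418240), (-7458395684397682905110831040,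
    1677866021591147620019701056), (2629814010469869897082360512, -346937040341729479242849600),
    (-756430065452605333190943168, 45803762213015781366410304), (184566749654530879553643264,
    369296165821398638397696), (-38703935179571003247400704, -2392406902636517406549888),
    (7039751152597112843929728, 873003108224789632240128), (-1109705905457467217215488,
    -215542451498510842518528), (150738896637624661292160, 42358881382073162788608),
    (-17281292990656833334080, -6958416345322468314816), (1602604490148102953664, 968205678056880222528),
    (-108595564097280943680, -114039789863453572032), (3480962346266676480, 11261807874891953280),
    (293959765578663360, -918911534558073408), (-59130327118585536, 60726172003713216), (5368268465334720,
    -3176743856780736), (-322457839475904, 127794361970880), (13449250907136, -3768216287616),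
    (-368907265728, 73322376768), (4748715072, -792866880), (32719680, 15073344), (-547200, -408960),
    (-9216, -2304)]

def quintic₅Even : List (ℤ × ℤ) := [(-385257514305201016186708610440333824,
    4429556278580617178317999759248357888), (5456460968155853262658038435793247232,
    -2921890960250830099418678115703796736), (-2949906538142018386698842480174482944,
    1153322695101266707513766602376563200), (1238547916545683151958111315366576128,
    -376343920768686543138735727504865280), (-422398909685390666696802952476240384,
    80968454126215411938141586662047232), (112495189770842431529955128084656128,
    8671795472480505335922100545589248), (6487889791863109212235512294893568,
    -21326609620841148078379407615154176), (-31122347097434678594223739013670912,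
    11120028474589200216629853363910656), (20391934192465670768585731056265728,
    -3064861399109904346009595246286336), (-8306840668210461797386886483300352,
    266964175534442570913432300410880), (2460759389990450246522687815434240,
    170745554583180183644991667574784), (-556910231629844606017994382348288,
    -100973790390120963759135785115648), (96796599059041291555070826852864,
    32618336468837792833821565960704), (-12300821598093552102163375346688,
    -7752831398533353395528474711040), (882320722619005597955882798592, 1472408424414545831591301259776),
    (55557617506637924639833749504, -231793187184109113134516600832), (-32398362447783969600080967168,
    30834506353119783552242661888), (6745799331501845822427838464, -3496793313219096182401308672),
    (-1012808401157286321768221184, 337320377951154733884824064), (122933885061861240717892608,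
    -27110772458891356600747008), (-12474594156830256422737920, 1705115129058285527937024),
    (1059542081648423936133120, -67731895809367067824128), (-73744117798452971410944,
    -603468577410475921920), (4019361965770889954304, 364328821568574415872), (-156601193230106786304,
    -32482225260546918912), (3318904257415160832, 1604117087122480128), (34087977271941120,
    -38090492722427904), (-4953803094586368, -538130386861056), (149990931560448, 75338844235776),
    (-2037201103872, -2654220856320), (28447828992, 51172577280), (-846455808, -682632192), (8464896,
    4511232), (-64512, 46080)]

def quintic₅Odd : List (ℤ × ℤ) := [(85205441507827799487803094415795968,
    9588862273619453307461095282995456), (-66869299362949158227396381974450944,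
    -14192715245551154289536889979918080), (44095621272350074789399292906678016,
    10718636076919206848658678703564032), (-19369445143854618123209502722705664,
    -7310246175023311623149737255510272), (7084792567639656332354921453740800,
    3509138778453941466618446387883264), (-2639812511964074476242306010224384,
    -1529110158691488914394795398969088), (850521865945812921846901976315904,
    642745980803548218106636847718912), (-178140797641830751074894856700160,
    -250036392520550337722742832245504), (-4412685124425346433601996229632,
    83653531993995236270134163168256), (21642445384032830834093606618112,
    -23018485781688572223883903785984), (-10394325233882739185167763647488,
    5111278562376369691515712429056), (3225055229823129485806438981632, -899125092734907546561144047616),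
    (-763663682701240421226381243648, 119674426108158539025593552640), (146547099376441722563484464640,
    -10140040091088956502016902144), (-23524180787522727562513342464, -75755753669796608209176576),
    (3225601398631811558392484352, 224412028597432052180190720), (-383594777959840672983867648,
    -51911564394397467664901376), (39950813731831775530914816, 8200672122010068583137792),
    (-3648411381711159054351360, -1042745500222121394017280), (288783885475666377308160,
    112206472524280688836608), (-19232883383975676619776, -10356132722859245749248),
    (1018668531986785253376, 815219556506221870080), (-38167929675172433664, -53875325476618880256),
    (650851813481050368, 2931214476438671616), (25449852431317248, -128856601743512832), (-2284542649813248,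
    4500473534887680), (75462943970304, -122960852983296), (-926241972480, 2599486629120), (-9714380544,
    -42999393024), (-355069440, 462053376), (35388672, 6643968), (-304128, -262656)]

def quintic₆Even : List (ℤ × ℤ) := [(128300049538508394662103926424287017113600,
    -1356101993689426506864696691823216591247360), (761424207194738123077736176207169355749376,
    1285966378976762288320339385695839962646528), (-1148233069090173413853107425156988581926912,
    -751381980953952913734392462083190735996928), (1014210282191732894468075671200529979154432,
    396297946883436124240437251849926221533184), (-558148849573100754779103239562429522542592,
    -245554780018124887727027123793923766964224), (138491067848112248639642524331267758073856,
    145517254879808041995417731944893348341760), (45641176053598709679470067463178204375040,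
    -64947979540399837667485985463294570719232), (-62402315955044915797586985137086418061312,
    18757463852365588601059711668507031504896), (32606912933932799616525962788142251063296,
    -1881798551135607313712947695225094821888), (-10859033445274053280147418567329091051520,
    -1278389926062574269118033522840487608320), (2358540597640300240217205705857771194368,
    871234480909507230819751386494480652288), (-226282404901633312900940416352356448256,
    -316344669060992692100157013172404119552), (-62340094480438220346510343279078275072,
    81331465725541268245471864892961429504), (38355108190421865298405110920208181248,
    -15483837832288713342655883174276941824), (-11486887999927269362265326540628713472,
    2052789729650910754787043040019632128), (2477798657975104468381142634066739200,
    -118815055555800081490434480618786816), (-416941829588986176291798691643129856,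
    -26079971354542315363958177124335616), (55587548915780967216455960650088448,
    10339913357002003093685727968673792), (-5715040730776805290384183227439104,
    -2115576402133928472631068566759424), (401487991814358003415008252893184,
    318739470539882923703001482864640), (-7246621083150040293074032957440,
    -38261378926942823013527506176000), (-2956730737931639360010590515200, 3755962248925963603577575624704),
    (557036683476176537815211458560, -303333649394726215761924980736), (-62966219555216609722442575872,
    20015270775365927060371009536), (5347356180991327311046520832, -1054893882577092101141741568),
    (-360331248918106528313518080, 41873886572369925047482368), (19336268929429587816198144,
    -1019853477227694001397760), (-780692235542079984009216, -4645079563892690644992),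
    (17481856873635122411520, 1555000562596481206272), (502566095555738818560, -10892602107596335104),
    (-81175643594338664448, -9467017155361345536), (4903314230935701504, 1071516259463620608),
    (-178452454227683328, -69108395902875648), (3217004399904768, 2960447588628480), (38923290464256,
    -81683382251520), (-4009540220928, 1147584264192), (98711230464, 4428232704), (-860479488, -405725184),
    (-1419264, 3999744)]

def quintic₆Odd : List (ℤ × ℤ) := [(-29530179799613825104187179509227890332672,
    -5856973897831080728429241736305183157248), (32409424818610501585363608707266281431040,
    3131966434599757863912043127922689267712), (-20876068152282035945976902671325134307328,
    -1736016382620800087539520198445454946304), (7819079937074953572663269800538884743168,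
    1037715462843194907649815815173760649216), (-1080789066000547765555127735850999782400,
    -229297698608530713232925931816224922624), (-374678535220488104780985908332969147392,
    -252137009159207688425535730851763332096), (75643809487545517194014629021781121024,
    284555265881099958585682059068462886912), (164872716191313773370440210544668295168,
    -151202081392723489842493869613847076864), (-149664614651326929899050672718867733504,
    50276307738820520985677794613108173824), (72256126668139229970323345449578015744,
    -9755518502433468674458565726372213760), (-24192574291252885001251937886869087232,
    35733523439809427637421529744292864), (5994199637002282917063304239409271808,
    774112902604227989000593114218845184), (-1086578794956387775614393172394179584,
    -340683179000514764916903607957183488), (124426244053806162841056925759362048,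
    94844089656050113987492109733061632), (15903910485636145482402212990976,
    -19829037503257821019378847653687296), (-4107710053861084311706547602827264,
    3251136278837804290583742402158592), (1196309069716211499210452820642816,
    -416559872703867062744673513925632), (-226193605504760213219479179967488,
    39287435751077983813071629890560), (32854169588159242780107768843264, -2058638658317592263994583434240),
    (-3852798169911401631693804641280, -109037342301208245767168105472), (371847224225754493240123984896,
    43359113181721586676567174144), (-29821713707211533208093358080, -6356565393135062628783439872),
    (2013654286138600616570772480, 654873905926091259572954112), (-118673300383202025078285312,
    -53146124962067076790219776), (6631896574190927776886784, 3588053331951250806583296),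
    (-389420925284884757658624, -212508748310286147812352), (24004930963962572421120,
    11772428619972717877248), (-1361209259351870134272, -639779958190114283520), (59989931481791950848,
    33536090908646092800), (-1513567070305145856, -1559069345350370304), (-23288553997277184,
    56573810550614016), (4508529584790528, -1231903773619200), (-229263284929536, -6842630919168),
    (6178075130880, 1681489787904), (-67310991360, -61241647104), (-752744448, 980453376), (22244352,
    -3376128), (-30720, -49152)]

def traceEven : List (ℤ × ℤ) := [(4281640, -557896), (-697554, -146250), (81004, -5968), (-17864, 3116),
    (2244, -372), (-110, 2)]

def traceOdd : List (ℤ × ℤ) := [(-12216, 300), (3631, 1043), (-108, -216), (36, 18), (1, -1)]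

def normEven : List (ℤ × ℤ) := [(2379808204400, -112197536528), (-876465323712, -640853674560),
    (-168696378224, 124691706128), (39731951072, -4352821088), (-1878851216, -747166288), (-80808640,
    38967808)]

def normOdd : List (ℤ × ℤ) := [(-12754887816, 10786829592), (8941807072, 791384528), (253827024,
    -697424640), (-164692616, 43479656)]

def parameterEven : List (ℤ × ℤ) := [(-25588367136305482577590177933295570637550499795906015631696,
    942281973944222966237555716623127319209792153570282031076),
    (30777769498740793565768578288981015581950226041612733194688,
    -2837583028315597136187405700776400582168362008470451640048),
    (180210168607656006681666954358091966737944062034791305656,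
    4139068141838459927151020497527697382988482517587529028416),
    (-24918955049889437021061738272416214938407360024983742759594,
    -9802152147966451697212575871010701701864130049482494801174),
    (13699970247954471971448275492915381021856125882756949033774,
    14087065397059142102662877014338151413176329574493697068606),
    (10215328604994197786149265830642256763838912428037357889058,
    -10944724847646710806671906692701335958395203644493208911670),
    (-19084080188921602500246378920748494526321636682830130853724,
    4154118485191903698262371566408263215054728319167936481264),
    (13099235200362040984800635673244195413016055344600634799030,
    388632040693395554710102212966279779423655521709870176130),
    (-4696759794343432433939300877586114251472624608624927103698,
    -1495787233610204031164678368495367571642434154570524121894),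
    (274598731045415528548085402142308305969621728447032620194,
    980307516469617616663876861289773674802309231449824515866),
    (735879100436995248898814770729799576054289171105638860920,
    -364464419362205024628765569503311183996522240020044508136),
    (-505824666081526244135393655698110393538198174219935462074,
    69221852534771339074235718178294853979715491931549914354),
    (195906223346240192501224810439631092268467985649612433130,
    8798314352286991357202310712980099491619175403824141902),
    (-49196336496533434382488154355010981513170729603391619310,
    -12602355323470999796535668505723585382706512008330031530),
    (6157967430942394816404025542434220924411196864235990142,
    5532072541433819809976638876511152723281629478507847350),
    (1105265386400044161326752725852019502994920792349809130,
    -1583462602699955975517009392400305009021259548564185290),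
    (-920443138636295389764919471727226811718016965338457730,
    311117600316861397298670832352042360424059033925415818),
    (314139269298519699395221791915249574196999789755901076,
    -32553845012764270533536467197588914722409992252741704),
    (-73518788028055280733231315976549856223253272593613766,
    -3830966986639491338758154094737750544281180086578314),
    (12359799048602898183144745012336478907421403608706328,
    2919163477555762008154510982759720073269736975953184),
    (-1268288443504371158382912770648575850107664519207258,
    -853024253921213941196890126631450765871729415118146),
    (-31807671985523497007306470381153471770496441795638,
    173180443742363285242245861561099810297033169082346),
    (50252794298627273432179371962706838513181440355640,
    -26198319282057684236479248973901717642255726780388),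
    (-13744270331948831264036520679383603219043854552282,
    2743229058619926791633752229159324834740668840582), (2527096139478413840452654742123099596366047838124,
    -99578954219292390624637595663674783129149362156), (-352536275402077601508713831675093534862089408780,
    -35024211338116094170343688925659313570892412592), (36903894540259344067771953262433079792491361130,
    10583290616419301945685234116956018837219982606), (-2407245503929072171629843326264058371903377326,
    -1847832901624511907854422037630331302898435918), (-45043372040088119113764703630302680933551018,
    241418702760095875143847682003534539879990210), (42575920131355029130371440997567425452182024,
    -24590883432454533668993159776798582122716700), (-7787965853576429157343259868534799367105802,
    1861459705575789000282912913865049619838082), (977273454102112582020078019895018415384882,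
    -77295557755942891869487527740524977739530), (-95509863857996676983610269870122437672492,
    -4390021294968335115407847737604505606728), (7392110279961935182229152887632764469758,
    1374566780385821626891313529634423507094), (-428731192976975721727838931997971939758,
    -179466929977808452364843572680938646670), (13784918784035772599261923964409785584,
    17050459982465347666679194410725590268), (583964646718390925710300324536714386,
    -1297054894765803978889124213540516666), (-144780825964134805628320778231572762,
    80950510875612334311277330974925546), (15050226026495438407363249648660912,
    -4106774529513257289554917309484632), (-1181291041796146169592903813050646,
    158762287154953104183874922280078), (79711408989467358630288936214722,
    -3174991031585975424041521777398), (-4961123657695765778755047376140, -197493898068859029938103575772),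
    (295764546929811852154702005192, 35918919432726550182058578108), (-16699482388698987315058210722,
    -3778230141033876027689974026), (829125049791240620100826626, 332527939106702908698191634),
    (-29932252580155104771261010, -25442400417068258104158986), (122354711024470968060798,
    1676860464145337427615978), (97898128863261187087330, -93335579019034675338334),
    (-10499258850361615127244, 4241889149470665614328), (723439494111296427828, -145673368166870199744),
    (-38013673175337694692, 2816443379991648792), (1573863225203585030, 55062179540644870),
    (-50573495203098032, -7985111942614576), (1177737341729806, 413684386338674), (-15423069810192,
    -14199210831036), (-105336903244, 345541343356), (10869416052, -5770845564), (-272285002, 57567158),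
    (3675452, -167068), (-25784, -2684), (66, 22)]

def parameterOdd : List (ℤ × ℤ) := [(-48062267680248044362135371482112290623191946768635220590,
    48715272975547715725851560072458986132917783810895172248),
    (-104193596049594292295416669075637649129681431587895817423,
    -102048523490501006150878769286579300857577189605272798737),
    (101644910167097907898065820216239361595247909833533971801,
    128181564873444966522237924989065775534986074845213889753),
    (102067885266406757323606351268102623409933640767059783401,
    -87150773393053051584497170370247169708335707175966626823),
    (-194292081114087396838642630059384251964286720557874778277,
    3132236894531315002476060924838720497016109557704439701),
    (91796278797172351609902198434847533409394618765428583596,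
    47401827051178161856557391643236335225662066504645884188),
    (32731498014095103945559465649473355567412611560082113674,
    -42893705926239266814714455660742225355889796032128868592),
    (-70513149905730273634025545907122836664722684676347768690,
    17721681073399149302702251799450726748201032062366385550),
    (47902335079737126196292478898170037481357910029909259399,
    -1038992527450966719073363413227076335967579242240076627),
    (-18718082742363273305904184006516233500949594703698210048,
    -3409708707592255983374022434831283826940168008780559244),
    (3621743491953103587290906665209425373597287274744862128,
    2457126346556649879022567196312767151210066243289846876),
    (596870578109620157878826622193152058044173635645131381,
    -982257546713407795965022020505672911313412136284703321),
    (-784664702201447516504919930399886432097030005331075988,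
    245407598471901331439113204829961841322802051628429878),
    (346743459525195440353574713819277560954417629791356380,
    -24870038182691110264058888734269855516496790717861520),
    (-98768783629844683056508960641650073750240596849493747,
    -9882000234157600701099006409579155684219815248887579),
    (18422496936422552181658604829765852760602241513842675,
    6436982658364241426999075160647079895901335020373719),
    (-1325776524951000023492014294738713931075815580880157,
    -2104707960797169600703796932804738582422227493212877),
    (-530750478082323009704198180691032353598669757055008,
    476779307120387560280688021238247695304920680301224),
    (268210496303127231084986486458821213115821869065989,
    -74858884096379116921885847166572831066338736439009),
    (-72421688388693265147034609282505758776663167675687,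
    5735828182783980398402426557637240330507131235157), (14007084172217233331129347735210095726438570438353,
    961579655183512530784141239860159072119276186171), (-1982833458978896378322870958967706442703373652934,
    -499689046909523975164047570415025302679368014058), (173946710265980995802509577348873612545025882046,
    120659423112238081372747935164961731332895831904), (3271147641361316352262452801619098319456507834,
    -20845382652381852028733889575408169542631686128), (-4926786815886174779448780213918120073144353319,
    2733743045047932383326638819456294422871281275), (1169543278165539254195813665537780934156479577,
    -256610076006299598008454003932455832999066693), (-187159731243641170721169796122578803998835384,
    10932335148934991458885136370378214399524226), (22942484536527341342702309964680547990763154,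
    1694958814587240475643547614114796873250936), (-2162547265265540012292743015698750527556248,
    -512327758405948809576173372389784886273684), (140200519907109119589192609919124920848154,
    80200731955822071752558716408441786814036), (-2199890124944806491871160127908162279296,
    -9273153005474386162311745430225089449536), (-976140018940462866976680243640313003083,
    842917013567889498843653767149695739871), (178483326773895330230182746620723902885,
    -59352979708356977304214930736590184701), (-20082002300904796577476688982854490734,
    2859051842373829790187936319788613058), (1717694999724142088447351371250292637,
    -29203256856288083691149744293803091), (-116420139738209584355862397669814270,
    -11589580331417597119057775335638550), (6155281485323174465953970059473397,
    1509089239981321416540129545194055), (-233214894321935258727264554097586,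
    -117642778878129814717777222728116), (4542102888344711660337730450769, 6407689150001803380816407216755),
    (45993022540943706822657272792, -211967052532331779934460226358), (7905811334115878731285802174,
    -1439987703973901227571550080), (-3041072923210572868069962697, 789486583364662908073246645),
    (411497383060552725280321439, -61269188749982351272960595), (-38631912675106795906108324,
    2285456870385399568940236), (2890662096127938614405705, 63365633060104353997453),
    (-179763795268139249806465, -19307852387747821742447), (9278460168672249816356, 1993752401115134014618),
    (-380807431905777383546, -146881598699847834304), (10741330336872928461, 8574940318264971717),
    (-56647444707651094, -405303885586963022), (-15482543645958972, 15327568201187814), (1128004724528704,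
    -443450150900746), (-48492920188031, 8656424757431), (1457947284706, -55754971756), (-30637675673,
    -2984512597), (407220650, 122987464), (-2162305, -2355703), (-24226, 24342), (456, -108), (-2, 0)]


def ofLists (N M : List (ℤ × ℤ)) : CurveExpr := poly N + poly M * w

def const (a b : ℤ) : CurveExpr := poly [(a, b)]

def den : CurveExpr := poly denominator

def param : CurveExpr := ofLists parameterEven parameterOdd

/-- The coefficients of the homogenised cubic factors, for `u` and for `-u`. -/
def tripleFactor (e : ℤ) (D : CurveExpr) : List CurveExpr :=
  [const 332 (-52 * e) * D.pow 3, const 642 (-42 * e) * D.pow 2, const 54 0 * D, 1]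

def simpleFactor (e : ℤ) (D : CurveExpr) : List CurveExpr :=
  [const 40172 (-6292 * e) * D.pow 3, const 3426 (-138 * e) * D.pow 2, const 102 0 * D, 1]

def sextic : List CurveExpr :=
  [ofLists sextic₆Even sextic₆Odd, ofLists sextic₅Even sextic₅Odd, ofLists sextic₄Even sextic₄Odd,
    ofLists sextic₃Even sextic₃Odd, ofLists sextic₂Even sextic₂Odd, ofLists sextic₁Even sextic₁Odd, 1]

def disc : CurveExpr := ofLists quintic₁Even quintic₁Odd

def quintic : List CurveExpr :=
  [ofLists quintic₆Even quintic₆Odd, ofLists quintic₅Even quintic₅Odd, ofLists quintic₄Even quintic₄Odd,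
    ofLists quintic₃Even quintic₃Odd, ofLists quintic₂Even quintic₂Odd, disc]

def dodecic : List CurveExpr :=
  addList (mulList (mulList (tripleFactor 1 den) (tripleFactor 1 den))
      (mulList (tripleFactor 1 den) (simpleFactor 1 den)))
    [0, const (2 ^ 18 * 67) (2 ^ 18 * 253) * param]

theorem sextic_check : (addList (mulList [disc] (mulList sextic sextic))
    (addList (mulList [-disc] dodecic) (mulList [const (-1) 0] (mulList quintic quintic)))).all
      (isZero (2 ^ 2000)) = true := by
  decide +kernel

/-- The cubic polynomial whose square is the square of `w`. -/
def cubic : List (ℤ × ℤ) := [(-6420, 4440), (2612, -788), (-338, 54), (16, 0)]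

theorem resolvent_check : isZero (2 ^ 2000) (const 64 0 * (poly parameterEven * poly parameterEven -
    poly cubic * (poly parameterOdd * poly parameterOdd)) - den.pow 11 * poly resolvent) = true := by
  decide +kernel

def traceExpr : CurveExpr := ofLists traceEven traceOdd

def normExpr : CurveExpr := ofLists normEven normOdd

def conjTriple : CurveExpr × CurveExpr :=
  evalPair traceExpr normExpr (tripleFactor (-1) (const 2 0 * den))

def conjSimple : CurveExpr × CurveExpr :=
  evalPair traceExpr normExpr (simpleFactor (-1) (const 2 0 * den))

/-- The value of the conjugate polynomial at a root of the quadratic polynomial. -/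
def conjDodecic : CurveExpr × CurveExpr :=
  let m := mulPair traceExpr normExpr
  m (m conjTriple conjTriple) (m conjTriple conjSimple)

theorem quadratic_check : (isZero (2 ^ 2000) conjDodecic.1 &&
    isZero (2 ^ 2000) (conjDodecic.2 + const (2 ^ 29 * 67) (-2 ^ 29 * 253) * param)) = true := by
  decide +kernel

theorem denominator_check : isNonzero (2 ^ 2000) den = true := by
  decide +kernel

theorem parameterOdd_check : isNonzero (2 ^ 2000) (poly parameterOdd) = true := by
  decide +kernel

theorem disc_check : isNonzero (2 ^ 2000)
    (disc * (poly quintic₁Even - poly quintic₁Odd * w)) = true := by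
  decide +kernel

theorem trace_norm_check : isNonzero (2 ^ 2000) ((traceExpr * traceExpr - const 4 0 * normExpr) *
    ((poly traceEven - poly traceOdd * w) * (poly traceEven - poly traceOdd * w)
      - const 4 0 * (poly normEven - poly normOdd * w))) = true := by
  decide +kernel

end CurveData

end CurveIdentities

section CurveValues

namespace CurveExpr

variable {Ω : Type*} [Field Ω] {s u v : Ω}

theorem map_listPoly_eval {Ω' : Type*} [Field Ω'] (f : Ω →+* Ω') (L : List (ℤ × ℤ)) :
    f ((listPoly u L).eval s) = (listPoly (f u) L).eval (f s) := by
  induction L with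
  | nil => simp [listPoly]
  | cons x L ih =>
    simp only [listPoly, List.foldr_cons, eval_add, eval_mul, eval_C, eval_X] at ih ⊢
    simp only [map_add, map_mul, map_intCast] at ih ⊢
    rw [ih]

theorem map_value {Ω' : Type*} [Field Ω'] (f : Ω →+* Ω') (x : CurveExpr) :
    f (x.value s u v) = x.value (f s) (f u) (f v) := by
  induction x with
  | poly L => exact map_listPoly_eval f L
  | w => rfl
  | add x y hx hy => simp only [value, map_add, hx, hy]
  | neg x hx => simp only [value, map_neg, hx]
  | mul x y hx hy => simp only [value, map_mul, hx, hy]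

theorem map_evalList {Ω' : Type*} [Field Ω'] (f : Ω →+* Ω') {y : Ω} (l : List CurveExpr) :
    f (evalList s u v y l) = evalList (f s) (f u) (f v) (f y) l := by
  induction l with
  | nil => exact map_zero f
  | cons x l ih => simp only [evalList, map_add, map_mul, ih, map_value]

/-- The polynomial with the given list of coefficients. -/
noncomputable def toPoly (s u v : Ω) : List CurveExpr → Polynomial Ω
  | [] => 0
  | x :: l => C (x.value s u v) + X * toPoly s u v l

theorem eval_toPoly (y : Ω) (l : List CurveExpr) :
    (toPoly s u v l).eval y = evalList s u v y l := by
  induction l with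
  | nil => simp [toPoly, evalList]
  | cons x l ih => simp [toPoly, evalList, ih]

theorem degree_toPoly_lt (l : List CurveExpr) : (toPoly s u v l).degree < l.length := by
  induction l with
  | nil => simp [toPoly]
  | cons x l ih =>
    rw [degree_lt_iff_coeff_zero] at ih ⊢
    intro m hm
    obtain ⟨m, rfl⟩ : ∃ k, m = k + 1 := ⟨m - 1, by simp at hm; omega⟩
    simp only [toPoly, coeff_add, coeff_C_succ, zero_add, coeff_X_mul]
    exact ih m (by simpa using hm)

theorem value_const (a b : ℤ) : (CurveData.const a b).value s u v = a + b * u := by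
  simp [CurveData.const, value, listPoly]

theorem value_poly (L : List (ℤ × ℤ)) : (poly L).value s u v = (listPoly u L).eval s := rfl

theorem value_w : w.value s u v = v := rfl

end CurveExpr

theorem degree_listPoly_lt {Ω : Type*} [Field Ω] (u : Ω) (L : List (ℤ × ℤ)) :
    (listPoly u L).degree < L.length := by
  induction L with
  | nil => simp [listPoly]
  | cons x L ih =>
    rw [degree_lt_iff_coeff_zero] at ih ⊢
    intro m hm
    obtain ⟨m, rfl⟩ : ∃ k, m = k + 1 := ⟨m - 1, by simp at hm; omega⟩
    have h : listPoly u (x :: L) = C (x.1 + x.2 * u) + X * listPoly u L := rfl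
    simp only [h, coeff_add, coeff_C_succ, zero_add, coeff_X_mul]
    exact ih m (by simpa using hm)

theorem coeff_listPoly {Ω : Type*} [Field Ω] (u : Ω) (L : List (ℤ × ℤ)) (n : ℕ) :
    (listPoly u L).coeff n = (L.getD n 0).1 + (L.getD n 0).2 * u := by
  induction L generalizing n with
  | nil => simp [listPoly]
  | cons x L ih =>
    have h : listPoly u (x :: L) = C (x.1 + x.2 * u) + X * listPoly u L := rfl
    cases n with
    | zero => simp [h]
    | succ n => simp only [h, coeff_add, coeff_C_succ, coeff_X_mul, ih, zero_add, List.getD_cons_succ]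

/-- The polynomial `2 ^ 8 * f_C (X / 2)`. -/
noncomputable def dodecicPoly {R : Type*} [CommRing R] (u t : R) : R[X] :=
  (X ^ 3 + 54 * X ^ 2 + C (642 - 42 * u) * X + C (332 - 52 * u)) ^ 3 *
    (X ^ 3 + 102 * X ^ 2 + C (3426 - 138 * u) * X + C (40172 - 6292 * u)) +
    C (2 ^ 16 * 3 ^ 12 * (67 + 253 * u) * t) * X

theorem eval_dodecicPoly {R : Type*} [CommRing R] (u t x : R) : (dodecicPoly u t).eval x =
    (x ^ 3 + 54 * x ^ 2 + (642 - 42 * u) * x + (332 - 52 * u)) ^ 3 *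
      (x ^ 3 + 102 * x ^ 2 + (3426 - 138 * u) * x + (40172 - 6292 * u)) +
      2 ^ 16 * 3 ^ 12 * (67 + 253 * u) * t * x := by
  simp [dodecicPoly]

/-- The data attached to a generic point `(s, v)` of the curve `v ^ 2 = G(s)` and the value `t` of
the parameter at it. -/
structure CurvePoint {Ω : Type*} [Field Ω] (u t s v : Ω) : Prop where
  sq : u ^ 2 = -11
  curve : v ^ 2 = aeval s KroneckerValue.cubic₀ + aeval s KroneckerValue.cubic₁ * u
  transcendental : Transcendental ℤ s
  parameter : 3 ^ 12 * t * CurveData.den.value s u v ^ 11 = 4 * CurveData.param.value s u v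

namespace CurvePoint

open CurveExpr CurveData

variable {Ω : Type*} [Field Ω] {u t s v : Ω} (h : CurvePoint u t s v)

include h

theorem den_ne_zero : den.value s u v ≠ 0 := value_ne_zero h.sq h.curve h.transcendental denominator_check

theorem disc_ne_zero : disc.value s u v ≠ 0 :=
  left_ne_zero_of_mul (value_ne_zero h.sq h.curve h.transcendental disc_check)

theorem parameterOdd_ne_zero : (listPoly u parameterOdd).eval s ≠ 0 :=
  value_ne_zero h.sq h.curve h.transcendental parameterOdd_check

theorem trace_sq_ne : traceExpr.value s u v ^ 2 - 4 * normExpr.value s u v ≠ 0 := by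
  have h1 := left_ne_zero_of_mul (value_ne_zero h.sq h.curve h.transcendental trace_norm_check)
  rw [value_sub, value_mul, value_mul, value_const] at h1
  convert h1 using 2
  · ring
  · push_cast; ring

theorem evalList_dodecic (x : Ω) : evalList s u v (den.value s u v * x) dodecic =
    den.value s u v ^ 12 * (dodecicPoly u t).eval x := by
  simp only [dodecic, evalList_addList, evalList_mulList, tripleFactor, simpleFactor, evalList, value_mul,
    value_const, value_pow, value_zero, value_one, eval_dodecicPoly]
  push_cast
  linear_combination -(2 ^ 16 * (67 + 253 * u) * den.value s u v * x) * h.parameter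

theorem disc_mul_sextic_sq {x : Ω} (hx : (dodecicPoly u t).eval x = 0) :
    disc.value s u v * evalList s u v (den.value s u v * x) sextic ^ 2 =
      evalList s u v (den.value s u v * x) quintic ^ 2 := by
  have h1 := evalList_eq_zero (y := den.value s u v * x) h.sq h.curve sextic_check
  have h2 := h.evalList_dodecic x
  rw [hx, mul_zero] at h2
  simp only [evalList_addList, evalList_mulList, h2] at h1
  simp only [evalList, value_neg, value_const] at h1
  push_cast at h1
  linear_combination h1

theorem eval_dodecicPoly_neg {x : Ω} (hx : (2 * den.value s u v * x) ^ 2 =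
    traceExpr.value s u v * (2 * den.value s u v * x) - normExpr.value s u v) (h2 : (2 : Ω) ≠ 0) :
    (dodecicPoly (-u) t).eval x = 0 := by
  have h0 := quadratic_check
  rw [Bool.and_eq_true] at h0
  have h3 := value_eq_zero h.sq h.curve h0.1
  have h4 := value_eq_zero h.sq h.curve h0.2
  simp only [conjDodecic] at h3 h4
  have e1 := evalPair_value hx (tripleFactor (-1) (const 2 0 * den))
  have e2 := evalPair_value hx (simpleFactor (-1) (const 2 0 * den))
  have m1 := mulPair_value hx conjTriple conjTriple
  have m2 := mulPair_value hx conjTriple conjSimple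
  have m3 := mulPair_value hx (mulPair traceExpr normExpr conjTriple conjTriple)
    (mulPair traceExpr normExpr conjTriple conjSimple)
  rw [m1, m2] at m3
  change conjTriple.1.value s u v + conjTriple.2.value s u v * _ = _ at e1
  change conjSimple.1.value s u v + conjSimple.2.value s u v * _ = _ at e2
  rw [e1, e2, h3, zero_add] at m3
  rw [value_add, value_mul, value_const] at h4
  simp only [tripleFactor, simpleFactor, evalList, value_mul,
    value_const, value_pow, value_one] at m3
  push_cast at m3 h4
  have h5 := h.parameter
  have hD := h.den_ne_zero
  rw [eval_dodecicPoly]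
  refine (mul_eq_zero.1 (?_ : (2 * den.value s u v) ^ 12 * _ = 0)).resolve_left
    (pow_ne_zero _ (mul_ne_zero h2 hD))
  linear_combination -m3 + (2 * den.value s u v * x) * h4 +
    2 ^ 12 * 2 ^ 16 * (67 - 253 * u) * den.value s u v * x * h5

end CurvePoint

/-- A polynomial of degree 66 with the first coordinate of the curve as root. -/
noncomputable def resolventPoly {Ω : Type*} [Field Ω] (u t : Ω) : Polynomial Ω :=
  C (4 * 3 ^ 24 * t ^ 2) * listPoly u CurveData.denominator ^ 11 -
    C (32 * 3 ^ 12 * t) * listPoly u CurveData.parameterEven + listPoly u CurveData.resolvent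

theorem eval_resolventPoly {Ω : Type*} [Field Ω] (u t s : Ω) : (resolventPoly u t).eval s =
    (4 * 3 ^ 24 * t ^ 2) * (listPoly u CurveData.denominator).eval s ^ 11 -
    (32 * 3 ^ 12 * t) * (listPoly u CurveData.parameterEven).eval s +
    (listPoly u CurveData.resolvent).eval s := by
  unfold resolventPoly
  generalize listPoly u CurveData.denominator = D
  generalize listPoly u CurveData.parameterEven = N
  generalize listPoly u CurveData.resolvent = R
  simp only [eval_add, eval_sub, eval_mul, eval_pow, eval_C]

open CurveExpr CurveData in
theorem exists_curvePoint {Ω : Type*} [Field Ω] [CharZero Ω] [IsAlgClosed Ω] {u t s : Ω} (hu : u ^ 2 = -11)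
    (hs : Transcendental ℤ s) (h : (resolventPoly u t).eval s = 0) :
    ∃ v, CurvePoint u t s v := by
  obtain ⟨v, hv⟩ := IsAlgClosed.exists_pow_nat_eq
    (aeval s KroneckerValue.cubic₀ + aeval s KroneckerValue.cubic₁ * u) (n := 2) (by norm_num)
  have hc : (listPoly u cubic).eval s = v ^ 2 := by
    rw [hv]
    simp only [listPoly, cubic, KroneckerValue.cubic₀, KroneckerValue.cubic₁, List.foldr_cons, List.foldr_nil,
      eval_add, eval_mul, eval_C, eval_X, eval_zero, map_add, map_mul, map_neg, aeval_X, map_ofNat]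
    push_cast
    ring
  have h1 := value_eq_zero hu hv resolvent_check
  simp only [value_sub, value_mul, value_const, value_pow, value_poly, den, hc] at h1
  have hM : (listPoly u parameterOdd).eval s ≠ 0 := value_ne_zero hu hv hs parameterOdd_check
  have hD : (listPoly u denominator).eval s ≠ 0 := value_ne_zero hu hv hs denominator_check
  have key : ∀ D N M R : Ω, (4 * 3 ^ 24 * t ^ 2) * D ^ 11 - (32 * 3 ^ 12 * t) * N + R = 0 →
      (((64 : ℤ) : Ω) + ((0 : ℤ) : Ω) * u) * (N * N - v ^ 2 * (M * M)) - D ^ 11 * R = 0 →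
      (3 ^ 12 * t * D ^ 11 - 4 * N) ^ 2 = (4 * (v * M)) ^ 2 := by
    intro D N M R h h1
    push_cast at h1
    have h4 : (4 : Ω) ≠ 0 := by norm_num
    refine mul_left_cancel₀ h4 ?_
    linear_combination D ^ 11 * h + h1
  rw [eval_resolventPoly] at h
  have h2 := key _ _ _ _ h h1
  rcases sq_eq_sq_iff_eq_or_eq_neg.1 h2 with h3 | h3
  · refine ⟨v, hu, hv, hs, ?_⟩
    simp only [param, ofLists, value_add, value_mul, value_poly, den, value_w]
    linear_combination h3
  · refine ⟨-v, hu, by rw [neg_sq, hv], hs, ?_⟩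
    simp only [param, ofLists, value_add, value_mul, value_poly, den, value_w]
    linear_combination h3

theorem natDegree_listPoly_le {Ω : Type*} [Field Ω] (u : Ω) {L : List (ℤ × ℤ)} {n : ℕ}
    (hn : L.length = n + 1) : (listPoly u L).natDegree ≤ n := by
  have h := degree_listPoly_lt u L
  rw [degree_lt_iff_coeff_zero, hn] at h
  exact natDegree_le_iff_coeff_eq_zero.2 fun N hN => h N hN

theorem resolventPoly_spec {Ω : Type*} [Field Ω] [CharZero Ω] (u t : Ω) :
    (resolventPoly u t).natDegree = 66 ∧ (resolventPoly u t).leadingCoeff = -2 := by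
  have h1 : (listPoly u CurveData.denominator).natDegree ≤ 5 := natDegree_listPoly_le u (by decide)
  have h2 : (listPoly u CurveData.parameterEven).natDegree ≤ 60 := natDegree_listPoly_le u (by decide)
  have h3 : (listPoly u CurveData.resolvent).natDegree ≤ 66 := natDegree_listPoly_le u (by decide)
  have h5 : (listPoly u CurveData.resolvent).coeff 66 = -2 := by
    rw [coeff_listPoly, show CurveData.resolvent.getD 66 0 = (-2, 0) by decide]
    simp
  unfold resolventPoly
  generalize listPoly u CurveData.denominator = D at *
  generalize listPoly u CurveData.parameterEven = N at *
  generalize listPoly u CurveData.resolvent = R at *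
  have h4 : (D ^ 11).natDegree ≤ 55 := natDegree_pow_le.trans (by omega)
  have hle : (C (4 * 3 ^ 24 * t ^ 2) * D ^ 11 - C (32 * 3 ^ 12 * t) * N + R).natDegree ≤ 66 :=
    natDegree_add_le_of_degree_le ((natDegree_sub_le_of_le (m := 66) (n := 66)
      ((natDegree_C_mul_le _ _).trans (h4.trans (by norm_num)))
      ((natDegree_C_mul_le _ _).trans (h2.trans (by norm_num)))).trans (max_self 66).le) h3
  have hc : (C (4 * 3 ^ 24 * t ^ 2) * D ^ 11 - C (32 * 3 ^ 12 * t) * N + R).coeff 66 = -2 := by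
    simp only [coeff_add, coeff_sub, coeff_C_mul]
    rw [coeff_eq_zero_of_natDegree_lt (h4.trans_lt (by norm_num)),
      coeff_eq_zero_of_natDegree_lt (h2.trans_lt (by norm_num)), h5]
    ring
  have hd := natDegree_eq_of_le_of_coeff_ne_zero hle (by rw [hc]; norm_num)
  exact ⟨hd, by rw [leadingCoeff, hd, hc]⟩

end CurveValues

section ModularPolynomials

/-- The value at `y` of the polynomial with the given coefficients. -/
def evalN {A : Type*} [CommRing A] (y : A) : List ℕ → A
  | [] => 0
  | c :: L => c + y * evalN y L

def addN : List ℕ → List ℕ → List ℕ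
  | [], l => l
  | x :: l, [] => x :: l
  | x :: l, y :: m => (x + y) % 23 :: addN l m

def scaleN (c : ℕ) (L : List ℕ) : List ℕ := L.map fun x => c * x % 23

def mulN : List ℕ → List ℕ → List ℕ
  | [], _ => []
  | c :: a, b => addN (scaleN c b) (0 :: mulN a b)

/-- Multiplication by `X` modulo a monic polynomial of degree 12. -/
def shiftN (P L : List ℕ) : List ℕ := addN (0 :: L.take 11) (scaleN 22 (mulN (L.drop 11) P))

/-- Multiplication modulo a monic polynomial of degree 12. -/
def mulRed (P : List ℕ) : List ℕ → List ℕ → List ℕ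
  | [], _ => []
  | c :: a, b => addN (scaleN c b) (shiftN P (mulRed P a b))

/-- `∑ i, c i * X ^ (23 * i) * p`, reduced modulo `X ^ 12 + P`. -/
def combRed (P : List ℕ) : List ℕ → List ℕ → List ℕ
  | _, [] => []
  | p, c :: a => addN (scaleN c p) (combRed P ((shiftN P)^[23] p) a)

/-- The power `X ^ (23 ^ j)` modulo a monic polynomial of degree 12. -/
def frobN (P : List ℕ) : ℕ → List ℕ
  | 0 => [0, 1]
  | j + 1 => combRed P [1] (frobN P j)

/-- The coefficients modulo 23 of `dodecicPoly`. -/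
def dodecicN (u t : ℕ) : List ℕ :=
  let T := [332 + 22 * 52 * u, 642 + 22 * 42 * u, 54, 1]
  let S := [40172 + 22 * 6292 * u, 3426 + 22 * 138 * u, 102, 1]
  addN (mulN (mulN T T) (mulN T S)) [0, 2 ^ 16 * 3 ^ 12 * (67 + 253 * u) * t]

def isZeroN (L : List ℕ) : Bool := L.all (· % 23 == 0)

/-- A certificate that a polynomial of degree 12 has a given number of roots fixed by the power
`23 ^ j`: the factors of the polynomial for the fixed and the moved roots, and cofactors. -/
structure FixCertificate where
  (fixed moved quotient left right : List ℕ)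

def FixCertificate.check (P : List ℕ) (j : ℕ) (c : FixCertificate) : Bool :=
  let d := addN (frobN P j) [0, 22]
  c.fixed.length + c.moved.length == 12 &&
  isZeroN (mulRed P (c.moved ++ [1]) (c.fixed ++ [1])) &&
  isZeroN (addN (mulRed P c.quotient (c.fixed ++ [1])) (scaleN 22 d)) &&
  isZeroN (addN (addN (mulRed P (c.moved ++ [1]) c.left) (mulRed P c.right d)) [22])

def derivN : List ℕ → List ℕ
  | [] => []
  | _ :: L => addN L (0 :: derivN L)

section Value

variable {A : Type*} [CommRing A] {y : A}

@[simp] theorem evalN_nil : evalN y [] = 0 := rfl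

@[simp] theorem evalN_cons (c : ℕ) (L : List ℕ) : evalN y (c :: L) = c + y * evalN y L := rfl

theorem evalN_append (L M : List ℕ) :
    evalN y (L ++ M) = evalN y L + y ^ L.length * evalN y M := by
  induction L with
  | nil => simp
  | cons c L ih => simp only [List.cons_append, evalN_cons, ih, List.length_cons]; ring

theorem evalN_take_add (n : ℕ) (L : List ℕ) :
    y * evalN y L = y * evalN y (L.take n) + y ^ (n + 1) * evalN y (L.drop n) := by
  induction n generalizing L with
  | zero => simp
  | succ n ih =>
    cases L with
    | nil => simp
    | cons c L =>
      simp only [evalN_cons, List.take_succ_cons, List.drop_succ_cons]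
      linear_combination y * ih L

variable [CharP A 23]

theorem natCast_mod (n : ℕ) : ((n % 23 : ℕ) : A) = n := by
  rw [← CharP.cast_eq_mod]

theorem evalN_addN (a b : List ℕ) : evalN y (addN a b) = evalN y a + evalN y b := by
  induction a generalizing b with
  | nil => simp [addN]
  | cons x a ih =>
    cases b with
    | nil => simp [addN]
    | cons z b =>
      simp only [addN, evalN_cons, natCast_mod, ih]
      push_cast
      ring

theorem evalN_scaleN (c : ℕ) (a : List ℕ) : evalN y (scaleN c a) = c * evalN y a := by
  induction a with
  | nil => simp [scaleN]
  | cons x a ih =>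
    simp only [scaleN, List.map_cons, evalN_cons, natCast_mod] at ih ⊢
    rw [ih]
    push_cast
    ring

theorem evalN_mulN (a b : List ℕ) : evalN y (mulN a b) = evalN y a * evalN y b := by
  induction a with
  | nil => simp [mulN]
  | cons x a ih =>
    simp only [mulN, evalN_addN, evalN_scaleN, evalN_cons, ih]
    push_cast
    ring

theorem cast_22 : ((22 : ℕ) : A) = -1 := by
  have h : ((23 : ℕ) : A) = 0 := CharP.cast_eq_zero A 23
  push_cast at h ⊢
  linear_combination h

theorem evalN_eq_zero {L : List ℕ} (h : isZeroN L = true) : evalN y L = 0 := by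
  induction L with
  | nil => rfl
  | cons c L ih =>
    rw [isZeroN, List.all_cons, Bool.and_eq_true, beq_iff_eq] at h
    rw [evalN_cons, ih h.2, ← natCast_mod, h.1]
    simp

theorem derivative_evalN {κ : Type*} [CommRing κ] [CharP κ 23] (L : List ℕ) :
    derivative (evalN (X : κ[X]) L) = evalN X (derivN L) := by
  induction L with
  | nil => simp [derivN]
  | cons c L ih =>
    simp only [derivN, evalN_addN, evalN_cons, derivative_add, derivative_mul, ih, derivative_X,
      derivative_natCast]
    push_cast
    ring

theorem eval_evalN {κ : Type*} [CommRing κ] (y : κ) (L : List ℕ) :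
    (evalN (X : κ[X]) L).eval y = evalN y L := by
  induction L with
  | nil => simp
  | cons c L ih => simp [ih]

theorem evalN_X_degree_lt {κ : Type*} [CommRing κ] (L : List ℕ) :
    (evalN (X : κ[X]) L).degree < L.length := by
  induction L with
  | nil => simp
  | cons c L ih =>
    rw [degree_lt_iff_coeff_zero] at ih ⊢
    intro m hm
    obtain ⟨m, rfl⟩ : ∃ k, m = k + 1 := ⟨m - 1, by simp at hm; omega⟩
    rw [evalN_cons, coeff_add, coeff_natCast_ite, if_neg (by omega), Nat.cast_zero, zero_add, coeff_X_mul]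
    exact ih m (by simpa using hm)

variable {P : List ℕ} (hy : evalN y (P ++ [1]) = 0) (hP : P.length = 12)

include hy hP

theorem evalN_shiftN (L : List ℕ) : evalN y (shiftN P L) = y * evalN y L := by
  rw [evalN_append, hP] at hy
  have h := evalN_take_add (y := y) 11 L
  simp only [shiftN, evalN_addN, evalN_scaleN, evalN_mulN, cast_22, evalN_cons] at hy ⊢
  push_cast at hy ⊢
  rw [evalN_nil] at hy
  linear_combination -h - evalN y (L.drop 11) * hy

theorem evalN_mulRed (a b : List ℕ) : evalN y (mulRed P a b) = evalN y a * evalN y b := by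
  induction a with
  | nil => simp [mulRed]
  | cons x a ih =>
    rw [mulRed, evalN_addN, evalN_scaleN, evalN_shiftN hy hP, ih, evalN_cons]
    ring

theorem evalN_iterate (n : ℕ) (L : List ℕ) : evalN y ((shiftN P)^[n] L) = y ^ n * evalN y L := by
  induction n with
  | zero => simp
  | succ n ih => rw [Function.iterate_succ_apply', evalN_shiftN hy hP, ih, pow_succ', mul_assoc]

theorem evalN_combRed (p a : List ℕ) : evalN y (combRed P p a) = evalN y p * evalN (y ^ 23) a := by
  induction a generalizing p with
  | nil => simp [combRed]
  | cons x a ih =>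
    rw [combRed, evalN_addN, evalN_scaleN, ih, evalN_iterate hy hP, evalN_cons]
    ring

theorem evalN_frobN (j : ℕ) : evalN y (frobN P j) = y ^ 23 ^ j := by
  have : Fact (Nat.Prime 23) := ⟨by norm_num⟩
  induction j with
  | zero => simp [frobN]
  | succ j ih =>
    rw [frobN, evalN_combRed hy hP]
    have h : ∀ L : List ℕ, evalN (y ^ 23) L = evalN y L ^ 23 := fun L => by
      induction L with
      | nil => simp
      | cons c L ih =>
        have : ExpChar A 23 := ExpChar.prime (by norm_num)
        rw [evalN_cons, evalN_cons, ih, add_pow_expChar, mul_pow, ← Nat.cast_pow]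
        congr 1
        have h1 : ((c : ZMod 23) ^ 23) = c := ZMod.pow_card _
        have h2 := congrArg (ZMod.castHom (dvd_refl 23) A) h1
        rw [map_pow, map_natCast] at h2
        rw [Nat.cast_pow, h2]
    rw [h, ih, ← pow_mul, pow_succ]
    simp

end Value

section Roots

variable {κ : Type*} [Field κ] [CharP κ 23]

omit [CharP κ 23] in
theorem card_roots_le {L : List ℕ} (R : Finset κ) (h : ∀ y ∈ R, evalN y (L ++ [1]) = 0) :
    R.card ≤ L.length := by
  have hne : (evalN (X : κ[X]) (L ++ [1])).coeff L.length = 1 := by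
    rw [evalN_append, coeff_add, coeff_eq_zero_of_degree_lt (evalN_X_degree_lt L)]
    simp
  have h0 : evalN (X : κ[X]) (L ++ [1]) ≠ 0 := fun h => by simp [h] at hne
  have hd : (evalN (X : κ[X]) (L ++ [1])).natDegree ≤ L.length := by
    have := evalN_X_degree_lt (κ := κ) (L ++ [1])
    rw [degree_lt_iff_coeff_zero] at this
    exact natDegree_le_iff_coeff_eq_zero.2 fun N hN => this N (by simp; omega)
  refine le_trans ?_ ((card_roots' _).trans hd)
  refine (Multiset.card_le_card ?_ : R.val.card ≤ _)
  refine (Multiset.le_iff_subset R.nodup).2 fun y hy => ?_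
  rw [mem_roots h0, IsRoot, eval_evalN]
  exact h y hy

theorem FixCertificate.card_eq [DecidableEq κ] {P : List ℕ} (hP : P.length = 12) {R : Finset κ}
    (hcard : R.card = 12) (hR : ∀ y ∈ R, evalN y (P ++ [1]) = 0) {j : ℕ} {c : FixCertificate}
    (hc : c.check P j = true) : (R.filter fun y => y ^ 23 ^ j = y).card = c.fixed.length := by
  simp only [check, Bool.and_eq_true, beq_iff_eq] at hc
  obtain ⟨⟨⟨h1, h2⟩, h3⟩, h4⟩ := hc
  have key : ∀ y ∈ R, evalN y (c.fixed ++ [1]) * evalN y (c.moved ++ [1]) = 0 ∧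
      evalN y c.quotient * evalN y (c.fixed ++ [1]) = y ^ 23 ^ j - y ∧
      evalN y c.left * evalN y (c.moved ++ [1]) + evalN y c.right * (y ^ 23 ^ j - y) = 1 := by
    intro y hy
    have h := hR y hy
    have e1 := evalN_eq_zero (y := y) h2
    have e2 := evalN_eq_zero (y := y) h3
    have e3 := evalN_eq_zero (y := y) h4
    simp only [evalN_addN, evalN_scaleN, evalN_mulRed h hP, evalN_frobN h hP, evalN_cons, evalN_nil,
      cast_22] at e1 e2 e3
    push_cast at e1 e2 e3
    exact ⟨by linear_combination e1, by linear_combination e2, by linear_combination e3⟩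
  have hf : (R.filter fun y => y ^ 23 ^ j = y).card ≤ c.fixed.length := by
    refine card_roots_le _ fun y hy => ?_
    rw [Finset.mem_filter] at hy
    obtain ⟨e1, e2, e3⟩ := key y hy.1
    rw [hy.2, sub_self, mul_zero, add_zero] at e3
    exact (mul_eq_zero.1 e1).resolve_right (right_ne_zero_of_mul (e3.trans_ne one_ne_zero))
  have hm : (R.filter fun y => ¬y ^ 23 ^ j = y).card ≤ c.moved.length := by
    refine card_roots_le _ fun y hy => ?_
    rw [Finset.mem_filter] at hy
    obtain ⟨e1, e2, e3⟩ := key y hy.1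
    refine (mul_eq_zero.1 e1).resolve_left fun h0 => hy.2 ?_
    rw [h0, mul_zero] at e2
    exact sub_eq_zero.1 e2.symm
  have := Finset.card_filter_add_card_filter_not (s := R) (fun y => y ^ 23 ^ j = y)
  omega

theorem pow_eq_self_of_frobN {P : List ℕ} (hP : P.length = 12) {y : κ} (hy : evalN y (P ++ [1]) = 0) {j : ℕ}
    (h : isZeroN (addN (frobN P j) [0, 22]) = true) : y ^ 23 ^ j = y := by
  have e := evalN_eq_zero (y := y) h
  simp only [evalN_addN, evalN_frobN hy hP, evalN_cons, evalN_nil, cast_22] at e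
  push_cast at e
  linear_combination e

/-- A polynomial certified to be coprime to its derivative. -/
def coprimeDerivN (P b : List ℕ) : Bool :=
  P.length == 12 && isZeroN (addN (mulRed P b (derivN (P ++ [1]))) [22])

theorem nodup_of_coprimeDerivN {P b : List ℕ} (h : coprimeDerivN P b = true) {M : Multiset κ}
    (hM : evalN (X : κ[X]) (P ++ [1]) = (M.map fun y => X - C y).prod) : M.Nodup := by
  rw [coprimeDerivN, Bool.and_eq_true, beq_iff_eq] at h
  classical
  rw [← roots_multiset_prod_X_sub_C M, Multiset.nodup_iff_count_le_one]
  intro y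
  rw [← hM, count_roots]
  by_contra! hlt
  have h0 : evalN (X : κ[X]) (P ++ [1]) ≠ 0 := by
    rw [hM]
    exact (monic_multiset_prod_of_monic _ _ fun y _ => monic_X_sub_C y).ne_zero
  obtain ⟨h1, h2⟩ := (one_lt_rootMultiplicity_iff_isRoot h0).1 hlt
  rw [IsRoot, eval_evalN] at h1
  rw [IsRoot, derivative_evalN, eval_evalN] at h2
  have e := evalN_eq_zero (y := y) h.2
  simp only [evalN_addN, evalN_mulRed h1 h.1, h2, evalN_cons, evalN_nil, cast_22] at e
  simp at e

end Roots

end ModularPolynomials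

section ModularRoots

theorem evalN_dodecicN {A : Type*} [CommRing A] [CharP A 23] (y : A) (u t : ℕ) :
    evalN y (dodecicN u t) =
      (y ^ 3 + 54 * y ^ 2 + (642 - 42 * (u : A)) * y + (332 - 52 * (u : A))) ^ 3 *
        (y ^ 3 + 102 * y ^ 2 + (3426 - 138 * (u : A)) * y + (40172 - 6292 * (u : A))) +
        2 ^ 16 * 3 ^ 12 * (67 + 253 * (u : A)) * t * y := by
  have h : (22 : A) = -1 := by simpa using cast_22 (A := A)
  simp only [dodecicN, evalN_addN, evalN_mulN, evalN_cons, evalN_nil]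
  push_cast
  have h1 : (1144 : A) = -52 := by linear_combination 52 * h
  have h2 : (924 : A) = -42 := by linear_combination 42 * h
  have h3 : (138424 : A) = -6292 := by linear_combination 6292 * h
  have h4 : (3036 : A) = -138 := by linear_combination 138 * h
  simp only [h1, h2, h3, h4]
  ring

theorem evalN_X_dodecicN {κ : Type*} [CommRing κ] [CharP κ 23] (u t : ℕ) :
    evalN (X : κ[X]) (dodecicN u t) = dodecicPoly (u : κ) (t : κ) := by
  rw [evalN_dodecicN, dodecicPoly]
  simp only [map_sub, map_add, map_mul, map_pow, map_ofNat, map_natCast]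

/-- The roots of the specialisation of `dodecicPoly` at `u`, `t` modulo 23 are distinct, they are fixed by
the `n`-th power of Frobenius, and for `(j, m)` in the list the `j`-th power fixes exactly `m` of them. -/
def ModularRoots (u t n : ℕ) (l : List (ℕ × ℕ)) : Prop :=
  ∀ (κ : Type) [Field κ] [CharP κ 23] (M : Multiset κ), M.card = 12 →
    dodecicPoly (u : κ) (t : κ) = (M.map fun y => X - C y).prod →
    M.Nodup ∧ (∀ y ∈ M, y ^ 23 ^ n = y) ∧
      ∀ c ∈ l, ∀ [DecidableEq κ], (M.toFinset.filter fun y => y ^ 23 ^ c.1 = y).card = c.2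

theorem modularRoots_of_check {u t n : ℕ} {l : List (ℕ × ℕ)} {b : List ℕ} {cs : List (ℕ × FixCertificate)}
    (h : (dodecicN u t == (dodecicN u t).take 12 ++ [1] && coprimeDerivN ((dodecicN u t).take 12) b &&
      isZeroN (addN (frobN ((dodecicN u t).take 12) n) [0, 22]) &&
      cs.all fun c => c.2.check ((dodecicN u t).take 12) c.1) = true)
    (hl : l = cs.map fun c => (c.1, c.2.fixed.length)) : ModularRoots u t n l := by
  simp only [Bool.and_eq_true, beq_iff_eq, List.all_eq_true] at h
  obtain ⟨⟨⟨h1, h2⟩, h3⟩, h4⟩ := h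
  generalize (dodecicN u t).take 12 = P at *
  have hP : P.length = 12 := by
    rw [coprimeDerivN, Bool.and_eq_true, beq_iff_eq] at h2
    exact h2.1
  intro κ _ _ M hM hprod
  have hprod' : evalN (X : κ[X]) (P ++ [1]) = (M.map fun y => X - C y).prod := by
    rw [← hprod, ← evalN_X_dodecicN, ← h1]
  have hnd := nodup_of_coprimeDerivN h2 hprod'
  have hroot : ∀ y ∈ M, evalN y (P ++ [1]) = 0 := fun y hy => by
    rw [← eval_evalN, hprod', eval_multiset_prod, Multiset.map_map]
    exact Multiset.prod_eq_zero (Multiset.mem_map.2 ⟨y, hy, by simp⟩)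
  refine ⟨hnd, fun y hy => pow_eq_self_of_frobN hP (hroot y hy) h3, ?_⟩
  intro c hc _
  rw [hl, List.mem_map] at hc
  obtain ⟨c, hc, rfl⟩ := hc
  exact FixCertificate.card_eq hP (by rw [Multiset.toFinset_card_of_nodup hnd, hM])
    (fun y hy => hroot y (Multiset.mem_toFinset.1 hy)) (h4 c hc)

theorem modularRoots_two_nine : ModularRoots 9 2 11 [(1, 1)] :=
  modularRoots_of_check (b := [2, 4, 18, 2, 15, 22, 0, 20, 4, 2, 22, 7]) (cs := [(1, ⟨[7], [17, 20, 9, 14,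
    15, 6, 13, 16, 2, 22, 4], [20, 22, 13, 16, 4, 9, 22, 2, 20, 7, 12], [0, 17, 14, 4, 8, 2, 16, 14, 19, 0,
    21], [12, 19, 2, 6, 4, 17, 14, 15, 6, 1, 4]⟩)])
    (by decide +kernel) (by decide)

theorem modularRoots_two_fourteen : ModularRoots 14 2 11 [(1, 1)] :=
  modularRoots_of_check (b := [5, 10, 5, 3, 6, 2, 10, 10, 7, 6, 22, 7]) (cs := [(1, ⟨[19], [17, 15, 3, 2,
    22, 21, 15, 18, 10, 9, 15], [11, 20, 11, 18, 13, 4, 2, 15, 19, 12, 5], [8, 2, 13, 8, 0, 16, 4, 8, 16, 2,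
    1], [13, 15, 7, 9, 18, 7, 19, 11, 22, 11, 9]⟩)])
    (by decide +kernel) (by decide)

theorem modularRoots_eight_nine : ModularRoots 9 8 10 [(1, 0), (2, 2)] :=
  modularRoots_of_check (b := [17, 10, 22, 5, 3, 9, 0, 4, 10, 5, 9, 6]) (cs := [(1, ⟨[], [4, 17, 14, 15, 4,
    11, 5, 10, 7, 18, 4, 11], [17, 1, 8, 11, 19, 9, 3, 1, 15, 18, 18, 14], [13, 7, 15, 16, 5, 5, 22, 10, 0,
    20, 22], [20, 18, 17, 16, 13, 21, 6, 5, 20, 10, 11, 5]⟩), (2, ⟨[12, 4], [8, 16, 22, 6, 8, 15, 12, 9, 10,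
    7], [14, 17, 5, 11, 20, 20, 13, 4, 9, 3], [14, 15, 4, 1, 21, 10, 2, 4, 20, 4, 19], [17, 16, 13, 4, 9, 3,
    6, 1, 14, 9]⟩)])
    (by decide +kernel) (by decide)

theorem modularRoots_eight_fourteen : ModularRoots 14 8 10 [(1, 0), (2, 2)] :=
  modularRoots_of_check (b := [13, 2, 1, 19, 15, 5, 2, 2, 6, 15, 9, 6]) (cs := [(1, ⟨[], [1, 1, 3, 18, 6, 7,
    7, 12, 1, 20, 18, 11], [0, 17, 3, 2, 5, 20, 3, 15, 13, 22, 1, 7], [1, 8, 10, 9, 11, 18, 7, 17, 5, 1,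
    17], [13, 10, 8, 17, 4, 4, 14, 6, 4, 8, 4, 14]⟩), (2, ⟨[4, 7], [6, 7, 10, 14, 9, 17, 10, 10, 9, 4], [4,
    16, 3, 15, 16, 3, 10, 9, 22, 8], [13, 22, 11, 8, 15, 1, 12, 5, 16, 20, 7], [11, 22, 8, 9, 17, 10, 4, 19,
    9, 2]⟩)])
    (by decide +kernel) (by decide)

theorem modularRoots_three_nine : ModularRoots 9 3 8 [(1, 2), (2, 4), (4, 4)] :=
  modularRoots_of_check (b := [4, 9, 6, 16, 5, 15, 0, 22, 9, 16, 15, 10]) (cs := [(1, ⟨[9, 13], [3, 2, 6, 3,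
    21, 14, 1, 16, 21, 21], [12, 2, 0, 9, 14, 9, 4, 20, 22, 20], [20, 10, 6, 21, 13, 13, 12, 21, 8, 12, 21],
    [15, 5, 18, 10, 15, 15, 6, 11, 4, 7]⟩), (2, ⟨[13, 0, 12, 20], [18, 15, 11, 18, 17, 21, 11, 14], [0, 1,
    5, 0, 8, 14, 4, 3], [9, 7, 21, 3, 17, 4, 18, 7, 7, 11, 9], [10, 22, 18, 11, 0, 10, 3, 20]⟩), (4, ⟨[13,
    0, 12, 20], [18, 15, 11, 18, 17, 21, 11, 14], [2, 8, 19, 20, 11, 5, 12, 13], [0, 20, 10, 1, 1, 6, 14,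
    21, 6, 13, 21], [8, 9, 9, 5, 1, 12, 11, 9]⟩)])
    (by decide +kernel) (by decide)

theorem modularRoots_four_nine : ModularRoots 9 4 6 [(1, 1), (2, 3), (3, 4)] :=
  modularRoots_of_check (b := [19, 16, 3, 8, 14, 19, 0, 11, 16, 8, 19, 5]) (cs := [(1, ⟨[21], [21, 9, 9, 20,
    8, 10, 14, 2, 9, 7, 13], [8, 14, 14, 21, 8, 7, 10, 12, 6, 0, 5], [13, 3, 5, 7, 0, 21, 12, 12, 11, 6, 9],
    [17, 13, 6, 0, 13, 14, 15, 4, 0, 4, 12]⟩), (2, ⟨[15, 9, 7], [11, 12, 7, 15, 1, 8, 14, 13, 4], [16, 19,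
    8, 12, 11, 22, 16, 21, 12], [2, 11, 2, 15, 9, 18, 6, 8, 6, 6, 8], [14, 22, 7, 0, 16, 5, 1, 18, 7]⟩), (3,
    ⟨[8, 15, 10, 17], [12, 21, 2, 1, 19, 18, 4, 17], [1, 11, 9, 9, 0, 6, 17], [0, 3, 17, 8, 19, 12, 8, 0, 5,
    17], [3, 0, 12, 5, 3, 2, 19, 22]⟩)])
    (by decide +kernel) (by decide)

end ModularRoots

section FrobeniusSubring

/-- The embedding of `ℤ[X]` in `ℚ(X)`. -/
noncomputable def intPolyToRatFunc : ℤ[X] →+* RatFunc ℚ :=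
  (algebraMap ℚ[X] (RatFunc ℚ)).comp (mapRingHom (algebraMap ℤ ℚ))

theorem intPolyToRatFunc_injective : Function.Injective intPolyToRatFunc :=
  (RatFunc.algebraMap_injective ℚ).comp (map_injective _ (algebraMap ℤ ℚ).injective_int)

theorem exists_intPolyToRatFunc_eq {x : RatFunc ℚ} (hx : intPolyToRatFunc.IsIntegralElem x) :
    ∃ p, intPolyToRatFunc p = x := by
  let : Algebra ℤ[X] ℚ[X] := Polynomial.algebra ..
  obtain ⟨q, hq, hqx⟩ := hx
  have h1 : IsIntegral ℚ[X] x := ⟨q.map (mapRingHom (algebraMap ℤ ℚ)), hq.map _, by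
    rw [eval₂_map]; exact hqx⟩
  obtain ⟨y, rfl⟩ := IsIntegrallyClosed.algebraMap_eq_of_integral h1
  have h2 : IsIntegral ℤ[X] y := ⟨q, hq, by
    apply RatFunc.algebraMap_injective ℚ
    rw [hom_eval₂, map_zero]
    exact hqx⟩
  rw [Polynomial.isIntegral_iff_isIntegral_coeff] at h2
  obtain ⟨p, hp⟩ := (mem_lifts y).1 ((lifts_iff_coeff_lifts y).2 fun n =>
    IsIntegrallyClosed.algebraMap_eq_of_integral (h2 n))
  exact ⟨p, congrArg (algebraMap ℚ[X] (RatFunc ℚ)) hp⟩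

theorem exists_frobenius_subring {Ω : Type} [Field Ω] [Algebra (RatFunc ℚ) Ω] [IsGalois (RatFunc ℚ) Ω]
    {u : Ω} (hu : u ^ 2 = -11) {γ₀ : Ω ≃ₐ[RatFunc ℚ] Ω} (hγ₀ : γ₀ u = -u) (t₀ : ℕ) :
    ∃ (A : Subring Ω) (κ : Type) (_ : Field κ) (_ : CharP κ 23) (φ : A →+* κ)
      (γ : Ω ≃ₐ[RatFunc ℚ] Ω) (u' t' : A), (u' : Ω) = u ∧
      (t' : Ω) = algebraMap (RatFunc ℚ) Ω RatFunc.X ∧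
      (∀ (p : Polynomial A) (x : Ω), p.Monic → p.eval₂ A.subtype x = 0 → x ∈ A) ∧
      φ t' = t₀ ∧ φ u' = 9 ∧ γ u = u ∧ ∀ x y : A, γ x = y → φ y = φ x ^ 23 := by
  have : Fact (Nat.Prime 23) := ⟨by norm_num⟩
  let : Algebra ℤ[X] (RatFunc ℚ) := intPolyToRatFunc.toAlgebra
  let : Algebra ℤ[X] Ω := ((algebraMap (RatFunc ℚ) Ω).comp intPolyToRatFunc).toAlgebra
  have : IsScalarTower ℤ[X] (RatFunc ℚ) Ω := .of_algebraMap_eq fun _ => rfl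
  have : IsIntegrallyClosedIn ℤ[X] (RatFunc ℚ) := isIntegrallyClosedIn_iff.2
    ⟨intPolyToRatFunc_injective, fun hx => exists_intPolyToRatFunc_eq hx⟩
  obtain ⟨κ, hκ, hc, φ, γ, h1, h2⟩ := exists_frobenius_element (Ω := Ω) (k := RatFunc ℚ) 23
    (eval₂RingHom (Int.castRingHom (ZMod 23)) (t₀ : ZMod 23)) intPolyToRatFunc_injective
  have hκ2 : (2 : κ) ≠ 0 := by
    have := CharP.cast_eq_zero_iff κ 23 2
    intro h
    exact absurd (this.1 (by exact_mod_cast h)) (by norm_num)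
  have hκ23 : (23 : κ) = 0 := by simpa using CharP.cast_eq_zero κ 23
  have hintegral : ∀ {x : Ω}, IsIntegral ℤ[X] x → ∀ γ : Ω ≃ₐ[RatFunc ℚ] Ω, IsIntegral ℤ[X] (γ x) :=
    fun h γ => h.map (γ.restrictScalars ℤ[X])
  have hu_int : IsIntegral ℤ[X] u := ⟨X ^ 2 + C 11, monic_X_pow_add_C _ two_ne_zero, by
    simp only [eval₂_add, eval₂_pow, eval₂_X, eval₂_C, hu]
    rw [map_ofNat]; ring⟩
  have ht_int : IsIntegral ℤ[X] (algebraMap (RatFunc ℚ) Ω RatFunc.X) := by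
    have : algebraMap (RatFunc ℚ) Ω RatFunc.X = algebraMap ℤ[X] Ω X := by
      rw [IsScalarTower.algebraMap_apply ℤ[X] (RatFunc ℚ) Ω]
      congr 1
      change _ = intPolyToRatFunc X
      simp [intPolyToRatFunc]
    rw [this]
    exact isIntegral_algebraMap
  have hφt : φ ⟨_, ht_int⟩ = t₀ := by
    have h := h1 X t₀ (by simp)
    rw [Int.cast_natCast] at h
    rw [← h]
    congr 1
    apply Subtype.ext
    change _ = algebraMap (RatFunc ℚ) Ω (intPolyToRatFunc X)
    simp [intPolyToRatFunc]
  have hu' : (⟨u, hu_int⟩ : integralClosure ℤ[X] Ω) ^ 2 = -11 := 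
    Subtype.ext (hu.trans rfl)
  have hφu : φ ⟨u, hu_int⟩ = 9 ∨ φ ⟨u, hu_int⟩ = -9 := by
    have h := congrArg φ hu'
    rw [map_pow, map_neg, map_ofNat] at h
    refine sq_eq_sq_iff_eq_or_eq_neg.1 ?_
    rw [h]
    linear_combination -4 * hκ23
  have hpow : φ ⟨u, hu_int⟩ ^ 23 = φ ⟨u, hu_int⟩ := by
    have h := congrArg φ hu'
    rw [map_pow, map_neg, map_ofNat] at h
    rw [show φ ⟨u, hu_int⟩ ^ 23 = (φ ⟨u, hu_int⟩ ^ 2) ^ 11 * φ ⟨u, hu_int⟩ by ring, h]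
    rw [show (-11 : κ) ^ 11 = 1 by linear_combination -12404855244 * hκ23, one_mul]
  have hne : φ ⟨u, hu_int⟩ ≠ 0 := by
    have h9 : (9 : κ) ≠ 0 := by
      intro h
      exact absurd ((CharP.cast_eq_zero_iff κ 23 9).1 (by exact_mod_cast h)) (by norm_num)
    rcases hφu with h | h <;> rw [h]
    · exact h9
    · exact neg_ne_zero.2 h9
  have hγu : γ u = u := by
    have h : (γ u - u) * (γ u + u) = 0 := by
      have : γ u ^ 2 = -11 := by rw [← map_pow, hu, map_neg, map_ofNat]
      linear_combination this - hu
    rcases mul_eq_zero.1 h with h | h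
    · exact sub_eq_zero.1 h
    · exfalso
      have h3 := h2 ⟨u, hu_int⟩ (-⟨u, hu_int⟩) (eq_neg_of_add_eq_zero_left h)
      rw [hpow, map_neg] at h3
      have : 2 * φ ⟨u, hu_int⟩ = 0 := by linear_combination -h3
      exact (mul_ne_zero hκ2 hne) this
  have hclosed : ∀ (p : Polynomial (integralClosure ℤ[X] Ω).toSubring) (x : Ω), p.Monic →
      p.eval₂ (integralClosure ℤ[X] Ω).toSubring.subtype x = 0 →
      x ∈ (integralClosure ℤ[X] Ω).toSubring := fun p x hp hx =>
    isIntegral_trans (R := ℤ[X]) (A := integralClosure ℤ[X] Ω) x ⟨p, hp, hx⟩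
  rcases hφu with hφu | hφu
  · exact ⟨(integralClosure ℤ[X] Ω).toSubring, κ, hκ, hc, φ, γ, ⟨u, hu_int⟩, ⟨_, ht_int⟩, rfl, rfl, hclosed,
      hφt, hφu, hγu, h2⟩
  · let τ : integralClosure ℤ[X] Ω →+* integralClosure ℤ[X] Ω :=
      ((γ₀ : Ω →+* Ω).comp (integralClosure ℤ[X] Ω).val.toRingHom).codRestrict
        (integralClosure ℤ[X] Ω).toSubring fun x => hintegral x.2 γ₀
    refine ⟨(integralClosure ℤ[X] Ω).toSubring, κ, hκ, hc, φ.comp τ, γ₀⁻¹ * γ * γ₀, ⟨u, hu_int⟩, ⟨_, ht_int⟩,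
      rfl, rfl, hclosed, ?_, ?_, ?_, fun x y hxy => ?_⟩
    · rw [← hφt]
      exact congrArg φ (Subtype.ext (γ₀.commutes _))
    · have : τ ⟨u, hu_int⟩ = -⟨u, hu_int⟩ := Subtype.ext hγ₀
      rw [RingHom.comp_apply]
      erw [this]
      rw [map_neg, hφu, neg_neg]
    · rw [AlgEquiv.mul_apply, AlgEquiv.mul_apply, hγ₀, map_neg, hγu, ← hγ₀]
      exact γ₀.symm_apply_apply u
    · refine h2 (τ x) (τ y) ?_
      change γ (γ₀ x) = γ₀ y
      rw [← hxy, AlgEquiv.mul_apply, AlgEquiv.mul_apply]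
      exact (γ₀.apply_symm_apply _).symm

end FrobeniusSubring

section RootTransfer

theorem map_dodecicPoly {R S : Type*} [CommRing R] [CommRing S] (f : R →+* S) (u t : R) :
    (dodecicPoly u t).map f = dodecicPoly (f u) (f t) := by
  simp only [dodecicPoly, Polynomial.map_add, Polynomial.map_sub, Polynomial.map_mul, Polynomial.map_pow,
    Polynomial.map_ofNat, map_C, map_X, map_add, map_sub, map_mul, map_pow, map_ofNat]

theorem dodecicPoly_monic_natDegree {R : Type*} [CommRing R] [Nontrivial R] (u t : R) :
    (dodecicPoly u t).Monic ∧ (dodecicPoly u t).natDegree = 12 := by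
  have cubic : ∀ a b c : R, (X ^ 3 + C a * X ^ 2 + C b * X + C c).Monic ∧
      (X ^ 3 + C a * X ^ 2 + C b * X + C c).natDegree = 3 := fun a b c => by
    constructor
    · monicity!
    · compute_degree!
  obtain ⟨m1, d1⟩ := cubic 54 (642 - 42 * u) (332 - 52 * u)
  obtain ⟨m2, d2⟩ := cubic 102 (3426 - 138 * u) (40172 - 6292 * u)
  have m : ((X ^ 3 + C 54 * X ^ 2 + C (642 - 42 * u) * X + C (332 - 52 * u)) ^ 3 *
      (X ^ 3 + C 102 * X ^ 2 + C (3426 - 138 * u) * X + C (40172 - 6292 * u))).Monic := (m1.pow 3).mul m2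
  have d : ((X ^ 3 + C 54 * X ^ 2 + C (642 - 42 * u) * X + C (332 - 52 * u)) ^ 3 *
      (X ^ 3 + C 102 * X ^ 2 + C (3426 - 138 * u) * X + C (40172 - 6292 * u))).natDegree = 12 := by
    rw [(m1.pow 3).natDegree_mul m2, m1.natDegree_pow, d1, d2]
  have h : dodecicPoly u t = (X ^ 3 + C 54 * X ^ 2 + C (642 - 42 * u) * X + C (332 - 52 * u)) ^ 3 *
      (X ^ 3 + C 102 * X ^ 2 + C (3426 - 138 * u) * X + C (40172 - 6292 * u)) +
      C (2 ^ 16 * 3 ^ 12 * (67 + 253 * u) * t) * X := by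
    simp only [dodecicPoly, map_sub, map_add, map_mul, map_pow, map_ofNat]
  have hlt : (C (2 ^ 16 * 3 ^ 12 * (67 + 253 * u) * t) * X).natDegree < 12 :=
    by
    refine (natDegree_C_mul_le _ _).trans_lt ?_
    rw [natDegree_X]
    norm_num
  rw [h]
  refine ⟨m.add_of_left (degree_lt_degree (d ▸ hlt)), ?_⟩
  rw [natDegree_add_eq_left_of_natDegree_lt (d ▸ hlt), d]

theorem ModularRoots.roots_dodecicPoly {k Ω : Type} [Field k] [Field Ω] [Algebra k Ω] [IsAlgClosed Ω]
    {A : Subring Ω} {κ : Type} [Field κ] [CharP κ 23] {φ : A →+* κ} {γ : Ω ≃ₐ[k] Ω} {u t : A}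
    (hA : ∀ (p : Polynomial A) (x : Ω), p.Monic → p.eval₂ A.subtype x = 0 → x ∈ A)
    (hu : γ u = u) (ht : γ t = t) (hγ : ∀ x y : A, γ x = y → φ y = φ x ^ 23)
    {u₀ t₀ n : ℕ} {l : List (ℕ × ℕ)} (hl : ModularRoots u₀ t₀ n l) (hu₀ : φ u = u₀) (ht₀ : φ t = t₀)
    [DecidableEq Ω] :
    (dodecicPoly (u : Ω) t).roots.toFinset.card = 12 ∧
    (∀ x ∈ (dodecicPoly (u : Ω) t).roots, (γ ^ n) x = x) ∧
    ∀ c ∈ l, ((dodecicPoly (u : Ω) t).roots.toFinset.filter fun x => (γ ^ c.1) x = x).card = c.2 := by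
  classical
  obtain ⟨hm, hd⟩ := dodecicPoly_monic_natDegree u t
  obtain ⟨hm', hd'⟩ := dodecicPoly_monic_natDegree (u : Ω) (t : Ω)
  have hmap : (dodecicPoly u t).map A.subtype = dodecicPoly (u : Ω) t := map_dodecicPoly _ _ _
  have hmem : ∀ x, x ∈ (dodecicPoly (u : Ω) t).roots ↔ (dodecicPoly (u : Ω) t).eval x = 0 := fun x =>
    mem_roots hm'.ne_zero
  have hsp := IsAlgClosed.splits (dodecicPoly (u : Ω) t)
  have hM : ∃ M : Multiset A, M.map A.subtype = (dodecicPoly (u : Ω) t).roots := by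
    refine ⟨(dodecicPoly (u : Ω) t).roots.pmap Subtype.mk fun x hx => hA _ x hm ?_, ?_⟩
    · rw [← eval_map, hmap, ← hmem]
      exact hx
    · rw [Multiset.map_pmap]
      exact (Multiset.pmap_eq_map _ _ _ _).trans (Multiset.map_id _)
  obtain ⟨M, hM⟩ := hM
  have hcard : M.card = 12 := by
    rw [← Multiset.card_map A.subtype, hM, ← hsp.natDegree_eq_card_roots, hd']
  have hprod : dodecicPoly u t = (M.map fun a => X - C a).prod := by
    apply map_injective A.subtype Subtype.val_injective
    rw [hmap, hsp.eq_prod_roots_of_monic hm', ← hM, Polynomial.map_multiset_prod, Multiset.map_map,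
      Multiset.map_map]
    simp
  have hprod' : dodecicPoly (u₀ : κ) (t₀ : κ) = ((M.map φ).map fun y => X - C y).prod := by
    rw [← hu₀, ← ht₀, ← map_dodecicPoly, hprod, Polynomial.map_multiset_prod, Multiset.map_map,
      Multiset.map_map]
    simp
  obtain ⟨h1, h2, h3⟩ := hl κ (M.map φ) (by rw [Multiset.card_map, hcard]) hprod'
  have hval : Function.Injective A.subtype := Subtype.val_injective
  have hnd : M.Nodup := Multiset.Nodup.of_map _ h1
  have hinj : ∀ a ∈ M, ∀ b ∈ M, φ a = φ b → a = b := Multiset.inj_on_of_nodup_map h1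
  have hroot : ∀ x : Ω, x ∈ (dodecicPoly (u : Ω) t).roots ↔ ∃ a ∈ M, (a : Ω) = x := fun x => by
    rw [← hM, Multiset.mem_map]; rfl
  have hγroot : ∀ x ∈ (dodecicPoly (u : Ω) t).roots, γ x ∈ (dodecicPoly (u : Ω) t).roots := fun x hx => by
    rw [hmem] at hx ⊢
    have := congrArg γ hx
    rw [map_zero, eval_dodecicPoly] at this
    simp only [map_add, map_sub, map_mul, map_pow, map_ofNat, hu, ht] at this
    rw [eval_dodecicPoly, this]
  have hpow : ∀ (j : ℕ), ∀ a ∈ M, ∃ b ∈ M, (γ ^ j) (a : Ω) = b ∧ φ b = φ a ^ 23 ^ j := fun j => by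
    induction j with
    | zero => exact fun a ha => ⟨a, ha, rfl, by simp⟩
    | succ j ih =>
      intro a ha
      obtain ⟨b, hb, e1, e2⟩ := ih a ha
      obtain ⟨c, hc, e3⟩ := (hroot _).1 (hγroot b ((hroot _).2 ⟨b, hb, rfl⟩))
      exact ⟨c, hc, by rw [pow_succ', AlgEquiv.mul_apply, e1, e3],
        by rw [hγ b c e3.symm, e2, ← pow_mul, ← pow_succ]⟩
  have hfix : ∀ (j : ℕ), ∀ a ∈ M, ((γ ^ j) (a : Ω) = a ↔ φ a ^ 23 ^ j = φ a) := fun j a ha => by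
    obtain ⟨b, hb, e1, e2⟩ := hpow j a ha
    rw [e1, ← e2]
    exact ⟨fun h => congrArg φ (Subtype.ext h), fun h => congrArg Subtype.val (hinj b hb a ha h)⟩
  have himage : (dodecicPoly (u : Ω) t).roots.toFinset = M.toFinset.image A.subtype := by
    rw [← hM, Multiset.toFinset_map]
  refine ⟨?_, fun x hx => ?_, fun c hc => ?_⟩
  · rw [himage, Finset.card_image_of_injective _ hval,
      Multiset.toFinset_card_of_nodup hnd, hcard]
  · obtain ⟨a, ha, rfl⟩ := (hroot x).1 hx
    exact (hfix n a ha).2 (h2 _ (Multiset.mem_map_of_mem φ ha))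
  · rw [← h3 c hc, himage, Multiset.toFinset_map, Finset.filter_image, Finset.filter_image,
      Finset.card_image_of_injective _ hval, Finset.card_image_of_injOn]
    · congr 1
      refine Finset.filter_congr fun a ha => hfix c.1 a (Multiset.mem_toFinset.1 ha)
    · intro a ha b hb hab
      rw [Finset.mem_coe, Finset.mem_filter, Multiset.mem_toFinset] at ha hb
      exact hinj a ha.1 b hb.1 hab

end RootTransfer

section CurveGeometry

theorem exists_transcendental_root_resolventPoly {Ω : Type*} [Field Ω] [CharZero Ω] [IsAlgClosed Ω]
    {u t : Ω} (hu : u ^ 2 = -11) (ht : Transcendental ℚ t) :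
    ∃ s, Transcendental ℤ s ∧ (resolventPoly u t).eval s = 0 := by
  by_contra! hcon
  have h0 : resolventPoly u t ≠ 0 := fun h => by simpa [h] using (resolventPoly_spec u t).1
  have hE : ∀ s, (resolventPoly u t).eval s = 0 → s ∈ algebraicClosure ℚ Ω := fun s hs => by
    rw [mem_algebraicClosure_iff, ← IsFractionRing.isAlgebraic_iff ℤ ℚ Ω]
    by_contra h
    exact hcon s h hs
  have huE : u ∈ algebraicClosure ℚ Ω := by
    rw [mem_algebraicClosure_iff]
    refine IsAlgebraic.of_pow two_pos ?_
    rw [hu, ← map_ofNat (algebraMap ℚ Ω) 11, ← map_neg]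
    exact isAlgebraic_algebraMap _
  have hval : (resolventPoly u t).eval 0 ∈ algebraicClosure ℚ Ω := by
    rw [(IsAlgClosed.splits (resolventPoly u t)).eq_prod_roots, eval_mul, eval_C, (resolventPoly_spec u t).2,
      eval_multiset_prod, Multiset.map_map]
    refine mul_mem (neg_mem (ofNat_mem _ 2)) (multiset_prod_mem _ fun a ha => ?_)
    obtain ⟨s, hs, rfl⟩ := Multiset.mem_map.1 ha
    simpa using hE s ((mem_roots h0).1 hs)
  have hlist : ∀ L : List (ℤ × ℤ), (listPoly u L).eval 0 ∈ algebraicClosure ℚ Ω := fun L => by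
    rw [← coeff_zero_eq_eval_zero, coeff_listPoly]
    exact add_mem (intCast_mem _ _) (mul_mem (intCast_mem _ _) huE)
  have hD : (listPoly u CurveData.denominator).eval 0 ≠ 0 := by
    rw [← coeff_zero_eq_eval_zero, coeff_listPoly,
      show CurveData.denominator.getD 0 0 = (-37288, 12130) by decide]
    intro h
    have h1 : ((37288 ^ 2 + 11 * 12130 ^ 2 : ℕ) : Ω) = 0 := by
      push_cast at h ⊢
      linear_combination (-37288 - 12130 * u) * h + 12130 ^ 2 * hu
    exact absurd (Nat.cast_eq_zero.1 h1) (by norm_num)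
  rw [eval_resolventPoly] at hval
  have hN := hlist CurveData.parameterEven
  have hR := hlist CurveData.resolvent
  have hD' := hlist CurveData.denominator
  generalize (listPoly u CurveData.denominator).eval 0 = D at *
  generalize (listPoly u CurveData.parameterEven).eval 0 = N at *
  generalize (listPoly u CurveData.resolvent).eval 0 = R at *
  have h1 : (2 * 3 ^ 12 * D ^ 11 * t - 8 * N) ^ 2 ∈ algebraicClosure ℚ Ω := by
    have : (2 * 3 ^ 12 * D ^ 11 * t - 8 * N) ^ 2 = D ^ 11 * (4 * 3 ^ 24 * t ^ 2 * D ^ 11 -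
        32 * 3 ^ 12 * t * N + R) + 64 * N ^ 2 - D ^ 11 * R := by ring
    rw [this]
    exact sub_mem (add_mem (mul_mem (pow_mem hD' _) hval) (mul_mem (ofNat_mem _ _) (pow_mem hN _)))
      (mul_mem (pow_mem hD' _) hR)
  have h2 : 2 * 3 ^ 12 * D ^ 11 * t - 8 * N ∈ algebraicClosure ℚ Ω := by
    rw [mem_algebraicClosure_iff] at h1 ⊢
    exact h1.of_pow two_pos
  refine ht ((mem_algebraicClosure_iff (F := ℚ)).1 ?_)
  have h3 : t = (2 * 3 ^ 12 * D ^ 11)⁻¹ * ((2 * 3 ^ 12 * D ^ 11 * t - 8 * N) + 8 * N) := by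
    field_simp
    ring
  rw [h3]
  refine mul_mem (inv_mem (mul_mem (mul_mem (ofNat_mem _ _) (pow_mem (ofNat_mem _ _) _)) (pow_mem hD' _)))
    (add_mem h2 (mul_mem (ofNat_mem _ _) hN))

end CurveGeometry

section CurvePointRoots

namespace CurveExpr

theorem toPoly_append {Ω : Type*} [Field Ω] {s u v : Ω} (l m : List CurveExpr) :
    toPoly s u v (l ++ m) = toPoly s u v l + X ^ l.length * toPoly s u v m := by
  induction l with
  | nil => simp [toPoly]
  | cons x l ih =>
    simp only [List.cons_append, toPoly, ih, List.length_cons]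
    ring

end CurveExpr

namespace CurvePoint

open CurveExpr CurveData

variable {Ω : Type*} [Field Ω] [CharZero Ω] [DecidableEq Ω] {u t s v : Ω} (h : CurvePoint u t s v)

include h

omit [CharZero Ω] in
theorem card_filter_sextic_le {δ : Ω} (hδ : δ ^ 2 = disc.value s u v) (R : Finset Ω)
    (hR : ∀ x ∈ R, δ * evalList s u v (den.value s u v * x) sextic =
      evalList s u v (den.value s u v * x) quintic) : R.card ≤ 6 := by
  have hδ0 : δ ≠ 0 := fun h0 => h.disc_ne_zero (by rw [← hδ, h0, zero_pow two_ne_zero])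
  have hq : (C δ * toPoly s u v sextic - toPoly s u v quintic).coeff 6 = δ := by
    have h1 : (toPoly s u v quintic).coeff 6 = 0 :=
      coeff_eq_zero_of_degree_lt ((degree_toPoly_lt quintic).trans_le (by simp [quintic]))
    have h2 : (toPoly s u v sextic.dropLast).coeff 6 = 0 :=
      coeff_eq_zero_of_degree_lt ((degree_toPoly_lt sextic.dropLast).trans_le (by simp [sextic]))
    have h3 : toPoly s u v sextic = toPoly s u v sextic.dropLast + X ^ 6 * 1 := by
      rw [show sextic = sextic.dropLast ++ [1] from rfl, toPoly_append]
      simp [toPoly, sextic, value_one]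
    rw [coeff_sub, coeff_C_mul, h1, h3, coeff_add, h2]
    simp
  have hd : (C δ * toPoly s u v sextic - toPoly s u v quintic).natDegree ≤ 6 := by
    refine natDegree_le_iff_degree_le.2 ((degree_sub_le _ _).trans (max_le ?_ ?_))
    · refine (degree_C_mul hδ0).trans_le (Order.le_of_lt_succ ?_)
      exact (degree_toPoly_lt sextic).trans_le le_rfl
    · exact ((degree_toPoly_lt quintic).trans_le (by simp [quintic])).le
  have hne : C δ * toPoly s u v sextic - toPoly s u v quintic ≠ 0 := fun h0 => by
    rw [h0, coeff_zero] at hq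
    exact hδ0 hq.symm
  have hinj : Function.Injective fun x : Ω => den.value s u v * x := mul_right_injective₀ h.den_ne_zero
  rw [← Finset.card_image_of_injective R hinj]
  refine le_trans ?_ ((card_roots' _).trans hd)
  refine (Multiset.card_le_card ((Multiset.le_iff_subset (Finset.nodup _)).2 fun y hy => ?_) :
    (R.image fun x : Ω => den.value s u v * x).val.card ≤ _)
  obtain ⟨x, hx, rfl⟩ := Finset.mem_image.1 hy
  rw [mem_roots hne, IsRoot, eval_sub, eval_mul, eval_C, eval_toPoly, eval_toPoly, hR x hx, sub_self]

omit [CharZero Ω] [DecidableEq Ω] in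
theorem sextic_or {δ : Ω} (hδ : δ ^ 2 = disc.value s u v) {x : Ω} (hx : (dodecicPoly u t).eval x = 0) :
    δ * evalList s u v (den.value s u v * x) sextic = evalList s u v (den.value s u v * x) quintic ∨
    -δ * evalList s u v (den.value s u v * x) sextic = evalList s u v (den.value s u v * x) quintic := by
  have h1 := h.disc_mul_sextic_sq hx
  rw [← hδ, ← mul_pow, sq_eq_sq_iff_eq_or_eq_neg] at h1
  exact h1.imp_right fun h2 => by rw [neg_mul, h2, neg_neg]

omit [CharZero Ω] in
/-- A quadratic over the function field splits the roots of `dodecicPoly` into two halves. -/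
theorem halves {δ : Ω} (hδ : δ ^ 2 = disc.value s u v)
    (hcard : (dodecicPoly u t).roots.toFinset.card = 12) :
    ((dodecicPoly u t).roots.toFinset.filter fun x => δ * evalList s u v (den.value s u v * x) sextic =
      evalList s u v (den.value s u v * x) quintic).card = 6 ∧
    ∀ x ∈ (dodecicPoly u t).roots.toFinset, (-δ * evalList s u v (den.value s u v * x) sextic =
      evalList s u v (den.value s u v * x) quintic ↔
      ¬ δ * evalList s u v (den.value s u v * x) sextic = evalList s u v (den.value s u v * x) quintic) := by
  have hroot : ∀ x ∈ (dodecicPoly u t).roots.toFinset, (dodecicPoly u t).eval x = 0 := fun x hx =>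
    (mem_roots (dodecicPoly_monic_natDegree u t).1.ne_zero).1 (Multiset.mem_toFinset.1 hx)
  generalize (dodecicPoly u t).roots.toFinset = R at hcard hroot
  have h1 := h.card_filter_sextic_le hδ (R.filter fun x =>
    δ * evalList s u v (den.value s u v * x) sextic = evalList s u v (den.value s u v * x) quintic)
    fun x hx => (Finset.mem_filter.1 hx).2
  have h2 := h.card_filter_sextic_le (δ := -δ) (by rw [neg_sq, hδ]) (R.filter fun x =>
    -δ * evalList s u v (den.value s u v * x) sextic = evalList s u v (den.value s u v * x) quintic)
    fun x hx => (Finset.mem_filter.1 hx).2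
  have h3 := Finset.card_filter_add_card_filter_not (s := R) fun x =>
    δ * evalList s u v (den.value s u v * x) sextic = evalList s u v (den.value s u v * x) quintic
  have h4 : (R.filter fun x => ¬δ * evalList s u v (den.value s u v * x) sextic =
      evalList s u v (den.value s u v * x) quintic) ⊆ R.filter fun x =>
      -δ * evalList s u v (den.value s u v * x) sextic = evalList s u v (den.value s u v * x) quintic :=
    fun x hx => by
      rw [Finset.mem_filter] at hx ⊢
      exact ⟨hx.1, (h.sextic_or hδ (hroot x hx.1)).resolve_left hx.2⟩
  have h5 := Finset.card_le_card h4
  refine ⟨by omega, fun x hx => ?_⟩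
  have h6 := Finset.ext_iff.1 (Finset.eq_of_subset_of_card_le h4 (by omega)) x
  simp only [Finset.mem_filter, hx, true_and] at h6
  exact h6.symm

omit [DecidableEq Ω] in
theorem quadratic_iff {r : Ω} (hr : r * r = traceExpr.value s u v ^ 2 - 4 * normExpr.value s u v) (y : Ω) :
    (2 * den.value s u v * y) ^ 2 = traceExpr.value s u v * (2 * den.value s u v * y) - normExpr.value s u v ↔
      y = (traceExpr.value s u v + r) / (4 * den.value s u v) ∨
      y = (traceExpr.value s u v - r) / (4 * den.value s u v) := by
  have hD := h.den_ne_zero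
  rw [eq_div_iff (by simpa using hD), eq_div_iff (by simpa using hD)]
  constructor
  · intro h1
    have h2 : (y * (4 * den.value s u v) - traceExpr.value s u v - r) *
        (y * (4 * den.value s u v) - traceExpr.value s u v + r) = 0 := by linear_combination 4 * h1 - hr
    rcases mul_eq_zero.1 h2 with h3 | h3
    · left; linear_combination h3
    · right; linear_combination h3
  · rintro (h1 | h1)
    · have h2 : (y * (4 * den.value s u v) - traceExpr.value s u v) ^ 2 = r * r := by rw [h1]; ring
      linear_combination (h2 + hr) / 4
    · have h2 : (y * (4 * den.value s u v) - traceExpr.value s u v) ^ 2 = r * r := by rw [h1]; ring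
      linear_combination (h2 + hr) / 4

theorem card_filter_quadratic [IsAlgClosed Ω] :
    ((dodecicPoly (-u) t).roots.toFinset.filter fun y => (2 * den.value s u v * y) ^ 2 =
      traceExpr.value s u v * (2 * den.value s u v * y) - normExpr.value s u v).card = 2 := by
  obtain ⟨r, hr⟩ := IsAlgClosed.exists_eq_mul_self (traceExpr.value s u v ^ 2 - 4 * normExpr.value s u v)
  have hr0 : r ≠ 0 := fun h0 => h.trace_sq_ne (by rw [hr, h0, mul_zero])
  have hD := h.den_ne_zero
  rw [Finset.card_eq_two]
  refine ⟨(traceExpr.value s u v + r) / (4 * den.value s u v),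
    (traceExpr.value s u v - r) / (4 * den.value s u v), ?_, Finset.ext fun y => ?_⟩
  rotate_left
  · rw [Finset.mem_filter, Multiset.mem_toFinset, mem_roots (dodecicPoly_monic_natDegree _ _).1.ne_zero, IsRoot,
      Finset.mem_insert, Finset.mem_singleton, ← h.quadratic_iff hr.symm y]
    exact and_iff_right_of_imp fun h1 => h.eval_dodecicPoly_neg h1 two_ne_zero
  · intro h1
    rw [div_left_inj' (by simpa using hD)] at h1
    have : 2 * r = 0 := by linear_combination h1
    exact mul_ne_zero two_ne_zero hr0 this

omit [CharZero Ω] [DecidableEq Ω] in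
/-- The second coordinate of the point is determined by the first one. -/
theorem map_eq {f : Ω →+* Ω} (h2 : (2 : Ω) ≠ 0) (hu : f u = u) (ht : f t = t) (hs : f s = s) : f v = v := by
  have h1 := congrArg f h.parameter
  have hp : param.value s u v = (listPoly u parameterEven).eval s + (listPoly u parameterOdd).eval s * v := rfl
  have hd : den.value s u v = (listPoly u denominator).eval s := rfl
  rw [hp, hd] at h1
  simp only [map_mul, map_pow, map_add, map_listPoly_eval, map_ofNat, hu, ht, hs] at h1
  have h3 := h.parameter
  rw [hp, hd, h1] at h3
  have h4 : (2 * 2) * (listPoly u parameterOdd).eval s * (f v - v) = 0 := by linear_combination h3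
  exact sub_eq_zero.1 ((mul_eq_zero.1 h4).resolve_left (mul_ne_zero (mul_ne_zero h2 h2) h.parameterOdd_ne_zero))

end CurvePoint

end CurvePointRoots

section MonodromyAction

open scoped Pointwise

/-- The action of a group on an invariant finite set. -/
@[reducible] def invariantFinsetAction {G X : Type*} [Group G] [MulAction G X] (R : Finset X)
    (hR : ∀ g : G, ∀ x ∈ R, g • x ∈ R) : MulAction G R where
  smul g x := ⟨g • x.1, hR g x x.2⟩
  one_smul x := Subtype.ext (one_smul G x.1)
  mul_smul g h x := Subtype.ext (mul_smul g h x.1)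

theorem card_filter_univ_coe {X : Type*} (R : Finset X) (P : X → Prop) [DecidablePred P] :
    (Finset.univ.filter fun x : R => P x).card = (R.filter P).card := by
  rw [← Finset.card_map (Function.Embedding.subtype _)]
  congr 1
  ext x
  simp [and_comm]

/-- A group element whose `n`-th power fixes the elements of `R`, a set of 12 elements, and whose
`j`-th power fixes exactly `m` of them for each `(j, m)` in the list. -/
def HasFixCounts {G X : Type*} [Group G] [MulAction G X] [DecidableEq X] (g : G) (R : Finset X) (n : ℕ)
    (l : List (ℕ × ℕ)) : Prop :=
  R.card = 12 ∧ (∀ x ∈ R, g ^ n • x = x) ∧ ∀ c ∈ l, (R.filter fun x => g ^ c.1 • x = x).card = c.2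

/-- `twelve_point_actions` for the actions of a group on two invariant finite subsets. -/
theorem twelve_point_actions_finset {G X : Type*} [Group G] [MulAction G X] [DecidableEq X]
    {R R' : Finset X} (hR : ∀ g : G, ∀ x ∈ R, g • x ∈ R) (hR' : ∀ g : G, ∀ x ∈ R', g • x ∈ R')
    {a b c d : G} (ha : HasFixCounts a R 11 [(1, 1)]) (ha' : HasFixCounts a R' 11 [(1, 1)])
    (hb : HasFixCounts b R 10 [(1, 0), (2, 2)]) (hb' : HasFixCounts b R' 10 [(1, 0), (2, 2)])
    (hc : HasFixCounts c R 8 [(1, 2), (2, 4), (4, 4)]) (hd : HasFixCounts d R 6 [(1, 1), (2, 3), (3, 4)])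
    {S : Subgroup G} (hS : S.index ≤ 66) (hS0 : S.index ≠ 0)
    {P : X → Prop} [DecidablePred P] (hP : (R'.filter P).card = 2) (hSP : ∀ g ∈ S, ∀ x, P x → P (g • x))
    {Q : X → Prop} [DecidablePred Q] (hQ : (R.filter Q).card = 6)
    (hSQ : ∀ g ∈ S, (∀ x ∈ R, Q x → Q (g • x)) ∨ ∀ x ∈ R, Q x → ¬ Q (g • x)) :
    ∃ N : Subgroup G, N.index = 95040 ∧ (∀ g, g ∈ N ↔ ∀ x ∈ R, g • x = x) ∧
      ∀ g ∈ N, ∀ y ∈ R', g • y = y := by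
  let := invariantFinsetAction _ hR
  let := invariantFinsetAction _ hR'
  have hfix : ∀ g : G, fixCount (α := R) g = (R.filter fun x => g • x = x).card := fun g => by
    rw [← card_filter_univ_coe]
    unfold fixCount
    congr 1
    exact Finset.filter_congr fun x _ => Subtype.ext_iff
  have hfix' : ∀ g : G, fixCount (α := R') g = (R'.filter fun x => g • x = x).card := fun g => by
    rw [← card_filter_univ_coe]
    unfold fixCount
    congr 1
    exact Finset.filter_congr fun x _ => Subtype.ext_iff
  have hone : ∀ {g : G} {T : Finset X} {n m : ℕ} {l : List (ℕ × ℕ)}, HasFixCounts g T n ((1, m) :: l) →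
      (T.filter fun x => g • x = x).card = m := fun {g T n m l} h => by
    simpa using h.2.2 (1, m) (by simp)
  have key := twelve_point_actions (α := R) (β := R')
    (by rw [Fintype.card_coe, ha.1]) (by rw [Fintype.card_coe, ha'.1])
    ((hfix _).trans (hone ha)) (fun x => Subtype.ext (ha.2.1 x x.2))
    ((hfix' _).trans (hone ha')) (fun x => Subtype.ext (ha'.2.1 x x.2))
    ((hfix _).trans (hone hb)) ((hfix _).trans (hb.2.2 (2, 2) (by simp)))
    (fun x => Subtype.ext (hb.2.1 x x.2))
    ((hfix' _).trans (hone hb')) ((hfix' _).trans (hb'.2.2 (2, 2) (by simp)))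
    ((hfix _).trans (hone hc)) ((hfix _).trans (hc.2.2 (2, 4) (by simp)))
    ((hfix _).trans (hc.2.2 (4, 4) (by simp))) (fun x => Subtype.ext (hc.2.1 x x.2))
    ((hfix _).trans (hone hd)) ((hfix _).trans (hd.2.2 (2, 3) (by simp)))
    ((hfix _).trans (hd.2.2 (3, 4) (by simp))) (fun x => Subtype.ext (hd.2.1 x x.2))
    S hS hS0 (Finset.univ.filter fun y => P y) (by rw [card_filter_univ_coe R' P, hP])
    (Finset.univ.filter fun x => Q x) (by rw [card_filter_univ_coe R Q, hQ]) ?_ ?_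
  · refine ⟨(MulAction.toPermHom G R).ker, by rw [Subgroup.index_ker, key.1], fun g => ?_,
      fun g hg y hy => ?_⟩
    · rw [MonoidHom.mem_ker]
      refine ⟨fun h x hx => congrArg Subtype.val (DFunLike.congr_fun h (⟨x, hx⟩ : R)), fun h => ?_⟩
      ext x
      exact h x x.2
    · exact congrArg Subtype.val (key.2 g (fun x => DFunLike.congr_fun (MonoidHom.mem_ker.1 hg) x) ⟨y, hy⟩)
  · intro g hg
    refine Finset.eq_of_subset_of_card_le (fun y hy => ?_) (Finset.card_smul_finset _ _).ge
    obtain ⟨y, hy', rfl⟩ := Finset.mem_smul_finset.1 hy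
    rw [Finset.mem_filter] at hy' ⊢
    exact ⟨Finset.mem_univ _, hSP g hg _ hy'.2⟩
  · intro g hg
    refine (hSQ g hg).imp (fun h => ?_) fun h => ?_
    · refine Finset.eq_of_subset_of_card_le (fun y hy => ?_) (Finset.card_smul_finset _ _).ge
      obtain ⟨y, hy', rfl⟩ := Finset.mem_smul_finset.1 hy
      rw [Finset.mem_filter] at hy' ⊢
      exact ⟨Finset.mem_univ _, h _ y.2 hy'.2⟩
    · refine Finset.eq_of_subset_of_card_le (fun y hy => ?_) ?_
      · obtain ⟨y, hy', rfl⟩ := Finset.mem_smul_finset.1 hy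
        rw [Finset.mem_compl, Finset.mem_filter]
        exact fun h' => h _ y.2 (Finset.mem_filter.1 hy').2 h'.2
      · rw [Finset.card_smul_finset, Finset.card_compl, Fintype.card_coe, ha.1, card_filter_univ_coe R Q, hQ]

theorem transcendental_algebraMap_X {Ω : Type*} [Field Ω] [CharZero Ω] [Algebra (RatFunc ℚ) Ω] :
    Transcendental ℚ (algebraMap (RatFunc ℚ) Ω RatFunc.X) := by
  rintro ⟨p, hp, hp'⟩
  have h : ∀ f : ℚ →+* RatFunc ℚ, eval₂ f RatFunc.X p = 0 := fun f => by
    refine (algebraMap (RatFunc ℚ) Ω).injective ?_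
    rw [map_zero, ← hp', aeval_def, hom_eval₂]
    congr 1
    exact Subsingleton.elim _ _
  exact RatFunc.transcendental_X (K := ℚ) ⟨p, hp, h _⟩

variable {Ω : Type} [Field Ω] [Algebra (RatFunc ℚ) Ω] [IsAlgClosed Ω]
  {u : Ω} (hu : u ^ 2 = -11) {γ₀ : Ω ≃ₐ[RatFunc ℚ] Ω} (hγ₀ : γ₀ u = -u)

local notation "τ" => algebraMap (RatFunc ℚ) Ω RatFunc.X

include hu hγ₀

theorem exists_fixCounts [IsGalois (RatFunc ℚ) Ω] [DecidableEq Ω] (t₀ : ℕ) :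
    ∃ γ : Ω ≃ₐ[RatFunc ℚ] Ω, γ u = u ∧ ∀ n l,
      (ModularRoots 9 t₀ n l → HasFixCounts γ (dodecicPoly u τ).roots.toFinset n l) ∧
      (ModularRoots 14 t₀ n l → HasFixCounts γ (dodecicPoly (-u) τ).roots.toFinset n l) := by
  obtain ⟨A, κ, _, _, φ, γ, u', t', rfl, ht', hA, hφt, hφu, hγu, hγ⟩ :=
    exists_frobenius_subring hu hγ₀ t₀
  have hγt : γ t' = t' := by rw [ht', γ.commutes]
  refine ⟨γ, hγu, fun n l => ⟨fun hl => ?_, fun hl => ?_⟩⟩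
  · rw [← ht']
    have h := hl.roots_dodecicPoly hA hγu hγt hγ (by rw [hφu]; norm_num) hφt
    exact ⟨h.1, fun x hx => h.2.1 x (Multiset.mem_toFinset.1 hx), h.2.2⟩
  · have h23 : (23 : κ) = 0 := by simpa using CharP.cast_eq_zero κ 23
    rw [← ht', show -(u' : Ω) = ((-u' : A) : Ω) from rfl]
    have h1 : γ ((-u' : A) : Ω) = ((-u' : A) : Ω) := by
      change γ (-(u' : Ω)) = -(u' : Ω)
      rw [map_neg, hγu]
    have h2 : φ (-u') = ((14 : ℕ) : κ) := by
      rw [map_neg, hφu]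
      push_cast
      linear_combination -h23
    have h := hl.roots_dodecicPoly hA h1 hγt hγ h2 hφt
    exact ⟨h.1, fun x hx => h.2.1 x (Multiset.mem_toFinset.1 hx), h.2.2⟩

omit [IsAlgClosed Ω] hu hγ₀ in
theorem eval_dodecicPoly_map {γ : Ω ≃ₐ[RatFunc ℚ] Ω} (hγ : γ u = u) {x : Ω}
    (hx : (dodecicPoly u τ).eval x = 0) : (dodecicPoly u τ).eval (γ x) = 0 := by
  have := congrArg γ hx
  rw [map_zero, eval_dodecicPoly] at this
  simp only [map_add, map_sub, map_mul, map_pow, map_ofNat, hγ, AlgEquiv.commutes] at this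
  rw [eval_dodecicPoly, this]

set_option maxHeartbeats 800000 in
theorem exists_subgroup_index_eq [Algebra.IsAlgebraic (RatFunc ℚ) Ω] :
    ∃ N : Subgroup (MulAction.stabilizer (Ω ≃ₐ[RatFunc ℚ] Ω) u), N.index = 95040 ∧
    (∀ γ, γ ∈ N ↔ ∀ x, (dodecicPoly u τ).eval x = 0 → γ.1 x = x) ∧
    ∀ γ ∈ N, ∀ y, (dodecicPoly (-u) τ).eval y = 0 → γ.1 y = y := by
  classical
  have : CharZero Ω := charZero_of_injective_algebraMap (algebraMap (RatFunc ℚ) Ω).injective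
  have : IsAlgClosure (RatFunc ℚ) Ω := ⟨inferInstance, inferInstance⟩
  have : Normal (RatFunc ℚ) Ω := IsAlgClosure.normal _ _
  have : IsGalois (RatFunc ℚ) Ω := ⟨⟩
  have hroot : ∀ (w x : Ω), x ∈ (dodecicPoly w τ).roots.toFinset ↔ (dodecicPoly w τ).eval x = 0 :=
    fun w x => by
      rw [Multiset.mem_toFinset, mem_roots (dodecicPoly_monic_natDegree _ _).1.ne_zero, IsRoot]
  have hinv : ∀ w : Ω, ∀ γ : MulAction.stabilizer (Ω ≃ₐ[RatFunc ℚ] Ω) u, γ.1 w = w →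
      ∀ x ∈ (dodecicPoly w τ).roots.toFinset, γ • x ∈ (dodecicPoly w τ).roots.toFinset :=
    fun w γ hw x hx => (hroot _ _).2 (eval_dodecicPoly_map hw ((hroot _ _).1 hx))
  obtain ⟨a, ha, ha'⟩ := exists_fixCounts hu hγ₀ 2
  obtain ⟨b, hb, hb'⟩ := exists_fixCounts hu hγ₀ 8
  obtain ⟨c, hc, hc'⟩ := exists_fixCounts hu hγ₀ 3
  obtain ⟨d, hd, hd'⟩ := exists_fixCounts hu hγ₀ 4
  have a1 := (ha' _ _).1 modularRoots_two_nine
  obtain ⟨s, hs, hs'⟩ := exists_transcendental_root_resolventPoly hu (transcendental_algebraMap_X (Ω := Ω))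
  obtain ⟨v, hv⟩ := exists_curvePoint hu hs hs'
  obtain ⟨δ, hδ⟩ := IsAlgClosed.exists_pow_nat_eq (CurveData.disc.value s u v) two_pos
  have hγv : ∀ γ : MulAction.stabilizer (Ω ≃ₐ[RatFunc ℚ] Ω) u, γ.1 s = s → γ.1 v = v := fun γ h =>
    hv.map_eq (f := γ.1.toAlgHom.toRingHom) two_ne_zero γ.2 (γ.1.commutes _) h
  have hval : ∀ γ : MulAction.stabilizer (Ω ≃ₐ[RatFunc ℚ] Ω) u, γ.1 s = s → ∀ x : CurveExpr,
      γ.1 (x.value s u v) = x.value s u v := fun γ h x => by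
    have h1 := CurveExpr.map_value (s := s) (u := u) (v := v) γ.1.toAlgHom.toRingHom x
    have h2 : γ.1 u = u := γ.2
    change γ.1 _ = x.value (γ.1 s) (γ.1 u) (γ.1 v) at h1
    rw [h1, h, h2, hγv γ h]
  have heval : ∀ γ : MulAction.stabilizer (Ω ≃ₐ[RatFunc ℚ] Ω) u, γ.1 s = s → ∀ y (l : List CurveExpr),
      γ.1 (CurveExpr.evalList s u v y l) = CurveExpr.evalList s u v (γ.1 y) l := fun γ h y l => by
    have h1 := CurveExpr.map_evalList (s := s) (u := u) (v := v) γ.1.toAlgHom.toRingHom (y := y) l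
    have h2 : γ.1 u = u := γ.2
    change γ.1 _ = CurveExpr.evalList (γ.1 s) (γ.1 u) (γ.1 v) (γ.1 y) l at h1
    rw [h1, h, h2, hγv γ h]
  have hres : resolventPoly u τ ≠ 0 := fun h => by
    simpa [h] using (resolventPoly_spec u τ).1
  have horbit : MulAction.orbit (MulAction.stabilizer (Ω ≃ₐ[RatFunc ℚ] Ω) u) s ⊆
      (resolventPoly u τ).roots.toFinset := by
    rintro _ ⟨γ, rfl⟩
    rw [Finset.mem_coe, Multiset.mem_toFinset, mem_roots hres, IsRoot]
    have h1 := congrArg γ.1 hs'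
    have h2 : γ.1 u = u := γ.2
    have h3 : ∀ L : List (ℤ × ℤ), γ.1 ((listPoly u L).eval s) = (listPoly u L).eval (γ.1 s) := fun L => by
      have h := CurveExpr.map_listPoly_eval (s := s) (u := u) γ.1.toAlgHom.toRingHom L
      change γ.1 _ = (listPoly (γ.1 u) L).eval (γ.1 s) at h
      rw [h, h2]
    rw [eval_resolventPoly, map_zero] at h1
    simp only [map_add, map_sub, map_mul, map_pow, map_ofNat, h3, AlgEquiv.commutes] at h1
    exact (eval_resolventPoly _ _ _).trans h1
  have hindex : (MulAction.stabilizer (MulAction.stabilizer (Ω ≃ₐ[RatFunc ℚ] Ω) u) s).index ≤ 66 ∧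
      (MulAction.stabilizer (MulAction.stabilizer (Ω ≃ₐ[RatFunc ℚ] Ω) u) s).index ≠ 0 := by
    rw [MulAction.index_stabilizer]
    constructor
    · refine (Set.ncard_le_ncard horbit (Finset.finite_toSet _)).trans ?_
      rw [Set.ncard_coe_finset, ← (resolventPoly_spec u τ).1]
      exact (Multiset.toFinset_card_le _).trans (card_roots' _)
    · exact ((Set.ncard_pos ((Finset.finite_toSet _).subset horbit)).2 ⟨s, MulAction.mem_orbit_self s⟩).ne'
  have hhalves := hv.halves hδ a1.1
  have hP : ∀ γ ∈ MulAction.stabilizer (MulAction.stabilizer (Ω ≃ₐ[RatFunc ℚ] Ω) u) s, ∀ y : Ω,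
      (2 * CurveData.den.value s u v * y) ^ 2 =
        CurveData.traceExpr.value s u v * (2 * CurveData.den.value s u v * y) - CurveData.normExpr.value s u v →
      (2 * CurveData.den.value s u v * γ • y) ^ 2 = CurveData.traceExpr.value s u v *
        (2 * CurveData.den.value s u v * γ • y) - CurveData.normExpr.value s u v := fun γ hγ y hy => by
    have h := congrArg γ.1 hy
    simp only [map_sub, map_mul, map_pow, map_ofNat, hval γ hγ] at h
    exact h
  have hQ : ∀ γ ∈ MulAction.stabilizer (MulAction.stabilizer (Ω ≃ₐ[RatFunc ℚ] Ω) u) s,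
      (∀ x ∈ (dodecicPoly u τ).roots.toFinset,
        δ * CurveExpr.evalList s u v (CurveData.den.value s u v * x) CurveData.sextic =
          CurveExpr.evalList s u v (CurveData.den.value s u v * x) CurveData.quintic →
        δ * CurveExpr.evalList s u v (CurveData.den.value s u v * γ • x) CurveData.sextic =
          CurveExpr.evalList s u v (CurveData.den.value s u v * γ • x) CurveData.quintic) ∨
      ∀ x ∈ (dodecicPoly u τ).roots.toFinset,
        δ * CurveExpr.evalList s u v (CurveData.den.value s u v * x) CurveData.sextic =
          CurveExpr.evalList s u v (CurveData.den.value s u v * x) CurveData.quintic →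
        ¬ δ * CurveExpr.evalList s u v (CurveData.den.value s u v * γ • x) CurveData.sextic =
          CurveExpr.evalList s u v (CurveData.den.value s u v * γ • x) CurveData.quintic := fun γ hγ => by
    have h1 : ∀ x : Ω, δ * CurveExpr.evalList s u v (CurveData.den.value s u v * x) CurveData.sextic =
        CurveExpr.evalList s u v (CurveData.den.value s u v * x) CurveData.quintic →
        γ.1 δ * CurveExpr.evalList s u v (CurveData.den.value s u v * γ.1 x) CurveData.sextic =
        CurveExpr.evalList s u v (CurveData.den.value s u v * γ.1 x) CurveData.quintic := fun x hx => by
      have h := congrArg γ.1 hx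
      rwa [map_mul, heval γ hγ, heval γ hγ, map_mul, hval γ hγ] at h
    have h2 : γ.1 δ = δ ∨ γ.1 δ = -δ := by
      rw [← sq_eq_sq_iff_eq_or_eq_neg, ← map_pow, hδ, hval γ hγ]
    refine h2.imp (fun h2 x hx h3 => ?_) fun h2 x hx h3 => ?_
    · have h := h1 x h3
      rwa [h2] at h
    · have h := h1 x h3
      rw [h2] at h
      exact (hhalves.2 _ (hinv u γ γ.2 x hx)).1 h
  obtain ⟨N, hN, hN1, hN2⟩ := twelve_point_actions_finset (G := MulAction.stabilizer (Ω ≃ₐ[RatFunc ℚ] Ω) u)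
    (a := ⟨a, ha⟩) (b := ⟨b, hb⟩) (c := ⟨c, hc⟩) (d := ⟨d, hd⟩)
    (fun γ => hinv u γ γ.2) (fun γ => hinv (-u) γ (by rw [map_neg, show γ.1 u = u from γ.2])) a1
    ((ha' _ _).2 modularRoots_two_fourteen) ((hb' _ _).1 modularRoots_eight_nine)
    ((hb' _ _).2 modularRoots_eight_fourteen) ((hc' _ _).1 modularRoots_three_nine)
    ((hd' _ _).1 modularRoots_four_nine) hindex.1 hindex.2 hv.card_filter_quadratic
    hP hhalves.1 hQ
  exact ⟨N, hN, fun γ => (hN1 γ).trans (forall_congr' fun x => by rw [hroot]; rfl),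
    fun γ hγ y hy => hN2 γ hγ y ((hroot _ _).2 hy)⟩

end MonodromyAction

section GaloisGroup

theorem card_gal_eq_index {F E : Type*} [Field F] [Field E] [Algebra F E] [IsAlgClosed E] [Normal F E]
    {p : F[X]} (hp : p ≠ 0) {M : Subgroup (E ≃ₐ[F] E)}
    (hM : ∀ γ, γ ∈ M ↔ ∀ x, aeval x p = 0 → γ x = x) : Nat.card p.Gal = M.index := by
  have : Fact ((p.map (algebraMap F E)).Splits) := ⟨IsAlgClosed.splits _⟩
  have hker : (Gal.restrict p E).ker = M := by
    ext γ
    rw [MonoidHom.mem_ker, hM, ← (Gal.galActionHom_injective p E).eq_iff, map_one]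
    constructor
    · intro h x hx
      have h1 := Gal.galActionHom_restrict p E γ ⟨x, mem_rootSet.2 ⟨hp, hx⟩⟩
      rw [h] at h1
      exact h1.symm
    · intro h
      ext x
      rw [Gal.galActionHom_restrict, h x (mem_rootSet.1 x.2).2]
      rfl
  rw [← hker, Subgroup.index_ker, MonoidHom.range_eq_top.2 (Gal.restrict_surjective p E), Subgroup.card_top]

theorem ratFunc_sq_ne_neg_eleven (r : RatFunc ℚ) : r ^ 2 ≠ -11 := by
  intro hr
  have h1 : IsIntegral ℚ[X] r := by
    refine ⟨X ^ 2 + C 11, ?_, ?_⟩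
    · exact (monic_X_pow_add_C (11 : ℚ[X]) two_ne_zero)
    · rw [eval₂_add, eval₂_pow, eval₂_X, eval₂_C, hr, map_ofNat]
      ring
  obtain ⟨p, rfl⟩ := IsIntegrallyClosed.algebraMap_eq_of_integral h1
  have h2 : p ^ 2 = -11 := RatFunc.algebraMap_injective ℚ (by
    rw [map_pow, hr, map_neg, map_ofNat])
  have h3 := congrArg (eval 0) h2
  simp only [eval_pow, eval_neg, eval_ofNat] at h3
  nlinarith [sq_nonneg (eval 0 p)]

/-- The norm from `ℚ(√-11)(t)` to `ℚ(t)` of the polynomial defining the `M₁₂`-extension. -/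
noncomputable def normPoly {R : Type*} [CommRing R] (t : R) : R[X] :=
  let A : R[X] := -2 * X ^ 3 - 54 * X ^ 2 - 321 * X - 83
  let B : R[X] := 21 * X + 13
  let A' : R[X] := -2 * X ^ 3 - 102 * X ^ 2 - 1713 * X - 10043
  let B' : R[X] := 69 * X + 1573
  ((A ^ 3 - 33 * A * B ^ 2) * A' - 11 * (3 * A ^ 2 * B - 11 * B ^ 3) * B' + 2 ^ 9 * 3 ^ 12 * 67 * C t * X) ^ 2 +
  11 * ((A ^ 3 - 33 * A * B ^ 2) * B' + (3 * A ^ 2 * B - 11 * B ^ 3) * A' + 2 ^ 9 * 3 ^ 12 * 253 * C t * X) ^ 2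

theorem map_normPoly {R S : Type*} [CommRing R] [CommRing S] (f : R →+* S) (t : R) :
    (normPoly t).map f = normPoly (f t) := by
  simp only [normPoly, Polynomial.map_add, Polynomial.map_sub, Polynomial.map_mul, Polynomial.map_pow,
    Polynomial.map_neg, Polynomial.map_ofNat, map_C, map_X]

theorem norm_cube_mul_add {R : Type*} [CommRing R] {u : R} (hu : u ^ 2 = -11) (A B A' B' c d : R) :
    ((A ^ 3 - 33 * A * B ^ 2) * A' - 11 * (3 * A ^ 2 * B - 11 * B ^ 3) * B' + c) ^ 2 +
      11 * ((A ^ 3 - 33 * A * B ^ 2) * B' + (3 * A ^ 2 * B - 11 * B ^ 3) * A' + d) ^ 2 =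
    ((A + u * B) ^ 3 * (A' + u * B') + (c + u * d)) * ((A - u * B) ^ 3 * (A' - u * B') + (c - u * d)) := by
  have h3 : u ^ 3 = -11 * u := by linear_combination u * hu
  have h4 : u ^ 4 = 121 := by linear_combination (u ^ 2 - 11) * hu
  have e1 : (A + u * B) ^ 3 * (A' + u * B') + (c + u * d) =
      ((A ^ 3 - 33 * A * B ^ 2) * A' - 11 * (3 * A ^ 2 * B - 11 * B ^ 3) * B' + c) +
      u * ((A ^ 3 - 33 * A * B ^ 2) * B' + (3 * A ^ 2 * B - 11 * B ^ 3) * A' + d) := by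
    linear_combination (3 * A * B ^ 2 * A' + 3 * A ^ 2 * B * B') * hu +
      (B ^ 3 * A' + 3 * A * B ^ 2 * B') * h3 + B ^ 3 * B' * h4
  have e2 : (A - u * B) ^ 3 * (A' - u * B') + (c - u * d) =
      ((A ^ 3 - 33 * A * B ^ 2) * A' - 11 * (3 * A ^ 2 * B - 11 * B ^ 3) * B' + c) -
      u * ((A ^ 3 - 33 * A * B ^ 2) * B' + (3 * A ^ 2 * B - 11 * B ^ 3) * A' + d) := by
    linear_combination (3 * A * B ^ 2 * A' + 3 * A ^ 2 * B * B') * hu -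
      (B ^ 3 * A' + 3 * A * B ^ 2 * B') * h3 + B ^ 3 * B' * h4
  rw [e1, e2]
  linear_combination (((A ^ 3 - 33 * A * B ^ 2) * B' + (3 * A ^ 2 * B - 11 * B ^ 3) * A' + d) ^ 2) * hu

theorem eval_normPoly {R : Type*} [CommRing R] {u : R} (hu : u ^ 2 = -11) (t x : R) :
    2 ^ 16 * (normPoly t).eval x =
      (dodecicPoly u t).eval (2 * x) * (dodecicPoly (-u) t).eval (2 * x) := by
  rw [eval_dodecicPoly, eval_dodecicPoly]
  simp only [normPoly, eval_add, eval_sub, eval_mul, eval_pow, eval_neg, eval_ofNat, eval_C, eval_X]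
  rw [norm_cube_mul_add hu]
  ring

variable {Ω : Type} [Field Ω] [Algebra (RatFunc ℚ) Ω] [IsAlgClosed Ω]

local notation "τ" => algebraMap (RatFunc ℚ) Ω RatFunc.X

omit [IsAlgClosed Ω] in
theorem exists_map_eq_neg [IsGalois (RatFunc ℚ) Ω] {u : Ω} (hu : u ^ 2 = -11) :
    ∃ γ : Ω ≃ₐ[RatFunc ℚ] Ω, γ u = -u := by
  by_contra! h
  have h1 : ∀ γ : Ω ≃ₐ[RatFunc ℚ] Ω, γ u = u := fun γ => by
    have h2 : γ u ^ 2 = u ^ 2 := by rw [← map_pow, hu, map_neg, map_ofNat]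
    exact (sq_eq_sq_iff_eq_or_eq_neg.1 h2).resolve_right (h γ)
  obtain ⟨r, rfl⟩ := (InfiniteGalois.mem_range_algebraMap_iff_fixed u).2 h1
  refine ratFunc_sq_ne_neg_eleven r ((algebraMap (RatFunc ℚ) Ω).injective ?_)
  rw [map_pow, hu, map_neg, map_ofNat]

omit [IsAlgClosed Ω] in
theorem index_stabilizer_eq_two [CharZero Ω] {u : Ω} (hu : u ^ 2 = -11) {γ₀ : Ω ≃ₐ[RatFunc ℚ] Ω}
    (hγ₀ : γ₀ u = -u) : (MulAction.stabilizer (Ω ≃ₐ[RatFunc ℚ] Ω) u).index = 2 := by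
  have h : MulAction.orbit (Ω ≃ₐ[RatFunc ℚ] Ω) u = {u, -u} := by
    ext x
    constructor
    · rintro ⟨γ, rfl⟩
      have h2 : γ u ^ 2 = u ^ 2 := by rw [← map_pow, hu, map_neg, map_ofNat]
      exact sq_eq_sq_iff_eq_or_eq_neg.1 h2
    · rintro (rfl | rfl)
      · exact MulAction.mem_orbit_self x
      · exact ⟨γ₀, hγ₀⟩
  rw [MulAction.index_stabilizer, h, Set.ncard_pair]
  intro h
  have h0 : u = 0 := self_eq_neg.1 h
  rw [h0] at hu
  norm_num at hu

theorem map_eq_of_map_roots_eq [CharZero Ω] {u : Ω} (hu : u ^ 2 = -11) {γ : Ω ≃ₐ[RatFunc ℚ] Ω}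
    (hγ : ∀ x, (dodecicPoly u τ).eval x = 0 → γ x = x) : γ u = u := by
  have h1 : γ u ^ 2 = u ^ 2 := by rw [← map_pow, hu, map_neg, map_ofNat]
  refine (sq_eq_sq_iff_eq_or_eq_neg.1 h1).resolve_right fun h => ?_
  have hm := (dodecicPoly_monic_natDegree u τ).1
  have h2 : (dodecicPoly u τ).map (γ : Ω →+* Ω) = dodecicPoly u τ := by
    conv_lhs => rw [(IsAlgClosed.splits (dodecicPoly u τ)).eq_prod_roots_of_monic hm]
    conv_rhs => rw [(IsAlgClosed.splits (dodecicPoly u τ)).eq_prod_roots_of_monic hm]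
    rw [Polynomial.map_multiset_prod, Multiset.map_map]
    refine congrArg Multiset.prod (Multiset.map_congr rfl fun x hx => ?_)
    rw [Function.comp_apply, Polynomial.map_sub, map_X, map_C]
    congr 2
    exact hγ x ((mem_roots hm.ne_zero).1 hx)
  rw [map_dodecicPoly] at h2
  have h3 : dodecicPoly (-u) τ = dodecicPoly u τ := by
    rw [← h2]
    congr 1
    · exact h.symm
    · exact (γ.commutes _).symm
  have h4 := congrArg (eval 0) h3
  rw [eval_dodecicPoly, eval_dodecicPoly] at h4
  have h5 : u = 0 := by
    have h6 : (4 ^ 4 * 121 * 8 * 83 * 13 * 5030 : Ω) * u = 0 := by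
      linear_combination h4 - 4 ^ 4 * 121 * 8 * 83 * 13 ^ 3 * u * hu
    exact (mul_eq_zero.1 h6).resolve_left (by norm_num)
  rw [h5] at hu
  norm_num at hu

omit [Algebra (RatFunc ℚ) Ω] [IsAlgClosed Ω] in
theorem eval_zero_dodecicPoly_ne_zero [CharZero Ω] {u : Ω} (hu : u ^ 2 = -11) (t : Ω) :
    (dodecicPoly u t).eval 0 ≠ 0 := by
  intro h
  rw [eval_dodecicPoly] at h
  have h1 : (4 ^ 4 * 121 : Ω) * (83 - 13 * u) ^ 4 = 0 := by linear_combination h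
  have h2 : 83 - 13 * u = 0 := eq_zero_of_pow_eq_zero ((mul_eq_zero.1 h1).resolve_left (by norm_num))
  have h3 : (8748 : Ω) = 0 := by linear_combination (83 + 13 * u) * h2 + 169 * hu
  norm_num at h3

variable (Ω) in
theorem card_gal_normPoly_aux [Algebra.IsAlgebraic (RatFunc ℚ) Ω] :
    Nat.card (normPoly (RatFunc.X : RatFunc ℚ)).Gal = 190080 := by
  have : CharZero Ω := charZero_of_injective_algebraMap (algebraMap (RatFunc ℚ) Ω).injective
  have : IsAlgClosure (RatFunc ℚ) Ω := ⟨inferInstance, inferInstance⟩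
  have : Normal (RatFunc ℚ) Ω := IsAlgClosure.normal _ _
  have : IsGalois (RatFunc ℚ) Ω := ⟨⟩
  obtain ⟨u, hu⟩ : ∃ u : Ω, u ^ 2 = -11 := IsAlgClosed.exists_pow_nat_eq _ two_pos
  obtain ⟨γ₀, hγ₀⟩ := exists_map_eq_neg hu
  obtain ⟨N, hN, hN1, hN2⟩ := exists_subgroup_index_eq hu hγ₀
  have hroot : ∀ x : Ω, aeval x (normPoly (RatFunc.X : RatFunc ℚ)) = 0 ↔
      (dodecicPoly u τ).eval (2 * x) = 0 ∨ (dodecicPoly (-u) τ).eval (2 * x) = 0 := fun x => by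
    rw [← mul_eq_zero, ← eval_normPoly hu, mul_eq_zero_iff_left (by norm_num : (2 : Ω) ^ 16 ≠ 0),
      aeval_def, eval₂_eq_eval_map, map_normPoly]
  have hp : normPoly (RatFunc.X : RatFunc ℚ) ≠ 0 := fun h => by
    have h1 := (hroot 0).1 (by rw [h, map_zero])
    rw [mul_zero] at h1
    exact h1.elim (eval_zero_dodecicPoly_ne_zero hu _) (eval_zero_dodecicPoly_ne_zero (by rwa [neg_sq]) _)
  have h2 : ∀ (γ : Ω ≃ₐ[RatFunc ℚ] Ω) (x : Ω), γ (2 * x) = 2 * x ↔ γ x = x := fun γ x => by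
    rw [map_mul, map_ofNat, mul_right_inj' (two_ne_zero (α := Ω))]
  have h3 : ∀ x : Ω, 2 * (x / 2) = x := fun x => mul_div_cancel₀ _ two_ne_zero
  rw [card_gal_eq_index hp (M := N.map (MulAction.stabilizer (Ω ≃ₐ[RatFunc ℚ] Ω) u).subtype)
    fun γ => ⟨?_, fun h => ?_⟩, Subgroup.index_map_subtype, hN, index_stabilizer_eq_two hu hγ₀]
  · rintro ⟨γ, hγ, rfl⟩ x hx
    rw [← h2]
    exact ((hroot x).1 hx).elim ((hN1 γ).1 hγ _) (hN2 γ hγ _)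
  · have h4 : ∀ x, (dodecicPoly u τ).eval x = 0 → γ x = x := fun x hx => by
      rw [← h3 x, h2]
      exact h _ ((hroot _).2 (Or.inl (by rwa [h3])))
    exact ⟨⟨γ, map_eq_of_map_roots_eq hu h4⟩, (hN1 _).2 h4, rfl⟩

theorem card_gal_normPoly : Nat.card (normPoly (RatFunc.X : RatFunc ℚ)).Gal = 190080 :=
  card_gal_normPoly_aux (AlgebraicClosure (RatFunc ℚ))

theorem ratFunc_mapRingHom_algebraMap {K L : Type*} [Field K] [Field L] (f : K[X] →+* L[X])
    (hf : nonZeroDivisors K[X] ≤ (nonZeroDivisors L[X]).comap f) (p : K[X]) :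
    RatFunc.mapRingHom f hf (algebraMap K[X] (RatFunc K) p) = algebraMap L[X] (RatFunc L) (f p) := by
  have h := RatFunc.map_apply_div f hf p 1
  rwa [map_one, map_one, div_one, map_one, div_one] at h

end GaloisGroup

/-- Let `K = ℚ(√-11)`, `u = √-11`, and `σ` the nontrivial automorphism of
`K/ℚ`.  The polynomial `f_{C2} = f_C · σf_C` has coefficients in `ℚ(t)` and its Galois group
over `ℚ(t)` has order `190080`, the order of `M₁₂.2 = Aut(M₁₂)`. -/
theorem galois_group_of_fC2_has_card_M12_2 (K : Type) [Field K] [Algebra ℚ K]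
    (u : K) (hu : u ^ 2 = -11) (hgen : IntermediateField.adjoin ℚ {u} = ⊤)
    (σ : K ≃ₐ[ℚ] K) (hσ : σ u = -u) :
    -- the extension of `σ` to `K(t)` fixing `t`, used to conjugate coefficients
    let sigmaT : RatFunc K →+* RatFunc K :=
      RatFunc.mapRingHom (Polynomial.mapRingHom (σ : K →+* K))
        (nonZeroDivisors_le_comap_nonZeroDivisors_of_injective _
          (Polynomial.map_injective _ (RingHom.injective _)))
    -- the inclusion `ℚ(t) → K(t)`
    let ι : RatFunc ℚ →+* RatFunc K :=
      RatFunc.mapRingHom (Polynomial.mapRingHom (algebraMap ℚ K))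
        (nonZeroDivisors_le_comap_nonZeroDivisors_of_injective _
          (Polynomial.map_injective _ (RingHom.injective _)))
    let U : Polynomial (RatFunc K) := C (RatFunc.C u)
    let t : Polynomial (RatFunc K) := C RatFunc.X
    let fC : Polynomial (RatFunc K) :=
      (21 * U * X + 13 * U - 2 * X ^ 3 - 54 * X ^ 2 - 321 * X - 83) ^ 3
          * (69 * U * X + 1573 * U - 2 * X ^ 3 - 102 * X ^ 2 - 1713 * X - 10043)
        + 2 ^ 9 * 3 ^ 12 * (253 * U + 67) * t * X
    let fC2 : Polynomial (RatFunc K) := fC * fC.map sigmaT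
    ∃ g : Polynomial (RatFunc ℚ), g.map ι = fC2 ∧ Nat.card g.Gal = 190080 := by
  intro sigmaT ι U t fC fC2
  refine ⟨normPoly RatFunc.X, ?_, card_gal_normPoly⟩
  have hι : ι RatFunc.X = RatFunc.X := by
    rw [← RatFunc.algebraMap_X, ratFunc_mapRingHom_algebraMap, coe_mapRingHom, map_X]
    rfl
  have h1 : sigmaT RatFunc.X = RatFunc.X := by
    rw [← RatFunc.algebraMap_X, ratFunc_mapRingHom_algebraMap, coe_mapRingHom, map_X]
  have h2 : sigmaT (RatFunc.C u) = -RatFunc.C u := by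
    rw [← RatFunc.algebraMap_C, ratFunc_mapRingHom_algebraMap, coe_mapRingHom, map_C,
      ← map_neg, ← C_neg]
    congr 2
  have hU : U ^ 2 = -11 := by
    rw [← C_pow, ← map_pow, hu, map_neg, map_ofNat, C_neg, map_ofNat]
  have h3 : fC.map sigmaT = (-21 * U * X - 13 * U - 2 * X ^ 3 - 54 * X ^ 2 - 321 * X - 83) ^ 3
          * (-69 * U * X - 1573 * U - 2 * X ^ 3 - 102 * X ^ 2 - 1713 * X - 10043)
        + 2 ^ 9 * 3 ^ 12 * (-253 * U + 67) * t * X := by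
    simp only [fC, U, t, Polynomial.map_add, Polynomial.map_sub, Polynomial.map_mul, Polynomial.map_pow,
      Polynomial.map_ofNat, map_C, map_X, h1, h2, C_neg]
    ring
  rw [map_normPoly, hι]
  change _ = fC * fC.map sigmaT
  rw [h3]
  simp only [normPoly]
  rw [norm_cube_mul_add hU]
  ring
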